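/- arXiv:2402.01085 — 6 statements merged into one kernel-verified Lean document; each statement's English description precedes it below -/
import Mathlib

section
/- For any two real n×n matrices X and Y, the squared Frobenius norm of the commutator [X,Y] = XY - YX satisfies ‖[X,Y]‖² ≤ 2‖X‖²‖Y‖². -/
open Matrix

/-- squared Frobenius norm -/
def bwN {n : ℕ} (M : Matrix (Fin n) (Fin n) ℝ) : ℝ := trace (M * Mᵀ)

lemma bwN_eq {n : ℕ} (M : Matrix (Fin n) (Fin n) ℝ) : bwN M = ∑ i, ∑ j, M i j ^ 2 := by
  simp [bwN, trace, Matrix.mul_apply, sq]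

lemma bwN_nonneg {n : ℕ} (M : Matrix (Fin n) (Fin n) ℝ) : 0 ≤ bwN M := by
  rw [bwN_eq]; positivity

lemma bwN_transpose {n : ℕ} (M : Matrix (Fin n) (Fin n) ℝ) : bwN Mᵀ = bwN M := by
  rw [bwN, bwN, transpose_transpose, trace_mul_comm]

lemma bwN_add {n : ℕ} (M K : Matrix (Fin n) (Fin n) ℝ) :
    bwN (M + K) = bwN M + 2 * trace (M * Kᵀ) + bwN K := by
  have h : trace (K * Mᵀ) = trace (M * Kᵀ) := by
    rw [← trace_transpose, transpose_mul, transpose_transpose]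
  simp only [bwN, transpose_add, mul_add, add_mul, trace_add, h]; ring

lemma bwN_sub {n : ℕ} (M K : Matrix (Fin n) (Fin n) ℝ) :
    bwN (M - K) = bwN M - 2 * trace (M * Kᵀ) + bwN K := by
  have h : trace (K * Mᵀ) = trace (M * Kᵀ) := by
    rw [← trace_transpose, transpose_mul, transpose_transpose]
  simp only [bwN, transpose_sub, mul_sub, sub_mul, trace_sub, h]; ring

lemma bw_identity {n : ℕ} (P Y : Matrix (Fin n) (Fin n) ℝ) :
    bwN (P * Y - Y * P) + bwN (Pᵀ * Y + Y * Pᵀ) =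
      bwN (P * Y) + bwN (Pᵀ * Y) + bwN (P * Yᵀ) + bwN (Pᵀ * Yᵀ) := by
  have h1 : bwN (Y * P) = bwN (Pᵀ * Yᵀ) := by rw [← bwN_transpose, transpose_mul]
  have h2 : bwN (Y * Pᵀ) = bwN (P * Yᵀ) := by
    rw [← bwN_transpose, transpose_mul, transpose_transpose]
  have h3 : trace (P * Y * (Y * P)ᵀ) = trace (Pᵀ * Y * (Y * Pᵀ)ᵀ) := by
    rw [← trace_transpose]
    simp only [transpose_mul, transpose_transpose, ← mul_assoc]
    rw [trace_mul_comm]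
    simp only [← mul_assoc]
  rw [bwN_sub, bwN_add, h1, h2, h3]; ring

lemma bw_par {n : ℕ} (M K : Matrix (Fin n) (Fin n) ℝ) :
    bwN M + bwN K = 2 * (bwN ((1/2 : ℝ) • (M + K)) + bwN ((1/2 : ℝ) • (M - K))) := by
  simp only [bwN_eq, Finset.mul_sum, ← Finset.sum_add_distrib, Matrix.smul_apply,
    Matrix.add_apply, Matrix.sub_apply, smul_eq_mul]
  refine Finset.sum_congr rfl fun i _ => Finset.sum_congr rfl fun j _ => ?_
  ring

lemma bw_scalar {n : ℕ} (a : Fin n → ℝ) :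
    ∃ c : ℝ, ∀ i, (a i - c) ^ 2 ≤ (1/2) * ∑ j, a j ^ 2 := by
  rcases isEmpty_or_nonempty (Fin n) with h | h
  · exact ⟨0, fun i => h.elim i⟩
  obtain ⟨m, hm⟩ := Finite.exists_min a
  set R := √((1/2) * ∑ j, a j ^ 2) with hR
  have hS : 0 ≤ (1/2) * ∑ j, a j ^ 2 := by positivity
  have hR2 : R ^ 2 = (1/2) * ∑ j, a j ^ 2 := Real.sq_sqrt hS
  have hR0 : 0 ≤ R := Real.sqrt_nonneg _
  refine ⟨a m + R, fun i => ?_⟩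
  rw [← hR2]
  have h1 := hm i
  have h2 : a i - a m ≤ 2 * R := by
    refine le_of_sq_le_sq ?_ (by positivity)
    by_cases him : i = m
    · subst him; simp; positivity
    have : a i ^ 2 + a m ^ 2 ≤ ∑ j, a j ^ 2 := by
      rw [← Finset.sum_pair (f := fun j => a j ^ 2) him]
      exact Finset.sum_le_sum_of_subset_of_nonneg (Finset.subset_univ _)
        (fun _ _ _ => sq_nonneg _)
    nlinarith [sq_nonneg (a i + a m)]
  apply sq_le_sq' <;> linarith

lemma bwN_orth {n : ℕ} (U M : Matrix (Fin n) (Fin n) ℝ) (h : Uᵀ * U = 1) :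
    bwN (U * M) = bwN M := by
  rw [bwN, transpose_mul, trace_mul_comm]
  rw [mul_assoc, ← mul_assoc Uᵀ, h, one_mul, trace_mul_comm, bwN]

lemma bw_sym {n : ℕ} (A : Matrix (Fin n) (Fin n) ℝ) (hA : Aᵀ = A) :
    ∃ c : ℝ, ∀ Z, bwN ((A - c • 1) * Z) ≤ (1/2) * bwN A * bwN Z := by
  have hH : A.IsHermitian := by
    rw [Matrix.IsHermitian, conjTranspose_eq_transpose_of_trivial, hA]
  obtain ⟨U, a, hU, hU', hD⟩ : ∃ (U : Matrix (Fin n) (Fin n) ℝ) (a : Fin n → ℝ),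
      Uᵀ * U = 1 ∧ U * Uᵀ = 1 ∧ A = U * diagonal a * Uᵀ := by
    have hU := hH.eigenvectorUnitary.2
    rw [Matrix.mem_unitaryGroup_iff'] at hU
    have hU' : (hH.eigenvectorUnitary : Matrix (Fin n) (Fin n) ℝ)ᵀ * hH.eigenvectorUnitary = 1 := by
      simpa [star_eq_conjTranspose, conjTranspose_eq_transpose_of_trivial] using hU
    refine ⟨hH.eigenvectorUnitary, hH.eigenvalues, hU', mul_eq_one_comm.mp hU', ?_⟩
    have := hH.spectral_theorem
    simpa [Unitary.conjStarAlgAut_apply, star_eq_conjTranspose,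
      conjTranspose_eq_transpose_of_trivial, Function.comp_def] using this
  obtain ⟨c, hc⟩ := bw_scalar a
  have hNA : bwN A = ∑ j, a j ^ 2 := by
    rw [hD, mul_assoc, bwN_orth _ _ hU, ← bwN_transpose, transpose_mul, transpose_transpose,
      bwN_orth _ _ hU, bwN]
    simp [trace, sq]
  refine ⟨c, fun Z => ?_⟩
  have e : (A - c • 1) * Z = U * (diagonal (fun i => a i - c) * (Uᵀ * Z)) := by
    have : (diagonal (fun i => a i - c) : Matrix (Fin n) (Fin n) ℝ) = diagonal a - c • 1 := by
      rw [smul_one_eq_diagonal, diagonal_sub]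
    rw [this, hD]
    simp only [sub_mul, mul_sub, smul_mul_assoc, mul_smul_comm, one_mul, ← mul_assoc, hU']
  have hZ : bwN Z = bwN (Uᵀ * Z) := by
    rw [bwN_orth]; rwa [transpose_transpose]
  rw [e, bwN_orth _ _ hU, hZ, hNA, bwN_eq, bwN_eq, Finset.mul_sum]
  refine Finset.sum_le_sum fun i _ => ?_
  rw [Finset.mul_sum]
  refine Finset.sum_le_sum fun j _ => ?_
  rw [diagonal_mul, mul_pow]
  exact mul_le_mul_of_nonneg_right (hc i) (sq_nonneg _)

lemma bw_skew_vec {n : ℕ} (B : Matrix (Fin n) (Fin n) ℝ) (hB : Bᵀ = -B) (v : Fin n → ℝ) :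
    ∑ i, (B *ᵥ v) i ^ 2 ≤ (1/2) * bwN B * ∑ i, v i ^ 2 := by
  set w := B *ᵥ v with hw
  have hwi : ∀ i, w i = ∑ j, B i j * v j := fun i => rfl
  have hBa : ∀ i j, B j i = - B i j := fun i j => congrFun (congrFun hB i) j
  set W := ∑ i, w i ^ 2 with hW
  set V := ∑ i, v i ^ 2 with hV
  have h1 : ∑ i, ∑ j, B i j * (w i * v j) = W := by
    rw [hW]; refine Finset.sum_congr rfl fun i _ => ?_
    rw [sq]; nth_rw 3 [hwi i]; rw [Finset.mul_sum]
    exact Finset.sum_congr rfl fun j _ => by ring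
  have h2 : ∑ i, ∑ j, B i j * (v i * w j) = -W := by
    rw [Finset.sum_comm, ← h1]
    simp only [← Finset.sum_neg_distrib]
    refine Finset.sum_congr rfl fun i _ => Finset.sum_congr rfl fun j _ => ?_
    rw [hBa i j]; ring
  have h3 : ∑ i, ∑ j, (w i ^ 2 * v j ^ 2) = W * V := by
    rw [hW, hV, Finset.sum_mul_sum]
  have h4 : ∑ i, ∑ j, (v i ^ 2 * w j ^ 2) = V * W := by
    rw [hW, hV, Finset.sum_mul_sum]
  have h5 : ∑ i, ∑ j, (w i * v i) * (w j * v j) = (∑ i, w i * v i) ^ 2 := by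
    rw [sq, Finset.sum_mul_sum]
  -- expand the square of V • B - (w vᵀ - v wᵀ)
  have key : 0 ≤ ∑ i, ∑ j, (V * B i j - (w i * v j - v i * w j)) ^ 2 := by positivity
  have e : ∑ i, ∑ j, (V * B i j - (w i * v j - v i * w j)) ^ 2 =
      V ^ 2 * bwN B - 2 * V * (∑ i, ∑ j, B i j * (w i * v j)) +
      2 * V * (∑ i, ∑ j, B i j * (v i * w j)) + ∑ i, ∑ j, (w i ^ 2 * v j ^ 2)
      + ∑ i, ∑ j, (v i ^ 2 * w j ^ 2) - 2 * ∑ i, ∑ j, (w i * v i) * (w j * v j) := by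
    rw [bwN_eq]
    simp only [Finset.mul_sum, ← Finset.sum_add_distrib, ← Finset.sum_sub_distrib]
    refine Finset.sum_congr rfl fun i _ => Finset.sum_congr rfl fun j _ => ?_
    ring
  rw [e, h1, h2, h3, h4, h5] at key
  have hV0 : 0 ≤ V := by positivity
  rcases hV0.eq_or_lt with h0 | h0
  · have hv : v = 0 := by
      funext i
      have := (Finset.sum_eq_zero_iff_of_nonneg (fun i _ => sq_nonneg (v i))).1 h0.symm i
        (Finset.mem_univ i)
      simpa using this
    have : W = 0 := by rw [hW, hw, hv]; simp
    rw [this, ← h0]; simp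
  · have : 0 ≤ V * (V * bwN B - 2 * W) := by nlinarith [sq_nonneg (∑ i, w i * v i)]
    have := nonneg_of_mul_nonneg_right this h0
    linarith

lemma bw_skew {n : ℕ} (B Z : Matrix (Fin n) (Fin n) ℝ) (hB : Bᵀ = -B) :
    bwN (B * Z) ≤ (1/2) * bwN B * bwN Z := by
  rw [bwN_eq (B * Z), bwN_eq Z, Finset.sum_comm, Finset.sum_comm (f := fun i j => Z i j ^ 2),
    Finset.mul_sum]
  exact Finset.sum_le_sum fun j _ => bw_skew_vec B hB (fun i => Z i j)

/-- Böttcher–Wenzel inequality for real matrices. -/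
theorem bw_real (n : ℕ) (X Y : Matrix (Fin n) (Fin n) ℝ) :
    trace ((X * Y - Y * X) * (X * Y - Y * X)ᵀ) ≤
      2 * trace (X * Xᵀ) * trace (Y * Yᵀ) := by
  change bwN (X * Y - Y * X) ≤ 2 * bwN X * bwN Y
  set A := (1/2 : ℝ) • (X + Xᵀ) with hA
  set B := (1/2 : ℝ) • (X - Xᵀ) with hB
  have hAt : Aᵀ = A := by
    rw [hA, transpose_smul, transpose_add, transpose_transpose, add_comm]
  have hBt : Bᵀ = -B := by
    rw [hB, transpose_smul, transpose_sub, transpose_transpose, ← smul_neg, neg_sub]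
  obtain ⟨c, hc⟩ := bw_sym A hAt
  have hX := bw_par X Xᵀ
  rw [bwN_transpose, ← hA, ← hB] at hX
  have hcomm : X * Y - Y * X = (X - c • 1) * Y - Y * (X - c • 1) := by
    simp only [sub_mul, mul_sub, smul_mul_assoc, mul_smul_comm, one_mul, mul_one]; abel
  have hid := bw_identity (X - c • 1) Y
  rw [← hcomm] at hid
  have hp : ∀ Z, bwN ((X - c • 1) * Z) + bwN ((X - c • 1)ᵀ * Z) =
      2 * (bwN ((A - c • 1) * Z) + bwN (B * Z)) := by
    intro Z
    rw [bw_par, ← add_mul, ← sub_mul, ← smul_mul_assoc, ← smul_mul_assoc]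
    have e1 : (1/2 : ℝ) • ((X - c • 1) + (X - c • 1)ᵀ) = A - c • 1 := by
      rw [hA, transpose_sub, transpose_smul, transpose_one]; module
    have e2 : (1/2 : ℝ) • ((X - c • 1) - (X - c • 1)ᵀ) = B := by
      rw [hB, transpose_sub, transpose_smul, transpose_one]; module
    rw [e1, e2]
  have g1 := hp Y
  have g2 := hp Yᵀ
  have i1 := hc Y
  have i2 := hc Yᵀ
  have i3 := bw_skew B Y hBt
  have i4 := bw_skew B Yᵀ hBt
  rw [bwN_transpose] at i2 i4
  have := bwN_nonneg ((X - c • 1)ᵀ * Y + Y * (X - c • 1)ᵀ)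
  have hX' : bwN X = bwN A + bwN B := by linarith
  rw [hX']
  linarith
end

section
/- For any m real symmetric n×n matrices B₁,…,B_m (m,n ≥ 2), the inequality ∑_{r,s=1}^m ‖[B_r,B_s]‖² ≤ (∑_{r=1}^m ‖B_r‖²)² holds. -/
open Matrix

namespace DDVV

/-- Frobenius inner product -/
def ip {n : ℕ} (A B : Matrix (Fin n) (Fin n) ℝ) : ℝ := ∑ i, ∑ j, A i j * B i j

/-- Squared Frobenius norm -/
def nsq {n : ℕ} (A : Matrix (Fin n) (Fin n) ℝ) : ℝ := ∑ i, ∑ j, A i j ^ 2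

/-- commutator -/
def cm {n : ℕ} (A B : Matrix (Fin n) (Fin n) ℝ) : Matrix (Fin n) (Fin n) ℝ := A * B - B * A

lemma ip_eq {n : ℕ} (A B : Matrix (Fin n) (Fin n) ℝ) : ip A B = trace (A * Bᵀ) := by
  simp [ip, trace, mul_apply]

lemma nsq_eq_ip {n : ℕ} (A : Matrix (Fin n) (Fin n) ℝ) : nsq A = ip A A := by
  simp [ip, nsq, sq]

lemma nsq_eq {n : ℕ} (A : Matrix (Fin n) (Fin n) ℝ) : nsq A = trace (A * Aᵀ) := by
  rw [nsq_eq_ip, ip_eq]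

lemma nsq_nonneg {n : ℕ} (A : Matrix (Fin n) (Fin n) ℝ) : 0 ≤ nsq A := by
  unfold nsq; positivity

lemma nsq_smul {n : ℕ} (c : ℝ) (A : Matrix (Fin n) (Fin n) ℝ) : nsq (c • A) = c ^ 2 * nsq A := by
  simp [nsq, mul_pow, Finset.mul_sum]

lemma cm_smul {n : ℕ} (c d : ℝ) (A B : Matrix (Fin n) (Fin n) ℝ) :
    cm (c • A) (d • B) = (c * d) • cm A B := by
  simp [cm, smul_sub, smul_smul, mul_comm]

lemma spectral {n : ℕ} (A : Matrix (Fin n) (Fin n) ℝ) (hA : Aᵀ = A) :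
    ∃ (U : Matrix (Fin n) (Fin n) ℝ) (d : Fin n → ℝ), U * Uᵀ = 1 ∧ Uᵀ * U = 1 ∧
      A = U * diagonal d * Uᵀ := by
  have h : A.IsHermitian := by
    rw [IsHermitian, conjTranspose_eq_transpose_of_trivial]; exact hA
  refine ⟨h.eigenvectorUnitary, h.eigenvalues, ?_, ?_, ?_⟩
  · have := Unitary.mul_star_self_of_mem h.eigenvectorUnitary.2
    rwa [star_eq_conjTranspose, conjTranspose_eq_transpose_of_trivial] at this
  · have := Unitary.star_mul_self_of_mem h.eigenvectorUnitary.2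
    rwa [star_eq_conjTranspose, conjTranspose_eq_transpose_of_trivial] at this
  · have := h.spectral_theorem
    rw [Unitary.conjStarAlgAut_apply, star_eq_conjTranspose,
      conjTranspose_eq_transpose_of_trivial] at this
    exact this

/-- Laplacian of a star -/
lemma star_bound {n : ℕ} (x : Fin n → ℝ) (c : Fin n) (J : Finset (Fin n)) (hc : c ∉ J) :
    ∑ j ∈ J, ((x c - x j) ^ 2 - ∑ i, x i ^ 2) ≤ ∑ i, x i ^ 2 := by
  have h1 : x c ^ 2 + ∑ j ∈ J, x j ^ 2 ≤ ∑ i, x i ^ 2 := by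
    rw [← Finset.sum_insert (f := fun j => x j ^ 2) hc]
    exact Finset.sum_le_sum_of_subset_of_nonneg (Finset.subset_univ _) (fun _ _ _ => sq_nonneg _)
  have h2 : (∑ j ∈ J, x j) ^ 2 ≤ (J.card : ℝ) * ∑ j ∈ J, x j ^ 2 := sq_sum_le_card_mul_sum_sq
  have h3 : ∑ j ∈ J, ((x c - x j) ^ 2 - ∑ i, x i ^ 2) =
      J.card * x c ^ 2 - 2 * x c * (∑ j ∈ J, x j) + (∑ j ∈ J, x j ^ 2)
        - J.card * ∑ i, x i ^ 2 := by
    simp only [sub_sq, Finset.sum_sub_distrib, Finset.sum_add_distrib, Finset.sum_const,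
      nsmul_eq_mul, Finset.mul_sum]
  rw [h3]
  have hk : (0 : ℝ) ≤ J.card := by positivity
  have := mul_le_mul_of_nonneg_left h1 hk
  nlinarith [sq_nonneg (x c + ∑ j ∈ J, x j)]

lemma star_max {n : ℕ} (x : Fin n → ℝ) (c : Fin n) :
    ∑ j, max ((x c - x j) ^ 2 - ∑ i, x i ^ 2) 0 ≤ ∑ i, x i ^ 2 := by
  have hN : 0 ≤ ∑ i, x i ^ 2 := by positivity
  have h := star_bound x c (Finset.univ.filter fun j => 0 < (x c - x j) ^ 2 - ∑ i, x i ^ 2) (by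
    simp [hN])
  rw [Finset.sum_filter] at h
  refine le_trans (Finset.sum_le_sum fun j _ => ?_) h
  split_ifs with h0
  · exact max_le le_rfl h0.le
  · exact max_le (not_lt.1 h0) le_rfl

lemma two_le {n : ℕ} (x : Fin n → ℝ) (i j : Fin n) (h : i ≠ j) :
    x i ^ 2 + x j ^ 2 ≤ ∑ i, x i ^ 2 := by
  rw [← Finset.sum_pair (f := fun i => x i ^ 2) h]
  exact Finset.sum_le_sum_of_subset_of_nonneg (Finset.subset_univ _) (fun _ _ _ => sq_nonneg _)

lemma four_le {n : ℕ} (x : Fin n → ℝ) (i j k l : Fin n) (h : i ≠ j) (h1 : i ≠ k) (h2 : i ≠ l)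
    (h3 : j ≠ k) (h4 : j ≠ l) (h5 : k ≠ l) :
    x i ^ 2 + x j ^ 2 + x k ^ 2 + x l ^ 2 ≤ ∑ i, x i ^ 2 := by
  have : ∑ a ∈ ({i, j, k, l} : Finset (Fin n)), x a ^ 2 ≤ ∑ i, x i ^ 2 :=
    Finset.sum_le_sum_of_subset_of_nonneg (Finset.subset_univ _) (fun _ _ _ => sq_nonneg _)
  rw [Finset.sum_insert (by simp [*]), Finset.sum_insert (by simp [*]), Finset.sum_pair h5] at this
  linarith

lemma triangle_aux (a b c N : ℝ) (h : a ^ 2 + b ^ 2 + c ^ 2 ≤ N)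
    (h1 : N < (a - b) ^ 2) (h2 : N < (b - c) ^ 2) (h3 : N < (a - c) ^ 2) : False := by
  have key : ∀ a b c : ℝ, a ^ 2 + b ^ 2 + c ^ 2 ≤ N → N < (a - b) ^ 2 → N < (b - c) ^ 2 →
      a ≤ b → b ≤ c → False := by
    intro a b c h h1 h2 hab hbc
    nlinarith [mul_nonneg (sub_nonneg.2 hab) (sub_nonneg.2 hbc), sq_nonneg (a + c), sq_nonneg b]
  rcases le_total a b with hab | hab <;> rcases le_total b c with hbc | hbc <;>
    rcases le_total a c with hac | hac
  · exact key a b c (by linarith) (by linarith) (by linarith) hab hbc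
  · exact key a b c (by linarith) (by linarith) (by linarith) hab hbc
  · exact key a c b (by linarith) (by linarith) (by nlinarith) hac hbc
  · exact key c a b (by linarith) (by nlinarith) (by nlinarith) hac hab
  · exact key b a c (by linarith) (by nlinarith) (by nlinarith) hab hac
  · exact key b c a (by linarith) (by nlinarith) (by nlinarith) hbc hac
  · exact key c b a (by linarith) (by nlinarith) (by nlinarith) hbc hab
  · exact key c b a (by linarith) (by nlinarith) (by nlinarith) hbc hab

lemma three_le {n : ℕ} (x : Fin n → ℝ) (i j k : Fin n) (h : i ≠ j) (h1 : i ≠ k)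
    (h3 : j ≠ k) :
    x i ^ 2 + x j ^ 2 + x k ^ 2 ≤ ∑ i, x i ^ 2 := by
  have : ∑ a ∈ ({i, j, k} : Finset (Fin n)), x a ^ 2 ≤ ∑ i, x i ^ 2 :=
    Finset.sum_le_sum_of_subset_of_nonneg (Finset.subset_univ _) (fun _ _ _ => sq_nonneg _)
  rw [Finset.sum_insert (by simp [*]), Finset.sum_pair h3] at this
  linarith

/-- heavy pairs form a star -/
lemma exists_center {n : ℕ} (x : Fin n → ℝ) (p q : Fin n)
    (hpq : ∑ i, x i ^ 2 < (x p - x q) ^ 2) :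
    ∃ c, ∀ i j, ∑ i, x i ^ 2 < (x i - x j) ^ 2 → i = c ∨ j = c := by
  have hN : 0 ≤ ∑ i, x i ^ 2 := by positivity
  set N := ∑ i, x i ^ 2 with hNdef
  have hne : ∀ i j, N < (x i - x j) ^ 2 → i ≠ j := by
    rintro i j h rfl
    simp at h; linarith
  have hsymm : ∀ i j, N < (x i - x j) ^ 2 → N < (x j - x i) ^ 2 := by
    intro i j h; nlinarith
  have hdis : ∀ i j k l, N < (x i - x j) ^ 2 → N < (x k - x l) ^ 2 →
      i = k ∨ i = l ∨ j = k ∨ j = l := by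
    intro i j k l h h'
    by_contra! hcon
    obtain ⟨a, b, c, d⟩ := hcon
    have := four_le x i j k l (hne _ _ h) a b c d (hne _ _ h')
    nlinarith [sq_nonneg (x i + x j), sq_nonneg (x k + x l)]
  have htri : ∀ i j k, N < (x i - x j) ^ 2 → N < (x j - x k) ^ 2 → N < (x i - x k) ^ 2 →
      False := by
    intro i j k h1 h2 h3
    exact triangle_aux _ _ _ N (three_le x i j k (hne _ _ h1) (hne _ _ h3) (hne _ _ h2)) h1 h2 h3
  by_contra! hcon
  obtain ⟨a, b, hab, hap, hbp⟩ := hcon p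
  obtain ⟨c, d, hcd, hcq, hdq⟩ := hcon q
  have h1 : ∃ r, r ≠ p ∧ N < (x q - x r) ^ 2 := by
    rcases hdis p q a b hpq hab with h | h | h | h
    · exact absurd h.symm hap
    · exact absurd h.symm hbp
    · exact ⟨b, hbp, h ▸ hab⟩
    · exact ⟨a, hap, h ▸ hsymm _ _ hab⟩
  have h2 : ∃ s, s ≠ q ∧ N < (x p - x s) ^ 2 := by
    rcases hdis p q c d hpq hcd with h | h | h | h
    · exact ⟨d, hdq, h ▸ hcd⟩
    · exact ⟨c, hcq, h ▸ hsymm _ _ hcd⟩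
    · exact absurd h.symm hcq
    · exact absurd h.symm hdq
  obtain ⟨r, hrp, hr⟩ := h1
  obtain ⟨s, hsq, hs⟩ := h2
  rcases hdis q r p s hr hs with h | h | h | h
  · exact hne _ _ hpq h.symm
  · exact hsq h.symm
  · exact hrp h
  · subst h
    exact htri p q r hpq hr hs

lemma pair_bound {n : ℕ} (x : Fin n → ℝ) :
    ∑ i, ∑ j, max ((x i - x j) ^ 2 - ∑ i, x i ^ 2) 0 ≤ 2 * ∑ i, x i ^ 2 := by
  have hN : 0 ≤ ∑ i, x i ^ 2 := by positivity
  by_cases hex : ∃ p q, ∑ i, x i ^ 2 < (x p - x q) ^ 2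
  · obtain ⟨p, q, hpq⟩ := hex
    obtain ⟨c, hc⟩ := exists_center x p q hpq
    have hs := star_max x c
    set N := ∑ i, x i ^ 2 with hNdef
    have hle : ∀ i j, max ((x i - x j) ^ 2 - N) 0 ≤
        (if i = c then max ((x c - x j) ^ 2 - N) 0 else 0) +
        (if j = c then max ((x c - x i) ^ 2 - N) 0 else 0) := by
      intro i j
      have n1 : 0 ≤ max ((x c - x j) ^ 2 - N) 0 := le_max_right _ _
      have n2 : 0 ≤ max ((x c - x i) ^ 2 - N) 0 := le_max_right _ _
      by_cases h : N < (x i - x j) ^ 2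
      · rcases hc i j h with h | h
        · subst h; simp only [if_true]
          split_ifs <;> linarith
        · subst h; simp only [if_true]
          rw [show (x i - x j) ^ 2 = (x j - x i) ^ 2 by ring]
          split_ifs <;> linarith
      · rw [max_eq_right (by linarith)]
        split_ifs <;> linarith
    calc _ ≤ ∑ i, ∑ j, ((if i = c then max ((x c - x j) ^ 2 - N) 0 else 0) +
        (if j = c then max ((x c - x i) ^ 2 - N) 0 else 0)) :=
          Finset.sum_le_sum fun i _ => Finset.sum_le_sum fun j _ => hle i j
      _ = (∑ j, max ((x c - x j) ^ 2 - N) 0) + ∑ j, max ((x c - x j) ^ 2 - N) 0 := by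
          simp only [Finset.sum_add_distrib]
          congr 1
          · rw [Finset.sum_comm]; simp
          · simp
      _ ≤ 2 * N := by linarith
  · push Not at hex
    rw [Finset.sum_eq_zero]
    · linarith
    · intro i _
      exact Finset.sum_eq_zero fun j _ => max_eq_right (by linarith [hex i j])

lemma nsq_lincomb {m n : ℕ} (A : Fin m → Matrix (Fin n) (Fin n) ℝ)
    (ho : ∀ r s, r ≠ s → ip (A r) (A s) = 0) (a : Fin m → ℝ) :
    nsq (∑ r, a r • A r) = ∑ r, a r ^ 2 * nsq (A r) := by
  have h : ∀ r, ∑ s, a r * a s * ip (A r) (A s) = a r ^ 2 * nsq (A r) := by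
    intro r
    rw [Finset.sum_eq_single r, nsq_eq_ip]
    · ring
    · intro s _ hs; rw [ho r s hs.symm, mul_zero]
    · simp
  rw [← Finset.sum_congr rfl fun r _ => h r]
  simp only [ip_eq, nsq_eq, transpose_sum, transpose_smul, Finset.sum_mul, Finset.mul_sum,
    trace_sum, smul_mul_smul_comm, trace_smul, smul_eq_mul]
  rw [Finset.sum_comm]

lemma bessel {m n : ℕ} (A : Fin m → Matrix (Fin n) (Fin n) ℝ) (hA : ∀ r, (A r)ᵀ = A r)
    (ho : ∀ r s, r ≠ s → ip (A r) (A s) = 0) (T : ℝ) (hT0 : 0 ≤ T) (hT : ∀ r, nsq (A r) ≤ T)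
    (i j : Fin n) (hij : i ≠ j) : 2 * ∑ r, A r i j ^ 2 ≤ T := by
  have h1 := nsq_lincomb A ho (fun r => A r i j)
  set C := ∑ r, A r i j • A r with hC
  have hsymm : ∀ r, A r j i = A r i j := fun r => by
    conv_lhs => rw [← hA r]
    rfl
  have hCij : C i j = ∑ r, A r i j ^ 2 := by
    simp [hC, Matrix.sum_apply, sq]
  have hCji : C j i = ∑ r, A r i j ^ 2 := by
    simp [hC, Matrix.sum_apply, sq, hsymm]
  have h2 : C i j ^ 2 + C j i ^ 2 ≤ nsq C := by
    unfold nsq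
    have e1 : C i j ^ 2 ≤ ∑ l, C i l ^ 2 :=
      Finset.single_le_sum (f := fun l => C i l ^ 2) (fun _ _ => sq_nonneg _) (Finset.mem_univ j)
    have e2 : C j i ^ 2 ≤ ∑ l, C j l ^ 2 :=
      Finset.single_le_sum (f := fun l => C j l ^ 2) (fun _ _ => sq_nonneg _) (Finset.mem_univ i)
    have e3 : ∑ k ∈ ({i, j} : Finset (Fin n)), ∑ l, C k l ^ 2 ≤ ∑ k, ∑ l, C k l ^ 2 :=
      Finset.sum_le_sum_of_subset_of_nonneg (Finset.subset_univ _)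
        (fun _ _ _ => by positivity)
    rw [Finset.sum_pair hij] at e3
    linarith
  have h3 : ∑ r, A r i j ^ 2 * nsq (A r) ≤ (∑ r, A r i j ^ 2) * T := by
    rw [Finset.sum_mul]
    exact Finset.sum_le_sum fun r _ => mul_le_mul_of_nonneg_left (hT r) (sq_nonneg _)
  rw [hCij, hCji, h1] at h2
  have hS : 0 ≤ ∑ r, A r i j ^ 2 := by positivity
  set S := ∑ r, A r i j ^ 2
  rcases hS.eq_or_lt with h | h
  · rw [← h]; linarith
  · by_contra! hcon
    nlinarith

lemma diag_case {m n : ℕ} (x : Fin n → ℝ)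
    (A : Fin m → Matrix (Fin n) (Fin n) ℝ) (hA : ∀ r, (A r)ᵀ = A r)
    (ho : ∀ r s, r ≠ s → ip (A r) (A s) = 0) (T : ℝ) (hT0 : 0 ≤ T) (hT : ∀ r, nsq (A r) ≤ T) :
    ∑ r, nsq (cm (diagonal x) (A r)) ≤ nsq (diagonal x) * (∑ r, nsq (A r) + T) := by
  have hd : nsq (diagonal x) = ∑ i, x i ^ 2 := by
    rw [nsq_eq, diagonal_transpose, diagonal_mul_diagonal, trace_diagonal]
    simp [sq]
  have hc : ∀ r, nsq (cm (diagonal x) (A r)) = ∑ i, ∑ j, (x i - x j) ^ 2 * A r i j ^ 2 := by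
    intro r
    unfold nsq cm
    refine Finset.sum_congr rfl fun i _ => Finset.sum_congr rfl fun j _ => ?_
    rw [Matrix.sub_apply, diagonal_mul, mul_diagonal]; ring
  rw [hd]
  have hN : 0 ≤ ∑ i, x i ^ 2 := by positivity
  have hp := pair_bound x
  set N := ∑ i, x i ^ 2 with hNdef
  simp only [hc]
  have key : ∑ r, ∑ i, ∑ j, ((x i - x j) ^ 2 - N) * A r i j ^ 2 ≤ N * T := by
    calc ∑ r, ∑ i, ∑ j, ((x i - x j) ^ 2 - N) * A r i j ^ 2
        = ∑ i, ∑ j, ((x i - x j) ^ 2 - N) * ∑ r, A r i j ^ 2 := by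
          rw [Finset.sum_comm]
          refine Finset.sum_congr rfl fun i _ => ?_
          rw [Finset.sum_comm]
          simp only [Finset.mul_sum]
      _ ≤ ∑ i, ∑ j, max ((x i - x j) ^ 2 - N) 0 * (T / 2) := by
          refine Finset.sum_le_sum fun i _ => Finset.sum_le_sum fun j _ => ?_
          have hS : 0 ≤ ∑ r, A r i j ^ 2 := by positivity
          by_cases hij : i = j
          · subst hij
            have : 0 ≤ max ((x i - x i) ^ 2 - N) 0 * (T / 2) :=
              mul_nonneg (le_max_right _ _) (by linarith)
            refine le_trans ?_ this
            exact mul_nonpos_of_nonpos_of_nonneg (by simpa using hN) hS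
          · have hb := bessel A hA ho T hT0 hT i j hij
            exact mul_le_mul (le_max_left _ _) (by linarith) hS (le_max_right _ _)
      _ = (∑ i, ∑ j, max ((x i - x j) ^ 2 - N) 0) * (T / 2) := by
          simp only [Finset.sum_mul]
      _ ≤ (2 * N) * (T / 2) := mul_le_mul_of_nonneg_right hp (by linarith)
      _ = N * T := by ring
  have e : ∑ r, ∑ i, ∑ j, ((x i - x j) ^ 2 - N) * A r i j ^ 2 =
      ∑ r, ∑ i, ∑ j, (x i - x j) ^ 2 * A r i j ^ 2 - N * ∑ r, nsq (A r) := by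
    simp only [nsq, sub_mul, Finset.sum_sub_distrib, Finset.mul_sum]
  rw [e] at key
  linarith

lemma ip_conj {n : ℕ} (U A B : Matrix (Fin n) (Fin n) ℝ) (h : U * Uᵀ = 1) :
    ip (Uᵀ * A * U) (Uᵀ * B * U) = ip A B := by
  rw [ip_eq, ip_eq, transpose_mul, transpose_mul, transpose_transpose]
  have : Uᵀ * A * U * (Uᵀ * (Bᵀ * U)) = Uᵀ * (A * (U * Uᵀ) * Bᵀ * U) := by
    simp only [Matrix.mul_assoc]
  rw [this, h, trace_mul_comm, Matrix.mul_one, Matrix.mul_assoc, h, Matrix.mul_one]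

lemma cm_conj {n : ℕ} (U A B : Matrix (Fin n) (Fin n) ℝ) (h : U * Uᵀ = 1) :
    cm (Uᵀ * A * U) (Uᵀ * B * U) = Uᵀ * cm A B * U := by
  have : ∀ A B : Matrix (Fin n) (Fin n) ℝ, Uᵀ * A * U * (Uᵀ * B * U) = Uᵀ * (A * B) * U := by
    intro A B
    calc _ = Uᵀ * A * (U * Uᵀ) * B * U := by simp only [Matrix.mul_assoc]
      _ = _ := by rw [h]; simp only [Matrix.mul_assoc, Matrix.mul_one, Matrix.one_mul]
  rw [cm, this, this, cm, Matrix.mul_sub, Matrix.sub_mul]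

lemma sym_case {m n : ℕ} (X : Matrix (Fin n) (Fin n) ℝ) (hX : Xᵀ = X)
    (A : Fin m → Matrix (Fin n) (Fin n) ℝ) (hA : ∀ r, (A r)ᵀ = A r)
    (ho : ∀ r s, r ≠ s → ip (A r) (A s) = 0) (T : ℝ) (hT0 : 0 ≤ T) (hT : ∀ r, nsq (A r) ≤ T) :
    ∑ r, nsq (cm X (A r)) ≤ nsq X * (∑ r, nsq (A r) + T) := by
  obtain ⟨U, d, h1, h2, h3⟩ := spectral X hX
  have hn : ∀ B, nsq (Uᵀ * B * U) = nsq B := fun B => by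
    rw [nsq_eq_ip, ip_conj U _ _ h1, nsq_eq_ip]
  have hd : diagonal d = Uᵀ * X * U := by
    rw [h3]
    calc diagonal d = (Uᵀ * U) * diagonal d * (Uᵀ * U) := by simp [h2]
      _ = _ := by simp only [Matrix.mul_assoc]
  have := diag_case d (fun r => Uᵀ * A r * U)
    (fun r => by simp only [transpose_mul, transpose_transpose, hA, Matrix.mul_assoc])
    (fun r s hrs => by rw [ip_conj U _ _ h1]; exact ho r s hrs) T hT0
    (fun r => by rw [hn]; exact hT r)
  simpa only [hd, cm_conj U _ _ h1, hn] using this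

/-- left-hand side -/
def F {m n : ℕ} (A : Fin m → Matrix (Fin n) (Fin n) ℝ) : ℝ := ∑ r, ∑ s, nsq (cm (A r) (A s))

/-- total norm -/
def Q {m n : ℕ} (A : Fin m → Matrix (Fin n) (Fin n) ℝ) : ℝ := ∑ r, nsq (A r)

lemma rot_nsq {m n : ℕ} (U : Matrix (Fin m) (Fin m) ℝ) (hU : U * Uᵀ = 1)
    (X : Fin m → Matrix (Fin n) (Fin n) ℝ) :
    ∑ s, nsq (∑ t, U t s • X t) = ∑ t, nsq (X t) := by
  have hv : ∀ v : Fin m → ℝ, ∑ s, (∑ t, U t s * v t) ^ 2 = ∑ t, v t ^ 2 := by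
    intro v
    have h1 : ∀ v : Fin m → ℝ, ∑ t, v t ^ 2 = v ⬝ᵥ v := fun v => by simp [dotProduct, sq]
    have h2 : (fun s => ∑ t, U t s * v t) = Uᵀ *ᵥ v := by
      ext s; simp [mulVec, dotProduct]
    rw [h1 (fun s => ∑ t, U t s * v t), h1, h2, dotProduct_mulVec, vecMul_transpose,
      mulVec_mulVec, hU, one_mulVec]
  simp only [nsq, Matrix.sum_apply, Matrix.smul_apply, smul_eq_mul]
  rw [Finset.sum_comm, Finset.sum_comm (s := Finset.univ (α := Fin m))]
  refine Finset.sum_congr rfl fun i _ => ?_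
  rw [Finset.sum_comm, Finset.sum_comm (s := Finset.univ (α := Fin m))]
  exact Finset.sum_congr rfl fun j _ => hv fun t => X t i j

lemma rot_F {m n : ℕ} (U : Matrix (Fin m) (Fin m) ℝ) (hU : U * Uᵀ = 1)
    (X : Fin m → Matrix (Fin n) (Fin n) ℝ) :
    F (fun s => ∑ t, U t s • X t) = F X := by
  unfold F
  have h1 : ∀ Y : Matrix (Fin n) (Fin n) ℝ, ∀ s,
      cm Y (∑ t, U t s • X t) = ∑ t, U t s • cm Y (X t) := by
    intro Y s
    simp only [cm, Finset.mul_sum, Finset.sum_mul, smul_sub, Finset.sum_sub_distrib,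
      Matrix.mul_smul, Matrix.smul_mul]
  have h2 : ∀ Y : Matrix (Fin n) (Fin n) ℝ, ∀ s,
      cm (∑ t, U t s • X t) Y = ∑ t, U t s • cm (X t) Y := by
    intro Y s
    simp only [cm, Finset.mul_sum, Finset.sum_mul, smul_sub, Finset.sum_sub_distrib,
      Matrix.mul_smul, Matrix.smul_mul]
  simp only [h1, rot_nsq U hU]
  rw [Finset.sum_comm]
  simp only [h2, rot_nsq U hU]
  rw [Finset.sum_comm]

lemma exists_orth {m n : ℕ} (A : Fin m → Matrix (Fin n) (Fin n) ℝ) (hA : ∀ r, (A r)ᵀ = A r) :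
    ∃ B : Fin m → Matrix (Fin n) (Fin n) ℝ, (∀ r, (B r)ᵀ = B r) ∧
      (∀ r s, r ≠ s → ip (B r) (B s) = 0) ∧ F B = F A ∧ Q B = Q A := by
  obtain ⟨U, d, h1, h2, h3⟩ := spectral (Matrix.of fun r s => ip (A r) (A s)) (by
    ext r s; simp [ip, mul_comm])
  refine ⟨fun s => ∑ t, U t s • A t, ?_, ?_, rot_F U h1 A, rot_nsq U h1 A⟩
  · intro r; simp [transpose_sum, hA]
  · intro r s hrs
    have hd : Uᵀ * (Matrix.of fun r s => ip (A r) (A s)) * U = diagonal d := by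
      rw [h3]
      calc _ = (Uᵀ * U) * diagonal d * (Uᵀ * U) := by simp only [Matrix.mul_assoc]
        _ = _ := by simp [h2]
    have e : ip (∑ t, U t r • A t) (∑ t, U t s • A t) =
        (Uᵀ * (Matrix.of fun r s => ip (A r) (A s)) * U) r s := by
      simp only [ip_eq, mul_apply, transpose_apply, of_apply, transpose_sum, transpose_smul,
        Finset.sum_mul, Finset.mul_sum, trace_sum, smul_mul_smul_comm, trace_smul, smul_eq_mul]
      refine Finset.sum_congr rfl fun i _ => Finset.sum_congr rfl fun j _ => ?_
      ring
    rw [e, hd, diagonal_apply_ne _ hrs]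

lemma F_smul {m n : ℕ} (c : ℝ) (A : Fin m → Matrix (Fin n) (Fin n) ℝ) :
    F (fun r => c • A r) = c ^ 4 * F A := by
  simp only [F, cm_smul, nsq_smul, Finset.mul_sum]
  refine Finset.sum_congr rfl fun i _ => Finset.sum_congr rfl fun j _ => ?_
  ring

lemma Q_smul {m n : ℕ} (c : ℝ) (A : Fin m → Matrix (Fin n) (Fin n) ℝ) :
    Q (fun r => c • A r) = c ^ 2 * Q A := by
  simp only [Q, nsq_smul, Finset.mul_sum]

lemma Q_nonneg {m n : ℕ} (A : Fin m → Matrix (Fin n) (Fin n) ℝ) : 0 ≤ Q A :=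
  Finset.sum_nonneg fun _ _ => nsq_nonneg _

lemma F_nonneg {m n : ℕ} (A : Fin m → Matrix (Fin n) (Fin n) ℝ) : 0 ≤ F A :=
  Finset.sum_nonneg fun _ _ => Finset.sum_nonneg fun _ _ => nsq_nonneg _

lemma entry_le {m n : ℕ} (A : Fin m → Matrix (Fin n) (Fin n) ℝ) (r : Fin m) (i j : Fin n) :
    A r i j ^ 2 ≤ Q A := by
  calc A r i j ^ 2 ≤ ∑ l, A r i l ^ 2 :=
        Finset.single_le_sum (f := fun l => A r i l ^ 2) (fun _ _ => sq_nonneg _)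
          (Finset.mem_univ j)
    _ ≤ nsq (A r) := Finset.single_le_sum (f := fun k => ∑ l, A r k l ^ 2)
          (fun _ _ => by positivity) (Finset.mem_univ i)
    _ ≤ Q A := Finset.single_le_sum (f := fun r => nsq (A r))
          (fun _ _ => nsq_nonneg _) (Finset.mem_univ r)

lemma Q_zero {m n : ℕ} (A : Fin m → Matrix (Fin n) (Fin n) ℝ) (h : Q A = 0) : F A = 0 := by
  have : ∀ r, A r = 0 := fun r => by
    ext i j
    have := entry_le A r i j
    rw [h] at this
    exact pow_eq_zero_iff (two_ne_zero) |>.1 (le_antisymm this (sq_nonneg _))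
  simp [F, this, cm, nsq]

lemma cont_F {m n : ℕ} : Continuous (F : (Fin m → Matrix (Fin n) (Fin n) ℝ) → ℝ) := by
  unfold F cm
  simp only [nsq_eq]
  fun_prop

lemma cont_Q {m n : ℕ} : Continuous (Q : (Fin m → Matrix (Fin n) (Fin n) ℝ) → ℝ) := by
  unfold Q
  simp only [nsq_eq]
  fun_prop

lemma compact_K {m n : ℕ} :
    IsCompact {A : Fin m → Matrix (Fin n) (Fin n) ℝ | (∀ r, (A r)ᵀ = A r) ∧ Q A = 1} := by
  have hbox : IsCompact {A : Fin m → Matrix (Fin n) (Fin n) ℝ |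
      ∀ r, A r ∈ {B : Matrix (Fin n) (Fin n) ℝ | ∀ i, B i ∈ {v : Fin n → ℝ |
        ∀ j, v j ∈ Set.Icc (-1 : ℝ) 1}}} :=
    isCompact_pi_infinite fun _ => isCompact_pi_infinite (X := fun _ : Fin n => Fin n → ℝ)
      fun _ => isCompact_pi_infinite fun _ => isCompact_Icc
  refine hbox.of_isClosed_subset ?_ ?_
  · apply IsClosed.inter
    · have : {A : Fin m → Matrix (Fin n) (Fin n) ℝ | ∀ r, (A r)ᵀ = A r} =
          ⋂ r, {A | (A r)ᵀ = A r} := by ext; simp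
      change IsClosed {A : Fin m → Matrix (Fin n) (Fin n) ℝ | ∀ r, (A r)ᵀ = A r}
      rw [this]
      exact isClosed_iInter fun r => isClosed_eq (by fun_prop) (by fun_prop)
    · exact isClosed_eq cont_Q continuous_const
  · rintro A ⟨-, hQ⟩ r i j
    have := entry_le A r i j
    rw [hQ] at this
    exact abs_le.1 (sq_le_one_iff_abs_le_one _ |>.1 this)

lemma vary {m n : ℕ} (A : Fin m → Matrix (Fin n) (Fin n) ℝ) (p : Fin m) (c : ℝ) :
    F (fun r => (if r = p then c else 1) • A r) =
      F A + 2 * (c ^ 2 - 1) * ∑ s, nsq (cm (A p) (A s)) := by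
  have hpp : nsq (cm (A p) (A p)) = 0 := by simp [cm, nsq]
  have hsw : ∀ r s, nsq (cm (A r) (A s)) = nsq (cm (A s) (A r)) := by
    intro r s
    have : cm (A r) (A s) = (-1 : ℝ) • cm (A s) (A r) := by simp [cm]
    rw [this, nsq_smul]; ring
  have h : ∀ r s, nsq (cm ((if r = p then c else 1) • A r) ((if s = p then c else 1) • A s)) =
      nsq (cm (A r) (A s)) + (if r = p then (c ^ 2 - 1) * nsq (cm (A p) (A s)) else 0)
        + (if s = p then (c ^ 2 - 1) * nsq (cm (A p) (A r)) else 0) := by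
    intro r s
    rw [cm_smul, nsq_smul]
    by_cases hr : r = p <;> by_cases hs : s = p
    · subst hr; subst hs; simp [hpp]
    · subst hr; simp [hs]; ring
    · subst hs; simp [hr]; rw [hsw]; ring
    · simp [hr, hs]
  simp only [F, h, Finset.sum_add_distrib]
  have e1 : ∑ r, ∑ s, (if r = p then (c ^ 2 - 1) * nsq (cm (A p) (A s)) else 0) =
      (c ^ 2 - 1) * ∑ s, nsq (cm (A p) (A s)) := by
    rw [Finset.sum_comm]; simp [Finset.mul_sum]
  have e2 : ∑ r, ∑ s, (if s = p then (c ^ 2 - 1) * nsq (cm (A p) (A r)) else 0) =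
      (c ^ 2 - 1) * ∑ s, nsq (cm (A p) (A s)) := by
    simp [Finset.mul_sum]
  rw [e1, e2]; ring

lemma varyQ {m n : ℕ} (A : Fin m → Matrix (Fin n) (Fin n) ℝ) (p : Fin m) (c : ℝ) :
    Q (fun r => (if r = p then c else 1) • A r) = Q A + (c ^ 2 - 1) * nsq (A p) := by
  have h : ∀ r, nsq ((if r = p then c else 1) • A r) =
      nsq (A r) + (if r = p then (c ^ 2 - 1) * nsq (A p) else 0) := by
    intro r
    rw [nsq_smul]
    by_cases hr : r = p
    · subst hr; simp; ring
    · simp [hr]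
  simp only [Q, h, Finset.sum_add_distrib]
  simp

lemma limit_aux (g M τ : ℝ) (h : ∀ c : ℝ, 0 ≤ c → c < 1 →
      M + 2 * (c ^ 2 - 1) * g ≤ M * (1 + (c ^ 2 - 1) * τ) ^ 2) : M * τ ≤ g := by
  have h2 : ∀ c : ℝ, c ∈ Set.Ico (0 : ℝ) 1 → M * (2 * τ + (c ^ 2 - 1) * τ ^ 2) ≤ 2 * g := by
    intro c hc
    have h0 := h c hc.1 hc.2
    have hu : c ^ 2 - 1 < 0 := by nlinarith [hc.1, hc.2]
    by_contra! hcon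
    nlinarith [mul_lt_mul_of_neg_left hcon hu]
  have hcl : IsClosed {c : ℝ | M * (2 * τ + (c ^ 2 - 1) * τ ^ 2) ≤ 2 * g} :=
    isClosed_le (by fun_prop) (by fun_prop)
  have h1 : (1 : ℝ) ∈ closure (Set.Ico (0 : ℝ) 1) := by
    rw [closure_Ico (by norm_num)]; simp
  have := hcl.closure_subset_iff.2 h2 h1
  simp at this
  linarith

lemma F_le {m n : ℕ} (B : Fin m → Matrix (Fin n) (Fin n) ℝ) (hB : ∀ r, (B r)ᵀ = B r) :
    F B ≤ Q B ^ 2 := by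
  have scale : ∀ B : Fin m → Matrix (Fin n) (Fin n) ℝ, 0 < Q B →
      Q (fun r => (√(Q B))⁻¹ • B r) = 1 ∧
        F B = Q B ^ 2 * F (fun r => (√(Q B))⁻¹ • B r) := by
    intro B hpos
    have hs : √(Q B) ^ 2 = Q B := Real.sq_sqrt hpos.le
    constructor
    · rw [Q_smul, inv_pow, hs, inv_mul_cancel₀ hpos.ne']
    · rw [F_smul, inv_pow, show √(Q B) ^ 4 = (√(Q B) ^ 2) ^ 2 by ring, hs, ← mul_assoc,
        mul_inv_cancel₀ (by positivity), one_mul]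
  rcases (Q_nonneg B).eq_or_lt with h0 | hpos
  · rw [Q_zero B h0.symm]; positivity
  obtain ⟨A₀, ⟨hA₀, hQ₀⟩, hmax⟩ := (compact_K (m := m) (n := n)).exists_isMaxOn
    ⟨fun r => (√(Q B))⁻¹ • B r, fun r => by simp [hB], (scale B hpos).1⟩ cont_F.continuousOn
  have hall : ∀ C : Fin m → Matrix (Fin n) (Fin n) ℝ, (∀ r, (C r)ᵀ = C r) →
      F C ≤ F A₀ * Q C ^ 2 := by
    intro C hC
    rcases (Q_nonneg C).eq_or_lt with h0 | hpos
    · rw [Q_zero C h0.symm]; have := F_nonneg A₀; positivity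
    · have : F (fun r => (√(Q C))⁻¹ • C r) ≤ F A₀ :=
        hmax ⟨fun r => by simp [hC], (scale C hpos).1⟩
      rw [(scale C hpos).2, mul_comm]
      exact mul_le_mul_of_nonneg_right this (by positivity)
  suffices hM : F A₀ ≤ 1 by
    have := hall B hB
    nlinarith [sq_nonneg (Q B)]
  obtain ⟨A, hA, ho, hF, hQ⟩ := exists_orth A₀ hA₀
  rw [hQ₀] at hQ
  rw [← hF] at hall ⊢
  have hne : Nonempty (Fin m) := by
    by_contra hcon
    rw [not_nonempty_iff] at hcon
    simp [Q] at hQ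
  obtain ⟨p, hp⟩ := Finite.exists_max fun r => nsq (A r)
  have hτ : 0 < nsq (A p) := by
    by_contra! hcon
    have : Q A ≤ 0 := Finset.sum_nonpos fun r _ => (hp r).trans hcon
    linarith
  have hlow : F A * nsq (A p) ≤ ∑ s, nsq (cm (A p) (A s)) := by
    apply limit_aux
    intro c _ _
    have := hall (fun r => (if r = p then c else 1) • A r) (fun r => by rw [transpose_smul, hA])
    rwa [vary, varyQ, hQ] at this
  have hup : ∑ s, nsq (cm (A p) (A s)) ≤ nsq (A p) := by
    have h := sym_case (A p) (hA p) (fun r => (if r = p then (0 : ℝ) else 1) • A r)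
      (fun r => by rw [transpose_smul, hA])
      (fun r s hrs => by
        have := ho r s hrs
        rw [ip_eq] at this
        rw [ip_eq, transpose_smul, smul_mul_smul_comm, trace_smul, this, smul_zero])
      (nsq (A p)) hτ.le
      (fun r => by
        rw [nsq_smul]
        split_ifs
        · simp; exact hτ.le
        · simpa using hp r)
    have e := varyQ A p 0
    unfold Q at e hQ
    rw [e, hQ] at h
    have e2 : ∀ r, nsq (cm (A p) ((if r = p then (0 : ℝ) else 1) • A r)) =
        nsq (cm (A p) (A r)) := by
      intro r
      split_ifs with hr
      · subst hr; simp [cm]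
      · simp
    simp only [e2] at h
    linarith
  by_contra! hcon
  nlinarith

end DDVV

/-- DDVV inequality for real symmetric matrices. -/
theorem ddvv_real_symmetric (m n : ℕ) (hm : 2 ≤ m) (hn : 2 ≤ n)
    (B : Fin m → Matrix (Fin n) (Fin n) ℝ) (hsym : ∀ r, (B r)ᵀ = B r) :
    ∑ r, ∑ s, trace ((B r * B s - B s * B r) * (B r * B s - B s * B r)ᵀ) ≤
      (∑ r, trace (B r * (B r)ᵀ)) ^ 2 := by
  have := DDVV.F_le B hsym
  simpa only [DDVV.F, DDVV.Q, DDVV.cm, DDVV.nsq_eq] using this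
end

section
/- For any m real skew-symmetric n×n matrices B₁,…,B_m with n ≥ 4, one has ∑_{r,s=1}^m ‖[B_r,B_s]‖² ≤ (2/3)(∑_{r=1}^m ‖B_r‖²)². -/
open Matrix

theorem half_bound {ι : Type*} [Fintype ι] [DecidableEq ι] (τ : ι → ι)
    (hτ : Function.Involutive τ) (l : ι → ℝ) (hl : ∀ p, l (τ p) = -l p)
    (hs : ∑ p, l p ^ 2 = 1) (S : Finset ι) (hS : ∀ p ∈ S, τ p ∈ S → l p = 0) :
    2 * ∑ p ∈ S, l p ^ 2 ≤ 1 := by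
  have h1 : ∑ p ∈ S, l p ^ 2 = ∑ p, if p ∈ S then l p ^ 2 else 0 := by
    rw [Finset.sum_ite_mem, Finset.univ_inter]
  have h2 : ∑ p, (if p ∈ S then l p ^ 2 else 0) = ∑ p, if τ p ∈ S then l p ^ 2 else 0 := by
    rw [← Equiv.sum_comp hτ.toPerm]
    apply Finset.sum_congr rfl
    intro p _
    simp [hl]
  have h3 : ∑ p, ((if p ∈ S then l p ^ 2 else 0) + if τ p ∈ S then l p ^ 2 else 0)
      ≤ ∑ p, l p ^ 2 := by
    apply Finset.sum_le_sum
    intro p _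
    have := sq_nonneg (l p)
    by_cases a : p ∈ S <;> by_cases b : τ p ∈ S <;> simp [a, b, this]
    simp [hS p a b]
  rw [Finset.sum_add_distrib] at h3
  linarith

/-- off-diagonal excess -/
noncomputable def exc {ι : Type*} [DecidableEq ι] (τ : ι → ι) (l : ι → ℝ) (p q : ι) : ℝ :=
  if q = p ∨ q = τ p then 0 else max ((l p - l q) ^ 2 - 2 / 3) 0

theorem exc_nonneg {ι : Type*} [DecidableEq ι] (τ : ι → ι) (l : ι → ℝ) (p q : ι) :
    0 ≤ exc τ l p q := by
  unfold exc; split_ifs <;> simp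

theorem exc_symm {ι : Type*} [DecidableEq ι] (τ : ι → ι) (hτ : Function.Involutive τ)
    (l : ι → ℝ) (p q : ι) : exc τ l p q = exc τ l q p := by
  unfold exc
  have : (q = p ∨ q = τ p) ↔ (p = q ∨ p = τ q) := by
    constructor
    · rintro (h | h)
      · exact Or.inl h.symm
      · right; rw [h, hτ]
    · rintro (h | h)
      · exact Or.inl h.symm
      · right; rw [h, hτ]
  simp only [this]
  rw [show (l p - l q) ^ 2 = (l q - l p) ^ 2 by ring]

theorem row_bound {ι : Type*} [Fintype ι] [DecidableEq ι] (τ : ι → ι)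
    (hτ : Function.Involutive τ) (l : ι → ℝ) (hl : ∀ p, l (τ p) = -l p)
    (hs : ∑ p, l p ^ 2 = 1) (a : ι) : ∑ q, exc τ l a q ≤ 1 / 3 := by
  have hfix : ∀ p, τ p = p → l p = 0 := by
    intro p hp; have := hl p; rw [hp] at this; linarith
  set S : Finset ι := Finset.univ.filter
    (fun q => (q ≠ a ∧ q ≠ τ a) ∧ 2 / 3 < (l a - l q) ^ 2) with hSdef
  have e1 : ∑ q, exc τ l a q = ∑ q ∈ S, ((l a - l q) ^ 2 - 2 / 3) := by
    rw [hSdef, Finset.sum_filter]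
    apply Finset.sum_congr rfl
    intro q _
    unfold exc
    by_cases h : q = a ∨ q = τ a
    · rw [if_pos h, if_neg (by tauto)]
    · rw [if_neg h]
      by_cases h2 : 2 / 3 < (l a - l q) ^ 2
      · rw [if_pos (by tauto), max_eq_left (by linarith)]
      · rw [if_neg (by tauto), max_eq_right (by linarith)]
  have pair : ∀ q, q ≠ a → q ≠ τ a → l a ^ 2 + l q ^ 2 ≤ 1 / 2 := by
    intro q h1 h2
    have := half_bound τ hτ l hl hs {a, q} (by
      intro p hp hp2
      simp only [Finset.mem_insert, Finset.mem_singleton] at hp hp2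
      rcases hp with rfl | rfl
      · rcases hp2 with h | h
        · exact hfix _ h
        · exact absurd h.symm h2
      · rcases hp2 with h | h
        · exact absurd (by rw [← h, hτ]) h2
        · exact hfix _ h)
    rw [Finset.sum_pair h1.symm] at this
    linarith
  have hSτ : ∀ q ∈ S, τ q ∉ S := by
    intro q hq hq2
    simp only [hSdef, Finset.mem_filter, Finset.mem_univ, true_and] at hq hq2
    have := pair q hq.1.1 hq.1.2
    have h2 := hq2.2
    rw [hl] at h2
    nlinarith [hq.2]
  have haS : a ∉ S := by simp [hSdef]
  have hτa : ∀ q ∈ S, τ q ≠ a := by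
    intro q hq h
    simp only [hSdef, Finset.mem_filter, Finset.mem_univ, true_and] at hq
    exact hq.1.2 (by rw [← h, hτ])
  have htot := half_bound τ hτ l hl hs (insert a S) (by
    intro p hp hp2
    rw [Finset.mem_insert] at hp hp2
    rcases hp with rfl | hp
    · rcases hp2 with h | h
      · exact hfix _ h
      · simp [hSdef] at h
    · rcases hp2 with h | h
      · exact absurd h (hτa p hp)
      · exact absurd h (hSτ p hp))
  rw [Finset.sum_insert haS] at htot
  rw [e1]
  rcases S.eq_empty_or_nonempty with h0 | h0
  · rw [h0]; norm_num
  have hc : (1 : ℝ) ≤ (S.card : ℝ) := by exact_mod_cast h0.card_pos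
  set e : ℝ := (S.card : ℝ) with he
  have star : ∑ q ∈ S, e * (l a - l q) ^ 2 ≤
      ∑ q ∈ S, ((e + 1) * l a ^ 2 + e * (e + 1) * l q ^ 2) := by
    apply Finset.sum_le_sum
    intro q _
    nlinarith [sq_nonneg (l a + e * l q)]
  rw [← Finset.mul_sum, Finset.sum_add_distrib, ← Finset.mul_sum, Finset.sum_const,
    nsmul_eq_mul, ← he, ← Finset.mul_sum] at star
  have star2 : ∑ q ∈ S, (l a - l q) ^ 2 ≤ (e + 1) * (l a ^ 2 + ∑ q ∈ S, l q ^ 2) := by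
    have : e * ∑ q ∈ S, (l a - l q) ^ 2 ≤ e * ((e + 1) * (l a ^ 2 + ∑ q ∈ S, l q ^ 2)) := by
      linarith
    exact le_of_mul_le_mul_left this (by linarith)
  rw [Finset.sum_sub_distrib, Finset.sum_const, nsmul_eq_mul, ← he]
  nlinarith

theorem exc_total {ι : Type*} [Fintype ι] [DecidableEq ι] (τ : ι → ι)
    (hτ : Function.Involutive τ) (l : ι → ℝ) (hl : ∀ p, l (τ p) = -l p)
    (hs : ∑ p, l p ^ 2 = 1) : ∑ p, ∑ q, exc τ l p q ≤ 4 / 3 := by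
  have hfix : ∀ p, τ p = p → l p = 0 := by
    intro p hp; have := hl p; rw [hp] at this; linarith
  have hne : (Finset.univ : Finset ι).Nonempty := by
    by_contra h
    rw [Finset.not_nonempty_iff_eq_empty] at h
    rw [h] at hs; simp at hs
  obtain ⟨a, -, ha⟩ := Finset.exists_max_image Finset.univ (fun p => l p ^ 2) hne
  have off : ∀ p q, p ≠ a → p ≠ τ a → q ≠ a → q ≠ τ a → exc τ l p q = 0 := by
    intro p q h1 h2 h3 h4
    unfold exc
    split_ifs with h
    · rfl
    push Not at h
    apply max_eq_right
    have := half_bound τ hτ l hl hs {a, p, q} (by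
      intro x hx hx2
      simp only [Finset.mem_insert, Finset.mem_singleton] at hx hx2
      have key : ∀ y z, y = τ z → z = τ y := by
        intro y z h; rw [h, hτ]
      by_cases hh : τ x = x
      · exact hfix _ hh
      exfalso
      rcases hx with rfl | rfl | rfl <;> rcases hx2 with h | h | h <;>
        first
        | exact hh h
        | (have hz := key _ _ h.symm; have := h.symm; tauto))
    rw [Finset.sum_insert (by simp; tauto), Finset.sum_pair h.1.symm] at this
    have hp := ha p (Finset.mem_univ _)
    have hq := ha q (Finset.mem_univ _)
    nlinarith [sq_nonneg (l p + l q)]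
  have pt : ∀ p q, exc τ l p q ≤ (if p = a then exc τ l a q else 0)
      + (if p = τ a then exc τ l (τ a) q else 0)
      + (if q = a then exc τ l a p else 0) + (if q = τ a then exc τ l (τ a) p else 0) := by
    intro p q
    have n1 := exc_nonneg τ l a q
    have n2 := exc_nonneg τ l (τ a) q
    have n3 := exc_nonneg τ l a p
    have n4 := exc_nonneg τ l (τ a) p
    have m1 : 0 ≤ (if p = a then exc τ l a q else 0) := by split_ifs <;> simp [n1]
    have m2 : 0 ≤ (if p = τ a then exc τ l (τ a) q else 0) := by split_ifs <;> simp [n2]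
    have m3 : 0 ≤ (if q = a then exc τ l a p else 0) := by split_ifs <;> simp [n3]
    have m4 : 0 ≤ (if q = τ a then exc τ l (τ a) p else 0) := by split_ifs <;> simp [n4]
    by_cases c1 : p = a
    · rw [if_pos c1] at m1 ⊢; rw [c1] at m2 m3 m4 ⊢; linarith
    by_cases c2 : p = τ a
    · rw [if_pos c2] at m2 ⊢; rw [c2] at m1 m3 m4 ⊢; linarith
    by_cases c3 : q = a
    · rw [if_pos c3] at m3 ⊢; rw [exc_symm τ hτ l p q]; rw [c3] at m1 m2 m4 ⊢; linarith
    by_cases c4 : q = τ a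
    · rw [if_pos c4] at m4 ⊢; rw [exc_symm τ hτ l p q]; rw [c4] at m1 m2 m3 ⊢; linarith
    rw [off p q c1 c2 c3 c4]; linarith
  have := Finset.sum_le_sum (s := Finset.univ) (fun p _ =>
    Finset.sum_le_sum (s := Finset.univ) (fun q _ => pt p q))
  refine this.trans ?_
  simp only [Finset.sum_add_distrib]
  have r1 := row_bound τ hτ l hl hs a
  have r2 := row_bound τ hτ l hl hs (τ a)
  have s1 : ∀ b, ∑ p, ∑ q, (if p = b then exc τ l b q else 0) = ∑ q, exc τ l b q := by
    intro b; rw [Finset.sum_comm]; simp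
  have s2 : ∀ b, ∑ p, ∑ q, (if q = b then exc τ l b p else 0) = ∑ q, exc τ l b q := by
    intro b; simp
  rw [s1, s1, s2, s2]
  linarith

theorem skew_canon (d : ℕ) : ∀ (V : Type) [NormedAddCommGroup V] [InnerProductSpace ℝ V]
    [FiniteDimensional ℝ V], Module.finrank ℝ V = d → ∀ T : V →ₗ[ℝ] V,
    (∀ x y, inner ℝ (T x) y = -inner ℝ x (T y)) →
    ∃ (ι : Type) (_ : Fintype ι) (v : ι → V) (τ : ι → ι) (l : ι → ℝ),
      Orthonormal ℝ v ∧ Fintype.card ι = d ∧ Function.Involutive τ ∧ (∀ p, l (τ p) = -l p) ∧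
      ∀ p, T (v p) = l p • v (τ p) := by
  induction d using Nat.strong_induction_on with
  | _ d ih =>
  intro V _ _ _ hd T hT
  rcases Nat.eq_zero_or_pos d with h0 | hpos
  · refine ⟨Empty, inferInstance, fun x => x.elim, fun x => x, fun x => x.elim, ?_, ?_, ?_, ?_, ?_⟩
    · constructor <;> intro x <;> exact x.elim
    · simp [h0]
    · intro x; rfl
    · intro x; exact x.elim
    · intro x; exact x.elim
  have hsym : (T * T).IsSymmetric := by
    intro x y
    simp only [Module.End.mul_apply]
    rw [hT, hT]; simp
  -- extraction step
  have step : ∀ (κ : Type) [Fintype κ] (w : κ → V) (σ : κ → κ) (k : κ → ℝ), Orthonormal ℝ w →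
      0 < Fintype.card κ → Function.Involutive σ → (∀ p, k (σ p) = -k p) →
      (∀ p, T (w p) = k p • w (σ p)) →
      ∃ (ι : Type) (_ : Fintype ι) (v : ι → V) (τ : ι → ι) (l : ι → ℝ),
      Orthonormal ℝ v ∧ Fintype.card ι = d ∧ Function.Involutive τ ∧ (∀ p, l (τ p) = -l p) ∧
      ∀ p, T (v p) = l p • v (τ p) := by
    intro κ _ w σ k hw hκ hσ hk hTw
    let W : Submodule ℝ V := Submodule.span ℝ (Set.range w)
    have hWd : Module.finrank ℝ W = Fintype.card κ :=
      finrank_span_eq_card hw.linearIndependent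
    have hinv : ∀ x ∈ Wᗮ, T x ∈ Wᗮ := by
      intro x hx
      rw [Submodule.mem_orthogonal] at hx ⊢
      intro u hu
      have hTu : T u ∈ W := by
        refine Submodule.span_induction (p := fun u _ => T u ∈ W) ?_ ?_ ?_ ?_ hu
        · rintro _ ⟨p, rfl⟩
          rw [hTw]
          exact W.smul_mem _ (Submodule.subset_span ⟨_, rfl⟩)
        · simp
        · intro x y _ _ hx hy; rw [map_add]; exact W.add_mem hx hy
        · intro a x _ hx; rw [map_smul]; exact W.smul_mem _ hx
      have := hT u x
      rw [hx _ hTu] at this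
      linarith
    have hsum := W.finrank_add_finrank_orthogonal
    rw [hd, hWd] at hsum
    obtain ⟨ι, _, v, τ, l, hv, hc, hτ, hl, hTv⟩ := ih (Module.finrank ℝ Wᗮ) (by omega) Wᗮ rfl
      (T.restrict hinv) (by
        intro x y
        simp only [Submodule.coe_inner, LinearMap.coe_restrict_apply]
        exact hT _ _)
    refine ⟨κ ⊕ ι, inferInstance, Sum.elim w (fun i => (v i : V)), Sum.map σ τ, Sum.elim k l,
      ?_, ?_, ?_, ?_, ?_⟩
    · have hwW : ∀ p, w p ∈ W := fun p => Submodule.subset_span ⟨_, rfl⟩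
      constructor
      · rintro (p | p)
        · exact hw.1 p
        · exact hv.1 p
      · rintro (p | p) (q | q) hpq
        · exact hw.2 (fun h => hpq (by rw [h]))
        · exact Submodule.inner_right_of_mem_orthogonal (hwW p) (v q).2
        · exact Submodule.inner_left_of_mem_orthogonal (hwW q) (v p).2
        · exact hv.2 (fun h => hpq (by rw [h]))
    · simp [hc, hsum]
    · rintro (p | p)
      · simp [hσ p]
      · simp [hτ p]
    · rintro (p | p)
      · simp [hk]
      · simp [hl]
    · rintro (p | p)
      · simp [hTw]
      · have := congrArg (Subtype.val) (hTv p)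
        simpa using this
  let i0 : Fin d := ⟨0, hpos⟩
  let e : V := hsym.eigenvectorBasis hd i0
  let μ : ℝ := hsym.eigenvalues hd i0
  have he1 : ‖e‖ = 1 := (hsym.eigenvectorBasis hd).orthonormal.1 i0
  have heig : T (T e) = μ • e := hsym.apply_eigenvectorBasis hd i0
  have hnorm : ‖T e‖ ^ 2 = -μ := by
    have := hT e (T e)
    rw [heig, real_inner_self_eq_norm_sq, inner_smul_right, real_inner_self_eq_norm_sq, he1] at this
    linarith
  have hee : inner ℝ (T e) e = 0 := by
    have := hT e e
    rw [real_inner_comm (T e) e] at this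
    linarith [real_inner_comm (T e) e]
  by_cases hTe : T e = 0
  · refine step Unit (fun _ => e) id (fun _ => 0) ?_ ?_ ?_ ?_ ?_
    · constructor
      · intro _; exact he1
      · intro i j hij; exact absurd (Subsingleton.elim i j) hij
    · simp
    · intro x; rfl
    · simp
    · simp [hTe]
  · have hν : ‖T e‖ ≠ 0 := norm_ne_zero_iff.2 hTe
    set ν := ‖T e‖ with hνd
    refine step Bool (fun b => if b then e else ν⁻¹ • T e) (fun b => !b)
      (fun b => if b then ν else -ν) ?_ ?_ ?_ ?_ ?_
    · constructor
      · rintro (_ | _)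
        · simp only [Bool.false_eq_true, if_false, norm_smul, norm_inv, ← hνd]
          rw [Real.norm_of_nonneg (norm_nonneg _)]
          exact inv_mul_cancel₀ hν
        · simpa using he1
      · rintro (_ | _) (_ | _) h
        · exact absurd rfl h
        · simp [inner_smul_left, hee]
        · have h2 : inner ℝ e (T e) = 0 := by rw [real_inner_comm]; exact hee
          simp [inner_smul_right, h2]
        · exact absurd rfl h
    · simp
    · intro x; simp
    · rintro (_ | _) <;> simp
    · rintro (_ | _)
      · simp only [Bool.false_eq_true, if_false, map_smul, heig, smul_smul, Bool.not_false, if_true]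
        congr 1
        have : μ = -ν ^ 2 := by linarith
        rw [this]; field_simp
      · simp [smul_smul, hν]

theorem skew_canon_matrix {n : ℕ} (A : Matrix (Fin n) (Fin n) ℝ) (hA : Aᵀ = -A) :
    ∃ (P : Matrix (Fin n) (Fin n) ℝ) (τ : Fin n → Fin n) (l : Fin n → ℝ),
      Pᵀ * P = 1 ∧ P * Pᵀ = 1 ∧ Function.Involutive τ ∧ (∀ p, l (τ p) = -l p) ∧
      Pᵀ * A * P = Matrix.of (fun p q => if p = τ q then l q else 0) := by
  obtain ⟨ι, _, v, τ, l, hv, hc, hτ, hl, hTv⟩ := skew_canon n (EuclideanSpace ℝ (Fin n)) (by simp)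
    (Matrix.toEuclideanLin A) (by
      intro x y
      simp only [EuclideanSpace.inner_eq_star_dotProduct, Matrix.ofLp_toLpLin,
        Matrix.toLin'_apply, star_trivial]
      rw [Matrix.dotProduct_mulVec, ← Matrix.mulVec_transpose, hA, Matrix.neg_mulVec,
        neg_dotProduct]
      )
  let ε : Fin n ≃ ι := (Fintype.equivFinOfCardEq hc).symm
  let P : Matrix (Fin n) (Fin n) ℝ := Matrix.of fun i p => v (ε p) i
  have hPP : Pᵀ * P = 1 := by
    ext p q
    have := (orthonormal_iff_ite.1 (hv.comp ε ε.injective)) p q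
    simp only [Function.comp, EuclideanSpace.inner_eq_star_dotProduct, star_trivial] at this
    rw [Matrix.mul_apply, Matrix.one_apply, ← this, dotProduct]
    apply Finset.sum_congr rfl
    intro i _
    simp [P, mul_comm]
  have hAP : A * P = P * Matrix.of (fun p q => if p = ε.symm (τ (ε q)) then l (ε q) else 0) := by
    ext i q
    have := congrFun (congrArg (fun x => x.ofLp) (hTv (ε q))) i
    simp only [Matrix.ofLp_toLpLin, Matrix.toLin'_apply] at this
    rw [Matrix.mul_apply, Matrix.mul_apply]
    simpa [P, Matrix.mulVec, dotProduct, mul_comm] using this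
  refine ⟨P, fun p => ε.symm (τ (ε p)), fun p => l (ε p), hPP, mul_eq_one_comm.1 hPP, ?_, ?_, ?_⟩
  · intro p; simp [hτ _]
  · intro p; simp [hl]
  · rw [Matrix.mul_assoc, hAP, ← Matrix.mul_assoc, hPP, Matrix.one_mul]

/-- Frobenius inner product -/
noncomputable def fip {n : ℕ} (X Y : Matrix (Fin n) (Fin n) ℝ) : ℝ := trace (X * Yᵀ)

theorem fip_eq {n : ℕ} (X Y : Matrix (Fin n) (Fin n) ℝ) :
    fip X Y = ∑ i, ∑ j, X i j * Y i j := by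
  simp [fip, trace, Matrix.mul_apply]

theorem fip_self {n : ℕ} (X : Matrix (Fin n) (Fin n) ℝ) :
    fip X X = ∑ i, ∑ j, X i j ^ 2 := by
  simp [fip_eq, sq]

theorem fip_self_nonneg {n : ℕ} (X : Matrix (Fin n) (Fin n) ℝ) : 0 ≤ fip X X := by
  rw [fip_self]; positivity

theorem fip_comm {n : ℕ} (X Y : Matrix (Fin n) (Fin n) ℝ) : fip X Y = fip Y X := by
  simp [fip_eq, mul_comm]

theorem fip_smul_left {n : ℕ} (c : ℝ) (X Y : Matrix (Fin n) (Fin n) ℝ) :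
    fip (c • X) Y = c * fip X Y := by
  simp [fip]

theorem fip_smul_right {n : ℕ} (c : ℝ) (X Y : Matrix (Fin n) (Fin n) ℝ) :
    fip X (c • Y) = c * fip X Y := by
  simp [fip]

theorem fip_sub_left {n : ℕ} (X Y Z : Matrix (Fin n) (Fin n) ℝ) :
    fip (X - Y) Z = fip X Z - fip Y Z := by
  simp [fip, Matrix.sub_mul]

theorem fip_sub_right {n : ℕ} (X Y Z : Matrix (Fin n) (Fin n) ℝ) :
    fip Z (X - Y) = fip Z X - fip Z Y := by
  simp [fip, Matrix.mul_sub]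

theorem fip_sum_left {n : ℕ} {σ : Type*} (S : Finset σ) (X : σ → Matrix (Fin n) (Fin n) ℝ)
    (Z : Matrix (Fin n) (Fin n) ℝ) :
    fip (∑ s ∈ S, X s) Z = ∑ s ∈ S, fip (X s) Z := by
  simp [fip, Matrix.sum_mul, Matrix.trace_sum]

theorem fip_sum_right {n : ℕ} {σ : Type*} (S : Finset σ) (X : σ → Matrix (Fin n) (Fin n) ℝ)
    (Z : Matrix (Fin n) (Fin n) ℝ) :
    fip Z (∑ s ∈ S, X s) = ∑ s ∈ S, fip Z (X s) := by
  rw [fip_comm, fip_sum_left]; simp [fip_comm]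

theorem fip_bessel {n : ℕ} {σ : Type*} [DecidableEq σ] (S : Finset σ)
    (Q : σ → Matrix (Fin n) (Fin n) ℝ)
    (hQ : ∀ s ∈ S, ∀ t ∈ S, fip (Q s) (Q t) = if s = t then 1 else 0)
    (X : Matrix (Fin n) (Fin n) ℝ) : ∑ s ∈ S, fip (Q s) X ^ 2 ≤ fip X X := by
  have h := fip_self_nonneg (X - ∑ s ∈ S, fip (Q s) X • Q s)
  have e1 : fip (∑ s ∈ S, fip (Q s) X • Q s) X = ∑ s ∈ S, fip (Q s) X ^ 2 := by
    rw [fip_sum_left]; simp [fip_smul_left, sq]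
  have e2 : fip (∑ s ∈ S, fip (Q s) X • Q s) (∑ s ∈ S, fip (Q s) X • Q s)
      = ∑ s ∈ S, fip (Q s) X ^ 2 := by
    rw [fip_sum_left]
    apply Finset.sum_congr rfl
    intro s hs
    rw [fip_smul_left, fip_sum_right, Finset.sum_eq_single_of_mem s hs]
    · rw [fip_smul_right, hQ s hs s hs]; simp [sq]
    · intro t ht hts
      rw [fip_smul_right, hQ s hs t ht, if_neg hts.symm, mul_zero]
  rw [fip_sub_left, fip_sub_right, fip_sub_right, e2, e1, fip_comm X (∑ s ∈ S, _), e1] at h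
  linarith

theorem fip_conj {n : ℕ} (P : Matrix (Fin n) (Fin n) ℝ) (hP : P * Pᵀ = 1)
    (X Y : Matrix (Fin n) (Fin n) ℝ) : fip (Pᵀ * X * P) (Pᵀ * Y * P) = fip X Y := by
  unfold fip
  have : Pᵀ * X * P * (Pᵀ * Y * P)ᵀ = Pᵀ * (X * (P * Pᵀ) * Yᵀ * P) := by
    simp only [Matrix.transpose_mul, Matrix.transpose_transpose, Matrix.mul_assoc]
  rw [this, Matrix.trace_mul_comm, hP, Matrix.mul_one, Matrix.mul_assoc, hP, Matrix.mul_one]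

theorem sum_avg {n : ℕ} (τ : Fin n → Fin n) (hτ : Function.Involutive τ)
    (f : Fin n → Fin n → ℝ) :
    ∑ p, ∑ q, f p q =
      ∑ p, ∑ q, (f p q + f (τ p) q + f p (τ q) + f (τ p) (τ q)) / 4 := by
  have hq : ∀ g : Fin n → ℝ, ∑ q, g (τ q) = ∑ q, g q := fun g => Equiv.sum_comp hτ.toPerm g
  have h1 : ∑ p, ∑ q, f (τ p) q = ∑ p, ∑ q, f p q := hq (fun p => ∑ q, f p q)
  have h2 : ∑ p, ∑ q, f p (τ q) = ∑ p, ∑ q, f p q :=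
    Finset.sum_congr rfl (fun p _ => hq (fun q => f p q))
  have h3 : ∑ p, ∑ q, f (τ p) (τ q) = ∑ p, ∑ q, f p q := by
    rw [← h2]; exact hq (fun p => ∑ q, f p (τ q))
  simp only [← Finset.sum_div, Finset.sum_add_distrib, h1, h2, h3]
  ring

theorem canon_comm {n : ℕ} (τ : Fin n → Fin n) (hτ : Function.Involutive τ) (l : Fin n → ℝ)
    (hl : ∀ p, l (τ p) = -l p) (C Q : Matrix (Fin n) (Fin n) ℝ)
    (hC : C = Matrix.of (fun p q => if p = τ q then l q else 0)) :
    fip (C * Q - Q * C) (C * Q - Q * C) = ∑ p, ∑ q, (l p - l q) ^ 2 / 4 *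
      ((Q p q + Q (τ p) (τ q)) ^ 2 + (Q p (τ q) - Q (τ p) q) ^ 2) := by
  have hent : ∀ p q, (C * Q - Q * C) p q = -(l p * Q (τ p) q + l q * Q p (τ q)) := by
    intro p q
    rw [Matrix.sub_apply, Matrix.mul_apply, Matrix.mul_apply, hC]
    have h1 : ∑ j, (Matrix.of (fun p q => if p = τ q then l q else 0) : Matrix (Fin n) (Fin n) ℝ) p j
        * Q j q = -l p * Q (τ p) q := by
      rw [Finset.sum_eq_single (τ p)]
      · simp [hτ p, hl]
      · intro j _ hj
        have : p ≠ τ j := fun h => hj (by rw [h, hτ])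
        simp [this]
      · simp
    rw [h1]
    simp
    ring
  rw [fip_self]
  simp only [hent]
  rw [sum_avg τ hτ, sum_avg τ hτ (fun p q => (l p - l q) ^ 2 / 4 *
      ((Q p q + Q (τ p) (τ q)) ^ 2 + (Q p (τ q) - Q (τ p) q) ^ 2))]
  apply Finset.sum_congr rfl; intro p _
  apply Finset.sum_congr rfl; intro q _
  simp only [hτ p, hτ q, hl]
  ring

theorem canon_norm {n : ℕ} (τ : Fin n → Fin n) (hτ : Function.Involutive τ)
    (Q : Matrix (Fin n) (Fin n) ℝ) :
    fip Q Q = ∑ p, ∑ q, 1 / 4 *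
      ((Q p q + Q (τ p) (τ q)) ^ 2 + (Q p (τ q) - Q (τ p) q) ^ 2) := by
  rw [fip_self, sum_avg τ hτ, sum_avg τ hτ (fun p q => 1 / 4 *
      ((Q p q + Q (τ p) (τ q)) ^ 2 + (Q p (τ q) - Q (τ p) q) ^ 2))]
  apply Finset.sum_congr rfl; intro p _
  apply Finset.sum_congr rfl; intro q _
  simp only [hτ p, hτ q]
  ring

theorem fip_single {n : ℕ} (Q : Matrix (Fin n) (Fin n) ℝ) (p q : Fin n) (c : ℝ) :
    fip Q (Matrix.single p q c) = Q p q * c := by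
  rw [fip_eq, Finset.sum_eq_single p, Finset.sum_eq_single q]
  · simp
  · intro j _ hj; simp [Matrix.single_apply, hj.symm]
  · simp
  · intro i _ hi
    apply Finset.sum_eq_zero
    intro j _; simp [Matrix.single_apply, hi.symm]
  · simp

theorem fip_add_right {n : ℕ} (X Y Z : Matrix (Fin n) (Fin n) ℝ) :
    fip Z (X + Y) = fip Z X + fip Z Y := by
  simp [fip, Matrix.mul_add]

/-- Bessel bound for pairs of entries -/
theorem pair_bessel {n : ℕ} {σ : Type*} [DecidableEq σ] (S : Finset σ)
    (Q : σ → Matrix (Fin n) (Fin n) ℝ) (hsk : ∀ s p q, Q s q p = -Q s p q)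
    (hQ : ∀ s ∈ S, ∀ t ∈ S, fip (Q s) (Q t) = if s = t then 1 else 0)
    (p q pp qq : Fin n) (ε : ℝ) (hε : ε ^ 2 = 1) (h1 : p ≠ q) (h2 : pp ≠ qq)
    (h3 : ¬ (p = pp ∧ q = qq)) (h4 : ¬ (p = qq ∧ q = pp)) :
    ∑ s ∈ S, (Q s p q + ε * Q s pp qq) ^ 2 ≤ 1 := by
  let X : Matrix (Fin n) (Fin n) ℝ := Matrix.single p q (1 / 2) - Matrix.single q p (1 / 2)
    + (Matrix.single pp qq (ε / 2) - Matrix.single qq pp (ε / 2))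
  have hX : ∀ Y : Matrix (Fin n) (Fin n) ℝ,
      fip Y X = (Y p q - Y q p) / 2 + ε * (Y pp qq - Y qq pp) / 2 := by
    intro Y
    simp only [X, fip_add_right, fip_sub_right, fip_single]
    ring
  have hb := fip_bessel S Q hQ X
  have hXX : fip X X = 1 := by
    rw [hX]
    have a1 : ¬ (pp = p ∧ qq = q) := fun h => h3 ⟨h.1.symm, h.2.symm⟩
    have a2 : ¬ (qq = p ∧ pp = q) := fun h => h4 ⟨h.1.symm, h.2.symm⟩
    have a3 : ¬ (q = qq ∧ p = pp) := fun h => h3 ⟨h.2, h.1⟩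
    have a4 : ¬ (qq = q ∧ pp = p) := fun h => h3 ⟨h.2.symm, h.1.symm⟩
    have a5 : ¬ (q = pp ∧ p = qq) := fun h => h4 ⟨h.2, h.1⟩
    have a6 : ¬ (pp = q ∧ qq = p) := fun h => h4 ⟨h.2.symm, h.1.symm⟩
    have b1 : ¬ (q = p ∧ p = q) := fun h => h1 h.2
    have b2 : ¬ (p = q ∧ q = p) := fun h => h1 h.1
    have b3 : ¬ (qq = pp ∧ pp = qq) := fun h => h2 h.2
    have b4 : ¬ (pp = qq ∧ qq = pp) := fun h => h2 h.1
    simp only [X, Matrix.add_apply, Matrix.sub_apply, Matrix.single_apply, a1, a2, a3, a4, a5, a6,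
      b1, b2, b3, b4, h3, h4, and_self, if_true, if_false]
    linear_combination (1 / 2) * hε
  rw [hXX] at hb
  refine le_trans (le_of_eq ?_) hb
  apply Finset.sum_congr rfl
  intro s _
  rw [hX, hsk s p q, hsk s pp qq]
  ring

theorem canon_key {n : ℕ} {σ : Type*} [DecidableEq σ] (τ : Fin n → Fin n)
    (hτ : Function.Involutive τ) (l : Fin n → ℝ)
    (hl : ∀ p, l (τ p) = -l p) (C : Matrix (Fin n) (Fin n) ℝ)
    (hC : C = Matrix.of (fun p q => if p = τ q then l q else 0)) (hC1 : fip C C = 1)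
    (S : Finset σ) (Q : σ → Matrix (Fin n) (Fin n) ℝ) (hsk : ∀ s p q, Q s q p = -Q s p q)
    (hQ : ∀ s ∈ S, ∀ t ∈ S, fip (Q s) (Q t) = if s = t then 1 else 0) :
    ∑ s ∈ S, (fip (C * Q s - Q s * C) (C * Q s - Q s * C) - 2 / 3) ≤ 2 / 3 := by
  have hfix : ∀ p, τ p = p → l p = 0 := by
    intro p hp; have := hl p; rw [hp] at this; linarith
  have hdiag : ∀ s p, Q s p p = 0 := by
    intro s p; have := hsk s p p; linarith
  have hs : ∑ p, l p ^ 2 = 1 := by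
    rw [← hC1, fip_self, Finset.sum_comm, hC]
    simp
  have htot := exc_total τ hτ l hl hs
  have e1 : ∀ s ∈ S, fip (C * Q s - Q s * C) (C * Q s - Q s * C) - 2 / 3 =
      ∑ p, ∑ q, ((l p - l q) ^ 2 - 2 / 3) / 4 *
      ((Q s p q + Q s (τ p) (τ q)) ^ 2 + (Q s p (τ q) - Q s (τ p) q) ^ 2) := by
    intro s hs
    have h1 : fip (Q s) (Q s) = 1 := by rw [hQ s hs s hs, if_pos rfl]
    have h2 := canon_norm τ hτ (Q s)
    rw [canon_comm τ hτ l hl C (Q s) hC]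
    rw [h1] at h2
    have h3 : (2 / 3 : ℝ) = 2 / 3 * ∑ p, ∑ q, 1 / 4 *
      ((Q s p q + Q s (τ p) (τ q)) ^ 2 + (Q s p (τ q) - Q s (τ p) q) ^ 2) := by
      rw [← h2, mul_one]
    conv_lhs => rw [h3]
    simp only [Finset.mul_sum, ← Finset.sum_sub_distrib]
    apply Finset.sum_congr rfl; intro p _
    apply Finset.sum_congr rfl; intro q _
    ring
  rw [Finset.sum_congr rfl e1, Finset.sum_comm]
  have pt : ∀ p q, ∑ s ∈ S, ((l p - l q) ^ 2 - 2 / 3) / 4 *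
      ((Q s p q + Q s (τ p) (τ q)) ^ 2 + (Q s p (τ q) - Q s (τ p) q) ^ 2) ≤
      exc τ l p q / 2 := by
    intro p q
    rw [← Finset.mul_sum]
    have hnn : 0 ≤ ∑ s ∈ S, ((Q s p q + Q s (τ p) (τ q)) ^ 2 + (Q s p (τ q) - Q s (τ p) q) ^ 2) :=
      Finset.sum_nonneg (fun s _ => by positivity)
    have hex := exc_nonneg τ l p q
    by_cases hle : (l p - l q) ^ 2 ≤ 2 / 3
    · have := mul_nonneg (sub_nonneg.2 hle) hnn
      linarith
    push Not at hle
    have hpq : q ≠ p := by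
      rintro rfl; norm_num at hle
    by_cases hqt : q = τ p
    · have : ∀ s, (Q s p q + Q s (τ p) (τ q)) ^ 2 + (Q s p (τ q) - Q s (τ p) q) ^ 2 = 0 := by
        intro s
        rw [hqt, hτ p, hdiag, hdiag, hsk s p (τ p)]; ring
      simp only [this, Finset.sum_const_zero, mul_zero]
      linarith
    have hqt2 : p ≠ τ q := fun h => hqt (by rw [h, hτ])
    have hnf : ¬ (p = τ p ∧ q = τ q) := by
      rintro ⟨h1, h2⟩
      rw [hfix p h1.symm, hfix q h2.symm] at hle
      norm_num at hle
    have hττ : τ p ≠ τ q := fun h => hpq (hτ.injective h).symm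
    have b1 := pair_bessel S Q hsk hQ p q (τ p) (τ q) 1 (by norm_num) hpq.symm hττ hnf
      (fun h => hqt2 h.1)
    have b2 := pair_bessel S Q hsk hQ p (τ q) (τ p) q (-1) (by norm_num) hqt2 (Ne.symm hqt)
      (fun h => hnf ⟨h.1, h.2.symm⟩) (fun h => hpq h.1.symm)
    have b3 : ∑ s ∈ S, ((Q s p q + Q s (τ p) (τ q)) ^ 2 + (Q s p (τ q) - Q s (τ p) q) ^ 2) ≤ 2 := by
      rw [Finset.sum_add_distrib]
      simp only [one_mul, neg_one_mul, ← sub_eq_add_neg] at b1 b2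
      linarith
    have hexc : exc τ l p q = (l p - l q) ^ 2 - 2 / 3 := by
      unfold exc
      rw [if_neg (by tauto), max_eq_left (by linarith)]
    rw [hexc]
    nlinarith
  calc _ = ∑ p, ∑ q, ∑ s ∈ S, ((l p - l q) ^ 2 - 2 / 3) / 4 *
      ((Q s p q + Q s (τ p) (τ q)) ^ 2 + (Q s p (τ q) - Q s (τ p) q) ^ 2) := by
        apply Finset.sum_congr rfl; intro p _; rw [Finset.sum_comm]
    _ ≤ ∑ p, ∑ q, exc τ l p q / 2 :=
        Finset.sum_le_sum fun p _ => Finset.sum_le_sum fun q _ => pt p q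
    _ = (∑ p, ∑ q, exc τ l p q) / 2 := by simp only [Finset.sum_div]
    _ ≤ 2 / 3 := by linarith

theorem key {n : ℕ} {σ : Type*} [DecidableEq σ] (A : Matrix (Fin n) (Fin n) ℝ) (hA : Aᵀ = -A)
    (hA1 : fip A A = 1)
    (S : Finset σ) (Q : σ → Matrix (Fin n) (Fin n) ℝ) (hsk : ∀ s, (Q s)ᵀ = -Q s)
    (hQ : ∀ s ∈ S, ∀ t ∈ S, fip (Q s) (Q t) = if s = t then 1 else 0) :
    ∑ s ∈ S, (fip (A * Q s - Q s * A) (A * Q s - Q s * A) - 2 / 3) ≤ 2 / 3 := by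
  obtain ⟨P, τ, l, h1, h2, hτ, hl, hC⟩ := skew_canon_matrix A hA
  have := canon_key τ hτ l hl (Pᵀ * A * P) hC (by rw [fip_conj P h2, hA1]) S
    (fun s => Pᵀ * Q s * P) (by
      intro s p q
      have : (Pᵀ * Q s * P)ᵀ = -(Pᵀ * Q s * P) := by
        simp [Matrix.transpose_mul, hsk, Matrix.mul_assoc]
      exact congrFun (congrFun this p) q)
    (by intro s hs t ht; rw [fip_conj P h2, hQ s hs t ht])
  have hc : ∀ s, Pᵀ * A * P * (Pᵀ * Q s * P) - Pᵀ * Q s * P * (Pᵀ * A * P)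
      = Pᵀ * (A * Q s - Q s * A) * P := by
    intro s
    have e : ∀ X Y : Matrix (Fin n) (Fin n) ℝ, Pᵀ * X * P * (Pᵀ * Y * P) = Pᵀ * (X * Y) * P := by
      intro X Y
      calc _ = Pᵀ * (X * (P * Pᵀ) * Y) * P := by simp only [Matrix.mul_assoc]
        _ = _ := by rw [h2, Matrix.mul_one]
    rw [e, e, Matrix.mul_sub, Matrix.sub_mul]
  simp only [hc, fip_conj P h2] at this
  exact this

theorem ddvv_orth {m n : ℕ} (B : Fin m → Matrix (Fin n) (Fin n) ℝ)
    (hskew : ∀ r, (B r)ᵀ = -(B r)) (horth : ∀ r s, r ≠ s → fip (B r) (B s) = 0) :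
    ∑ r, ∑ s, fip (B r * B s - B s * B r) (B r * B s - B s * B r) ≤
      (2 / 3) * (∑ r, fip (B r) (B r)) ^ 2 := by
  set x : Fin m → ℝ := fun r => fip (B r) (B r) with hx
  have hx0 : ∀ r, 0 ≤ x r := fun r => fip_self_nonneg _
  let Q : Fin m → Matrix (Fin n) (Fin n) ℝ := fun r => (Real.sqrt (x r))⁻¹ • B r
  have hQsk : ∀ r, (Q r)ᵀ = -Q r := by intro r; simp [Q, hskew]
  have hBQ : ∀ r, B r = Real.sqrt (x r) • Q r := by
    intro r
    by_cases h : x r = 0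
    · have hB : B r = 0 := by
        have hz : fip (B r) (B r) = 0 := h
        rw [fip_self] at hz
        ext i j
        have h1 := (Finset.sum_eq_zero_iff_of_nonneg
          (fun i _ => Finset.sum_nonneg fun j _ => sq_nonneg (B r i j))).1 hz i (Finset.mem_univ _)
        have h2 := (Finset.sum_eq_zero_iff_of_nonneg
          (fun j _ => sq_nonneg (B r i j))).1 h1 j (Finset.mem_univ _)
        simpa using h2
      simp [Q, hB]
    · have : Real.sqrt (x r) ≠ 0 := by
        rw [Real.sqrt_ne_zero (hx0 r)]; exact h
      simp [Q, smul_smul, this]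
  let t : Fin m → Fin m → ℝ := fun r s => fip (Q r * Q s - Q s * Q r) (Q r * Q s - Q s * Q r)
  have ht : ∀ r s, fip (B r * B s - B s * B r) (B r * B s - B s * B r) = x r * x s * t r s := by
    intro r s
    have : B r * B s - B s * B r = (Real.sqrt (x r) * Real.sqrt (x s)) • (Q r * Q s - Q s * Q r) := by
      rw [hBQ r, hBQ s]
      simp only [Matrix.smul_mul, Matrix.mul_smul, smul_smul, smul_sub]
      rw [mul_comm (Real.sqrt (x s))]
    rw [this, fip_smul_left, fip_smul_right]
    have a := Real.mul_self_sqrt (hx0 r)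
    have b := Real.mul_self_sqrt (hx0 s)
    calc _ = (Real.sqrt (x r) * Real.sqrt (x r)) * (Real.sqrt (x s) * Real.sqrt (x s)) * t r s := by
          simp only [t]; ring
      _ = _ := by rw [a, b]
  have htsymm : ∀ r s, t r s = t s r := by
    intro r s
    simp only [t]
    rw [← neg_sub (Q s * Q r) (Q r * Q s)]
    simp only [fip_self, Matrix.neg_apply, neg_sq]
  have htdiag : ∀ r, t r r = 0 := by intro r; simp [t, fip]
  let I : Finset (Fin m) := Finset.univ.filter (fun r => x r ≠ 0)
  have hQI : ∀ r ∈ I, ∀ s ∈ I, fip (Q r) (Q s) = if r = s then 1 else 0 := by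
    intro r hr s hs
    simp only [Q, fip_smul_left, fip_smul_right]
    split_ifs with h
    · subst h
      have h1 : x r ≠ 0 := (Finset.mem_filter.1 hr).2
      have h2 := Real.mul_self_sqrt (hx0 r)
      change _ * (_ * x r) = 1
      rw [← mul_assoc, ← mul_inv, h2, inv_mul_cancel₀ h1]
    · rw [horth r s h]; simp
  let w : Fin m → Fin m → ℝ := fun r s => if s ∈ I then max (t r s - 2 / 3) 0 else 0
  have hw0 : ∀ r s, 0 ≤ w r s := by
    intro r s; simp only [w]; split_ifs <;> simp
  have hrow : ∀ r ∈ I, ∑ s, w r s ≤ 2 / 3 := by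
    intro r hr
    have hk := key (Q r) (hQsk r) (by rw [hQI r hr r hr, if_pos rfl])
      (I.filter (fun s => 2 / 3 < t r s)) Q hQsk (fun a ha b hb =>
        hQI a (Finset.mem_filter.1 ha).1 b (Finset.mem_filter.1 hb).1)
    refine le_trans (le_of_eq ?_) hk
    rw [Finset.sum_filter, ← Finset.univ_inter I, ← Finset.sum_ite_mem]
    apply Finset.sum_congr rfl
    intro s _
    simp only [w]
    by_cases hs : s ∈ I
    · rw [if_pos hs, if_pos (by simpa using hs)]
      by_cases h : 2 / 3 < t r s
      · rw [if_pos h, max_eq_left (by linarith)]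
      · rw [if_neg h, max_eq_right (by linarith)]
    · rw [if_neg hs, if_neg (by simpa using hs)]
  have hxI : ∀ s, s ∉ I → x s = 0 := by
    intro s hs; by_contra h; exact hs (by simp [I, h])
  have pt : ∀ r s, x r * x s * t r s ≤ 2 / 3 * (x r * x s) + 
      (if r ∈ I then (x r ^ 2 * w r s) / 2 else 0) + (if s ∈ I then (x s ^ 2 * w s r) / 2 else 0)
      - (if r = s then 2 / 3 * x r ^ 2 else 0) := by
    intro r s
    by_cases hr : r ∈ I
    · by_cases hs : s ∈ I
      · rw [if_pos hr, if_pos hs]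
        have hws : w s r = w r s := by
          simp only [w, if_pos hr, if_pos hs, htsymm r s]
        have hp := mul_nonneg (hx0 r) (hx0 s)
        rw [hws]
        split_ifs with h
        · subst h
          rw [htdiag]
          have := mul_nonneg (sq_nonneg (x r)) (hw0 r r)
          nlinarith
        · have h1 : t r s - 2 / 3 ≤ w r s := by
            simp only [w, if_pos hs]; exact le_max_left _ _
          have h2 := mul_le_mul_of_nonneg_left h1 hp
          have h3 := mul_nonneg (sq_nonneg (x r - x s)) (hw0 r s)
          nlinarith
      · have hrs : r ≠ s := fun h => hs (h ▸ hr)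
        rw [hxI s hs, if_pos hr, if_neg hs, if_neg hrs]
        have := mul_nonneg (sq_nonneg (x r)) (hw0 r s)
        linarith
    · rw [hxI r hr, if_neg hr]
      have h1 := mul_nonneg (sq_nonneg (x s)) (hw0 s r)
      have : 0 ≤ (if s ∈ I then (x s ^ 2 * w s r) / 2 else 0) := by
        split_ifs <;> linarith
      have h2 : (if r = s then 2 / 3 * (0 : ℝ) ^ 2 else 0) = 0 := by simp
      rw [h2]
      linarith
  have hW : ∀ r, ∑ s, (if r ∈ I then (x r ^ 2 * w r s) / 2 else 0) ≤ x r ^ 2 / 3 := by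
    intro r
    by_cases hr : r ∈ I
    · simp only [if_pos hr]
      rw [← Finset.sum_div, ← Finset.mul_sum]
      have := mul_le_mul_of_nonneg_left (hrow r hr) (sq_nonneg (x r))
      linarith
    · simp only [if_neg hr, Finset.sum_const_zero]; positivity
  have hW2 := Finset.sum_le_sum (s := Finset.univ) (fun r _ => hW r)
  simp only [ht]
  have := Finset.sum_le_sum (s := Finset.univ) (fun r _ =>
    Finset.sum_le_sum (s := Finset.univ) (fun s _ => pt r s))
  refine this.trans ?_
  simp only [Finset.sum_add_distrib, Finset.sum_sub_distrib]
  have c1 : ∑ r, ∑ s, (if s ∈ I then (x s ^ 2 * w s r) / 2 else 0)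
      = ∑ r, ∑ s, (if r ∈ I then (x r ^ 2 * w r s) / 2 else 0) := Finset.sum_comm
  have c2 : ∑ r, ∑ s, (if r = s then 2 / 3 * x r ^ 2 else 0) = 2 / 3 * ∑ r, x r ^ 2 := by
    simp [Finset.mul_sum]
  have c3 : ∑ r, ∑ s, 2 / 3 * (x r * x s) = 2 / 3 * (∑ r, x r) ^ 2 := by
    rw [sq, Finset.sum_mul_sum]; simp only [Finset.mul_sum]
  rw [c1, c2, c3]
  rw [← Finset.sum_div] at hW2
  linarith

theorem rot_invariant {m n : ℕ} (U : Matrix (Fin m) (Fin m) ℝ) (hU : U * Uᵀ = 1)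
    (v : Fin m → Matrix (Fin n) (Fin n) ℝ) :
    ∑ r, fip (∑ a, U a r • v a) (∑ a, U a r • v a) = ∑ a, fip (v a) (v a) := by
  simp only [fip_sum_left, fip_sum_right, fip_smul_left, fip_smul_right, Finset.mul_sum]
  rw [Finset.sum_comm]
  apply Finset.sum_congr rfl
  intro a _
  rw [Finset.sum_comm]
  have : ∀ b, ∑ r, U a r * (U b r * fip (v b) (v a)) = if a = b then fip (v b) (v a) else 0 := by
    intro b
    have h := congrFun (congrFun hU a) b
    rw [Matrix.mul_apply, Matrix.one_apply] at h
    simp only [Matrix.transpose_apply] at h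
    simp only [← mul_assoc]
    rw [← Finset.sum_mul, h]
    simp
  rw [Finset.sum_congr rfl (fun b _ => this b)]
  simp

theorem ddvv_fip {m n : ℕ} (B : Fin m → Matrix (Fin n) (Fin n) ℝ)
    (hskew : ∀ r, (B r)ᵀ = -(B r)) :
    ∑ r, ∑ s, fip (B r * B s - B s * B r) (B r * B s - B s * B r) ≤
      (2 / 3) * (∑ r, fip (B r) (B r)) ^ 2 := by
  let G : Matrix (Fin m) (Fin m) ℝ := Matrix.of fun r s => fip (B r) (B s)
  have hG : G.IsHermitian := by
    ext r s; simp [G, fip_comm]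
  let U : Matrix (Fin m) (Fin m) ℝ := (hG.eigenvectorUnitary : Matrix (Fin m) (Fin m) ℝ)
  have hUU : U * Uᵀ = 1 := by
    have := Unitary.coe_mul_star_self hG.eigenvectorUnitary
    simpa [Matrix.star_eq_conjTranspose] using this
  have hVV : Uᵀ * U = 1 := mul_eq_one_comm.1 hUU
  have hD : Uᵀ * G * U = Matrix.diagonal hG.eigenvalues := by
    have := hG.spectral_theorem
    rw [Unitary.conjStarAlgAut_apply] at this
    have h2 : G = U * Matrix.diagonal hG.eigenvalues * Uᵀ := by
      simpa [Matrix.star_eq_conjTranspose, Function.comp_def] using this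
    calc Uᵀ * G * U = Uᵀ * (U * Matrix.diagonal hG.eigenvalues * Uᵀ) * U := by rw [← h2]
      _ = (Uᵀ * U) * Matrix.diagonal hG.eigenvalues * (Uᵀ * U) := by
          simp only [Matrix.mul_assoc]
      _ = _ := by rw [hVV]; simp
  let Bo : Fin m → Matrix (Fin n) (Fin n) ℝ := fun r => ∑ a, U a r • B a
  have hBosk : ∀ r, (Bo r)ᵀ = -Bo r := by
    intro r
    simp [Bo, Matrix.transpose_sum, hskew]
  have horth : ∀ r s, r ≠ s → fip (Bo r) (Bo s) = 0 := by
    intro r s hrs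
    have h := congrFun (congrFun hD r) s
    rw [Matrix.diagonal_apply_ne _ hrs] at h
    rw [← h]
    simp only [Bo, fip_sum_left, fip_sum_right, fip_smul_left, fip_smul_right, Finset.mul_sum]
    rw [Matrix.mul_apply]
    simp only [Matrix.mul_apply, Finset.sum_mul, Matrix.transpose_apply, G, Matrix.of_apply]
    apply Finset.sum_congr rfl; intro a _
    apply Finset.sum_congr rfl; intro b _
    ring
  have main := ddvv_orth Bo hBosk horth
  have hn : ∑ r, fip (Bo r) (Bo r) = ∑ r, fip (B r) (B r) := rot_invariant U hUU B
  have hc : ∑ r, ∑ s, fip (Bo r * Bo s - Bo s * Bo r) (Bo r * Bo s - Bo s * Bo r)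
      = ∑ r, ∑ s, fip (B r * B s - B s * B r) (B r * B s - B s * B r) := by
    have e1 : ∀ r, ∑ s, fip (Bo r * Bo s - Bo s * Bo r) (Bo r * Bo s - Bo s * Bo r)
        = ∑ b, fip (Bo r * B b - B b * Bo r) (Bo r * B b - B b * Bo r) := by
      intro r
      rw [← rot_invariant U hUU (fun b => Bo r * B b - B b * Bo r)]
      apply Finset.sum_congr rfl; intro s _
      have : Bo r * Bo s - Bo s * Bo r = ∑ b, U b s • (Bo r * B b - B b * Bo r) := by
        simp only [smul_sub, Finset.sum_sub_distrib]
        change Bo r * (∑ a, U a s • B a) - (∑ a, U a s • B a) * Bo r = _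
        rw [Matrix.mul_sum, Matrix.sum_mul]
        simp only [Matrix.mul_smul, Matrix.smul_mul]
      rw [this]
    have e2 : ∀ b, ∑ r, fip (Bo r * B b - B b * Bo r) (Bo r * B b - B b * Bo r)
        = ∑ a, fip (B a * B b - B b * B a) (B a * B b - B b * B a) := by
      intro b
      rw [← rot_invariant U hUU (fun a => B a * B b - B b * B a)]
      apply Finset.sum_congr rfl; intro r _
      have : Bo r * B b - B b * Bo r = ∑ a, U a r • (B a * B b - B b * B a) := by
        simp only [smul_sub, Finset.sum_sub_distrib]
        change (∑ a, U a r • B a) * B b - B b * (∑ a, U a r • B a) = _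
        rw [Matrix.mul_sum, Matrix.sum_mul]
        simp only [Matrix.mul_smul, Matrix.smul_mul]
      rw [this]
    rw [Finset.sum_congr rfl (fun r _ => e1 r), Finset.sum_comm,
      Finset.sum_congr rfl (fun r _ => e2 r), Finset.sum_comm]
  rw [hn, hc] at main
  exact main

/-- DDVV-type inequality for real skew-symmetric n×n matrices, n ≥ 4. -/
theorem ddvv_skew (m n : ℕ) (hn : 4 ≤ n) (B : Fin m → Matrix (Fin n) (Fin n) ℝ)
    (hskew : ∀ r, (B r)ᵀ = -(B r)) :
    ∑ r, ∑ s, trace ((B r * B s - B s * B r) * (B r * B s - B s * B r)ᵀ) ≤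
      (2 / 3) * (∑ r, trace (B r * (B r)ᵀ)) ^ 2 := by
  exact ddvv_fip B hskew
end

section
/- For any m Hermitian n×n complex matrices B₁,…,B_m with m ≥ 3 and n ≥ 2, one has ∑_{r,s=1}^m ‖[B_r,B_s]‖² ≤ (4/3)(∑_{r=1}^m ‖B_r‖²)². -/
open Matrix

theorem edge_bound {n : ℕ} (l : Fin n → ℝ) (E : Finset (Fin n × Fin n))
    (hE : ∀ e ∈ E, e.1 < e.2) :
    ∑ e ∈ E, (l e.1 - l e.2) ^ 2 ≤ (E.card + 1) * ∑ k, l k ^ 2 := by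
  set c : Fin n × Fin n → ℝ := fun e => l e.1 - l e.2 with hc
  set v : Fin n × Fin n → Fin n → ℝ :=
    fun e k => (if k = e.1 then 1 else 0) - (if k = e.2 then 1 else 0) with hv
  set W : Fin n → ℝ := fun k => ∑ e ∈ E, c e * v e k with hW
  have h1 : ∑ k, W k * l k = ∑ e ∈ E, c e ^ 2 := by
    simp only [hW, Finset.sum_mul]
    rw [Finset.sum_comm]
    refine Finset.sum_congr rfl fun e _ => ?_
    simp [hv, mul_sub, sub_mul, Finset.sum_sub_distrib, hc]
    ring
  have hvv : ∀ e ∈ E, ∀ f ∈ E, |∑ k, v e k * v f k| ≤ 1 + (if e = f then 1 else 0) := by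
    intro e he f hf
    have h : ∑ k, v e k * v f k = (if e.1 = f.1 then 1 else 0) - (if e.1 = f.2 then 1 else 0)
        - (if e.2 = f.1 then 1 else 0) + (if e.2 = f.2 then 1 else 0) := by
      simp [hv, mul_sub, Finset.sum_sub_distrib]
      simp only [eq_comm (a := f.1), eq_comm (a := f.2)]
      ring
    rw [h]
    have a := hE e he
    have b := hE f hf
    obtain ⟨e1, e2⟩ := e
    obtain ⟨f1, f2⟩ := f
    simp only [Prod.mk.injEq] at *
    split_ifs <;> first | (exfalso; omega) | norm_num
  have h2 : ∑ k, W k ^ 2 ≤ (E.card + 1) * ∑ e ∈ E, c e ^ 2 := by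
    have : ∑ k, W k ^ 2 = ∑ e ∈ E, ∑ f ∈ E, c e * c f * ∑ k, v e k * v f k := by
      simp only [hW, sq, Finset.sum_mul_sum]
      simp only [Finset.mul_sum]
      rw [Finset.sum_comm]
      refine Finset.sum_congr rfl fun e _ => ?_
      rw [Finset.sum_comm]
      refine Finset.sum_congr rfl fun f _ => ?_
      refine Finset.sum_congr rfl fun k _ => ?_
      ring
    rw [this]
    calc _ ≤ ∑ e ∈ E, ∑ f ∈ E, |c e| * |c f| * (1 + (if e = f then 1 else 0)) := by
          refine Finset.sum_le_sum fun e he => Finset.sum_le_sum fun f hf => ?_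
          refine (le_abs_self _).trans ?_
          rw [abs_mul, abs_mul]
          exact mul_le_mul_of_nonneg_left (hvv e he f hf) (by positivity)
      _ = (∑ e ∈ E, |c e|) ^ 2 + ∑ e ∈ E, c e ^ 2 := by
          simp only [mul_add, mul_one, Finset.sum_add_distrib, sq, Finset.sum_mul_sum]
          congr 1
          refine Finset.sum_congr rfl fun e he => ?_
          simp [he]
      _ ≤ E.card * ∑ e ∈ E, |c e| ^ 2 + ∑ e ∈ E, c e ^ 2 := by
          gcongr
          exact sq_sum_le_card_mul_sum_sq
      _ = _ := by simp only [sq_abs]; ring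
  have h3 := Finset.sum_mul_sq_le_sq_mul_sq Finset.univ W l
  rw [h1] at h3
  have h0 : 0 ≤ ∑ e ∈ E, c e ^ 2 := Finset.sum_nonneg fun _ _ => sq_nonneg _
  have hl : 0 ≤ ∑ k, l k ^ 2 := Finset.sum_nonneg fun _ _ => sq_nonneg _
  rcases h0.eq_or_lt with h | h
  · change ∑ e ∈ E, c e ^ 2 ≤ _
    rw [← h]; positivity
  · have := h3.trans (mul_le_mul_of_nonneg_right h2 hl)
    change ∑ e ∈ E, c e ^ 2 ≤ _
    nlinarith

theorem excess_bound {n : ℕ} (l : Fin n → ℝ) :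
    ∑ i, ∑ j, max ((l i - l j) ^ 2 - ∑ k, l k ^ 2) 0 ≤ 2 * ∑ k, l k ^ 2 := by
  have hl : 0 ≤ ∑ k, l k ^ 2 := Finset.sum_nonneg fun _ _ => sq_nonneg _
  set N := ∑ k, l k ^ 2 with hN
  have key : ∑ i, ∑ j, (if i < j then max ((l i - l j) ^ 2 - N) 0 else 0) ≤ N := by
    rw [← Fintype.sum_prod_type' (f := fun i j => if i < j then max ((l i - l j) ^ 2 - N) 0 else 0)]
    have := edge_bound l (Finset.univ.filter fun e : Fin n × Fin n =>
      e.1 < e.2 ∧ 0 < (l e.1 - l e.2) ^ 2 - N) (by simp +contextual)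
    have h2 : ∑ x : Fin n × Fin n, (if x.1 < x.2 then max ((l x.1 - l x.2) ^ 2 - N) 0 else 0)
      = ∑ e ∈ (Finset.univ.filter fun e : Fin n × Fin n =>
      e.1 < e.2 ∧ 0 < (l e.1 - l e.2) ^ 2 - N), ((l e.1 - l e.2) ^ 2 - N) := by
      rw [Finset.sum_filter]
      refine Finset.sum_congr rfl fun e _ => ?_
      by_cases h : e.1 < e.2
      · by_cases h' : 0 < (l e.1 - l e.2) ^ 2 - N
        · rw [if_pos h, if_pos ⟨h, h'⟩, max_eq_left h'.le]
        · rw [if_pos h, if_neg (fun x => h' x.2), max_eq_right (not_lt.1 h')]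
      · rw [if_neg h, if_neg (fun x => h x.1)]
    rw [h2, Finset.sum_sub_distrib, Finset.sum_const, nsmul_eq_mul]
    linarith
  have key2 : ∑ i, ∑ j, (if j < i then max ((l i - l j) ^ 2 - N) 0 else 0) ≤ N := by
    rw [Finset.sum_comm]
    refine le_trans (le_of_eq ?_) key
    refine Finset.sum_congr rfl fun i _ => Finset.sum_congr rfl fun j _ => ?_
    rw [show (l j - l i) ^ 2 = (l i - l j) ^ 2 by ring]
  have : ∀ i j, max ((l i - l j) ^ 2 - N) 0 = (if i < j then max ((l i - l j) ^ 2 - N) 0 else 0)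
      + (if j < i then max ((l i - l j) ^ 2 - N) 0 else 0) := by
    intro i j
    rcases lt_trichotomy i j with h | h | h
    · simp [h, h.not_gt]
    · subst h; simp [hl]
    · simp [h, h.not_gt]
  rw [Finset.sum_congr rfl fun i _ => Finset.sum_congr rfl fun j _ => this i j]
  simp only [Finset.sum_add_distrib]
  linarith

theorem gap_bound {n : ℕ} (l : Fin n → ℝ) (i j : Fin n) :
    (l i - l j) ^ 2 ≤ 2 * ∑ k, l k ^ 2 := by
  by_cases h : i = j
  · subst h
    have hl : 0 ≤ ∑ k, l k ^ 2 := Finset.sum_nonneg fun _ _ => sq_nonneg _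
    simp [hl]
  · have : l i ^ 2 + l j ^ 2 ≤ ∑ k, l k ^ 2 := by
      rw [← Finset.sum_pair (f := fun k => l k ^ 2) h]
      exact Finset.sum_le_sum_of_subset_of_nonneg (Finset.subset_univ _) fun _ _ _ => sq_nonneg _
    nlinarith [sq_nonneg (l i + l j)]

/-- homogeneous Bessel -/
theorem bessel {ι κ : Type*} [Fintype ι] [DecidableEq ι] [Fintype κ] (x : ι → κ → ℂ)
    (S : Finset ι) (b : ι → ℝ)
    (hb : ∀ s, ∑ k, ‖x s k‖ ^ 2 = b s)
    (h : ∀ s t, s ≠ t → ∑ k, x s k * star (x t k) = 0) (p : κ) :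
    ∑ s ∈ S, ‖x s p‖ ^ 2 / b s ≤ 1 := by
  have hb0 : ∀ s, 0 ≤ b s := fun s => by rw [← hb]; positivity
  have hb' : ∀ s, ∑ k, x s k * star (x s k) = (b s : ℂ) := fun s => by
    rw [← hb]; push_cast
    refine Finset.sum_congr rfl fun k _ => ?_
    exact Complex.mul_conj' _
  set V : κ → ℂ := fun k => ∑ s ∈ S, star (x s p) / b s * x s k with hV
  set w := ∑ s ∈ S, ‖x s p‖ ^ 2 / b s with hw
  have hVp : V p = (w : ℂ) := by
    simp only [hV, hw]; push_cast
    refine Finset.sum_congr rfl fun s _ => ?_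
    rw [div_mul_eq_mul_div]
    congr 1
    exact Complex.conj_mul' _
  have hVV : ∑ k, V k * star (V k) = (w : ℂ) := by
    calc _ = ∑ s ∈ S, ∑ t ∈ S, (star (x s p) / b s) * star (star (x t p) / b t) *
              ∑ k, x s k * star (x t k) := by
          simp only [hV, star_sum, Finset.sum_mul_sum]
          simp only [Finset.mul_sum]
          rw [Finset.sum_comm]
          refine Finset.sum_congr rfl fun e _ => ?_
          rw [Finset.sum_comm]
          refine Finset.sum_congr rfl fun f _ => ?_
          refine Finset.sum_congr rfl fun k _ => ?_
          rw [star_mul']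
          ring
      _ = ∑ s ∈ S, (star (x s p) / b s) * star (star (x s p) / b s) * b s := by
          refine Finset.sum_congr rfl fun s hs => ?_
          rw [Finset.sum_eq_single s, hb']
          · intro t _ hts
            rw [h s t hts.symm, mul_zero]
          · intro h; exact absurd hs h
      _ = _ := by
          rw [hw]; push_cast
          refine Finset.sum_congr rfl fun s hs => ?_
          rw [star_div₀, star_star]
          have : star (b s : ℂ) = b s := Complex.conj_ofReal _
          rw [this]
          have h2 : star (x s p) * x s p = (‖x s p‖ : ℂ) ^ 2 := Complex.conj_mul' _
          by_cases hz : (b s : ℂ) = 0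
          · simp [hz]
          · field_simp
            exact h2
  have hVV' : ∑ k, ‖V k‖ ^ 2 = w := by
    have : ((∑ k, ‖V k‖ ^ 2 : ℝ) : ℂ) = w := by
      rw [← hVV]; push_cast
      refine Finset.sum_congr rfl fun k _ => ?_
      exact (Complex.mul_conj' _).symm
    exact_mod_cast this
  have hle : ‖V p‖ ^ 2 ≤ w := by
    rw [← hVV']
    exact Finset.single_le_sum (f := fun k => ‖V k‖ ^ 2) (fun _ _ => by positivity)
      (Finset.mem_univ p)
  rw [hVp, Complex.norm_real, Real.norm_eq_abs, sq_abs] at hle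
  nlinarith

/-- weighted main estimate -/
theorem diag_bound {n : ℕ} {ι : Type*} [Fintype ι] [DecidableEq ι] (l : Fin n → ℝ)
    (C : ι → Fin n × Fin n → ℂ) (S : Finset ι) (b : ι → ℝ)
    (hb : ∀ s, ∑ k, ‖C s k‖ ^ 2 = b s)
    (h : ∀ s t, s ≠ t → ∑ k, C s k * star (C t k) = 0) (q : ℝ) (hq : 0 ≤ q) :
    ∑ s ∈ S, ∑ p, (l p.1 - l p.2) ^ 2 * ‖C s p‖ ^ 2 ≤
      (∑ k, l k ^ 2) * (∑ s ∈ S, b s + 2 * q + ∑ s ∈ S, max (b s - q) 0) := by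
  have hb0 : ∀ s, 0 ≤ b s := fun s => by rw [← hb]; positivity
  have hl : 0 ≤ ∑ k, l k ^ 2 := Finset.sum_nonneg fun _ _ => sq_nonneg _
  have hex := excess_bound l
  have hgap := gap_bound l
  set N := ∑ k, l k ^ 2 with hN
  set P : Fin n × Fin n → ℝ := fun p => max ((l p.1 - l p.2) ^ 2 - N) 0 with hP
  have hP0 : ∀ p, 0 ≤ P p := fun p => le_max_right _ _
  have hPN : ∀ p, P p ≤ N := fun p => max_le (by linarith [hgap p.1 p.2]) hl
  have hPs : ∑ p, P p ≤ 2 * N := by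
    rw [Fintype.sum_prod_type]; exact hex
  set t : ι → ℝ := fun s => ∑ p, P p * (‖C s p‖ ^ 2 / b s) with ht
  have ht0 : ∀ s, 0 ≤ t s := fun s =>
    Finset.sum_nonneg fun p _ => mul_nonneg (hP0 p) (div_nonneg (by positivity) (hb0 s))
  have htN : ∀ s, t s ≤ N := fun s => by
    calc t s ≤ ∑ p, N * (‖C s p‖ ^ 2 / b s) := Finset.sum_le_sum fun p _ =>
          mul_le_mul_of_nonneg_right (hPN p) (div_nonneg (by positivity) (hb0 s))
      _ = N * (b s / b s) := by rw [← Finset.mul_sum, ← Finset.sum_div, hb]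
      _ ≤ N * 1 := mul_le_mul_of_nonneg_left (div_self_le_one _) hl
      _ = N := mul_one _
  have hts : ∑ s ∈ S, t s ≤ 2 * N := by
    simp only [ht]
    rw [Finset.sum_comm]
    refine le_trans (Finset.sum_le_sum fun p _ => ?_) hPs
    rw [← Finset.mul_sum]
    exact mul_le_of_le_one_right (hP0 p) (bessel C S b hb h p)
  have htb : ∀ s, ∑ p, P p * ‖C s p‖ ^ 2 = t s * b s := fun s => by
    simp only [ht, Finset.sum_mul]
    refine Finset.sum_congr rfl fun p _ => ?_
    by_cases hz : b s = 0
    · have := hb s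
      rw [hz, Finset.sum_eq_zero_iff_of_nonneg (fun _ _ => by positivity)] at this
      rw [this p (Finset.mem_univ _), hz]; simp
    · field_simp
  have h1 : ∀ s, ∑ p, (l p.1 - l p.2) ^ 2 * ‖C s p‖ ^ 2 ≤ N * b s + t s * b s := fun s => by
    rw [← htb, ← hb s, Finset.mul_sum, ← Finset.sum_add_distrib]
    refine Finset.sum_le_sum fun p _ => ?_
    rw [← add_mul]
    refine mul_le_mul_of_nonneg_right ?_ (by positivity)
    have : (l p.1 - l p.2) ^ 2 - N ≤ P p := le_max_left _ _
    linarith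
  have h2 : ∀ s, t s * b s ≤ t s * q + N * max (b s - q) 0 := fun s => by
    have a1 : t s * (b s - q) ≤ t s * max (b s - q) 0 :=
      mul_le_mul_of_nonneg_left (le_max_left _ _) (ht0 s)
    have a2 : t s * max (b s - q) 0 ≤ N * max (b s - q) 0 :=
      mul_le_mul_of_nonneg_right (htN s) (le_max_right _ _)
    linarith
  calc _ ≤ ∑ s ∈ S, (N * b s + (t s * q + N * max (b s - q) 0)) :=
        Finset.sum_le_sum fun s _ => by linarith [h1 s, h2 s]
    _ = N * ∑ s ∈ S, b s + ((∑ s ∈ S, t s) * q + N * ∑ s ∈ S, max (b s - q) 0) := by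
        simp only [Finset.sum_add_distrib, Finset.mul_sum, Finset.sum_mul]
    _ ≤ _ := by nlinarith

/-- the squared Frobenius norm -/
noncomputable def nsq {n : ℕ} (A : Matrix (Fin n) (Fin n) ℂ) : ℝ := (trace (A * Aᴴ)).re

theorem trace_eq {n : ℕ} (A B : Matrix (Fin n) (Fin n) ℂ) :
    trace (A * Bᴴ) = ∑ p : Fin n × Fin n, A p.1 p.2 * star (B p.1 p.2) := by
  rw [Fintype.sum_prod_type]
  simp [trace, Matrix.mul_apply]

theorem nsq_eq {n : ℕ} (A : Matrix (Fin n) (Fin n) ℂ) :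
    nsq A = ∑ p : Fin n × Fin n, ‖A p.1 p.2‖ ^ 2 := by
  rw [nsq, trace_eq, Complex.re_sum]
  refine Finset.sum_congr rfl fun p _ => ?_
  rw [show A p.1 p.2 * star (A p.1 p.2) = _ from Complex.mul_conj' _]
  norm_cast

theorem herm_bound {n : ℕ} {ι : Type*} [Fintype ι] [DecidableEq ι]
    (A : Matrix (Fin n) (Fin n) ℂ) (hA : A.IsHermitian)
    (B : ι → Matrix (Fin n) (Fin n) ℂ) (S : Finset ι)
    (h : ∀ s t, s ≠ t → trace (B s * (B t)ᴴ) = 0) (q : ℝ) (hq : 0 ≤ q) :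
    ∑ s ∈ S, nsq (A * B s - B s * A) ≤
      nsq A * (∑ s ∈ S, nsq (B s) + 2 * q + ∑ s ∈ S, max (nsq (B s) - q) 0) := by
  set U : Matrix (Fin n) (Fin n) ℂ := (hA.eigenvectorUnitary : Matrix (Fin n) (Fin n) ℂ) with hU
  have hU1 : Uᴴ * U = 1 := by
    have := (Matrix.mem_unitaryGroup_iff').1 hA.eigenvectorUnitary.2
    exact this
  have hU2 : U * Uᴴ = 1 := by
    have := (Matrix.mem_unitaryGroup_iff).1 hA.eigenvectorUnitary.2
    exact this
  set D : Matrix (Fin n) (Fin n) ℂ := diagonal (fun i => (hA.eigenvalues i : ℂ)) with hD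
  have hspec : A = U * D * Uᴴ := by
    have := hA.spectral_theorem
    rw [Unitary.conjStarAlgAut_apply] at this
    exact this
  set φ : Matrix (Fin n) (Fin n) ℂ → Matrix (Fin n) (Fin n) ℂ := fun X => Uᴴ * X * U with hφ
  have hφmul : ∀ X Y, φ (X * Y) = φ X * φ Y := fun X Y => by
    calc Uᴴ * (X * Y) * U = Uᴴ * X * 1 * Y * U := by simp only [mul_one, mul_assoc]
      _ = _ := by rw [← hU2]; simp only [hφ, mul_assoc]
  have hφsub : ∀ X Y, φ (X - Y) = φ X - φ Y := fun X Y => by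
    simp only [hφ, mul_sub, sub_mul]
  have hφH : ∀ X, φ Xᴴ = (φ X)ᴴ := fun X => by
    simp only [hφ, conjTranspose_mul, conjTranspose_conjTranspose, mul_assoc]
  have hφtr : ∀ X, trace (φ X) = trace X := fun X => by
    simp only [hφ]
    rw [trace_mul_comm, ← mul_assoc, hU2, one_mul]
  have hφn : ∀ X, nsq (φ X) = nsq X := fun X => by
    rw [nsq, nsq, ← hφH, ← hφmul, hφtr]
  have hφA : φ A = D := by
    simp only [hφ]
    rw [hspec]
    calc Uᴴ * (U * D * Uᴴ) * U = (Uᴴ * U) * D * (Uᴴ * U) := by simp only [mul_assoc]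
      _ = D := by rw [hU1, one_mul, mul_one]
  have hDn : nsq A = ∑ k, hA.eigenvalues k ^ 2 := by
    rw [← hφn, hφA, nsq, hD, diagonal_conjTranspose, diagonal_mul_diagonal, trace_diagonal,
      Complex.re_sum]
    refine Finset.sum_congr rfl fun k _ => ?_
    simp [sq]
  have hcomm : ∀ s, nsq (A * B s - B s * A) = ∑ p : Fin n × Fin n,
      (hA.eigenvalues p.1 - hA.eigenvalues p.2) ^ 2 * ‖φ (B s) p.1 p.2‖ ^ 2 := fun s => by
    rw [← hφn, hφsub, hφmul, hφmul, hφA, nsq_eq]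
    refine Finset.sum_congr rfl fun p _ => ?_
    rw [Matrix.sub_apply, hD, diagonal_mul, mul_diagonal, mul_comm (φ (B s) p.1 p.2), ← sub_mul, norm_mul,
      mul_pow, ← Complex.ofReal_sub, Complex.norm_real, Real.norm_eq_abs, sq_abs]
  simp_rw [hcomm]
  rw [hDn]
  refine diag_bound hA.eigenvalues (fun s p => φ (B s) p.1 p.2) S (fun s => nsq (B s)) ?_ ?_ q hq
  · intro s
    rw [← hφn, nsq_eq]
  · intro s t hst
    rw [← trace_eq, ← hφH, ← hφmul, hφtr, h s t hst]

/-- combinatorial end -/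
theorem final_real {m : ℕ} (hm : 3 ≤ m) (b : Fin m → ℝ) (hb : ∀ r, 0 ≤ b r) :
    ∃ q, 0 ≤ q ∧ ∑ r, b r * (∑ s ∈ Finset.univ.erase r, b s + 2 * q
      + ∑ s ∈ Finset.univ.erase r, max (b s - q) 0) ≤ 4 / 3 * (∑ r, b r) ^ 2 := by
  obtain ⟨i, -, hi⟩ := Finset.exists_max_image (Finset.univ : Finset (Fin m)) b
    ⟨⟨0, by omega⟩, Finset.mem_univ _⟩
  obtain ⟨j, hj', hj⟩ := Finset.exists_max_image ((Finset.univ : Finset (Fin m)).erase i) b (by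
    rw [← Finset.card_pos, Finset.card_erase_of_mem (Finset.mem_univ _), Finset.card_fin]; omega)
  obtain ⟨k, hk', hk⟩ := Finset.exists_max_image (((Finset.univ : Finset (Fin m)).erase i).erase j) b (by
    rw [← Finset.card_pos, Finset.card_erase_of_mem hj',
      Finset.card_erase_of_mem (Finset.mem_univ _), Finset.card_fin]; omega)
  refine ⟨b k, hb k, ?_⟩
  have hik : b k ≤ b i := hi k (Finset.mem_univ _)
  have hjk : b k ≤ b j := hj k (Finset.mem_of_mem_erase hk')
  set R := (((Finset.univ : Finset (Fin m)).erase i).erase j).erase k with hR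
  have hsum : ∀ f : Fin m → ℝ, ∑ r, f r = f i + (f j + (f k + ∑ r ∈ R, f r)) := fun f => by
    rw [Finset.add_sum_erase _ _ hk', Finset.add_sum_erase _ _ hj',
      Finset.add_sum_erase _ _ (Finset.mem_univ _)]
  have her : ∀ (f : Fin m → ℝ) r, ∑ s ∈ Finset.univ.erase r, f s = ∑ s, f s - f r := fun f r => by
    rw [← Finset.add_sum_erase _ _ (Finset.mem_univ r)]; ring
  have hmR : ∀ r ∈ R, max (b r - b k) 0 = 0 := fun r hr => by
    have := hk r (Finset.mem_of_mem_erase hr)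
    exact max_eq_right (by linarith)
  set T := ∑ r ∈ R, b r with hT
  have hT0 : 0 ≤ T := Finset.sum_nonneg fun r _ => hb r
  simp only [her]
  have hX : ∑ s, max (b s - b k) 0 = (b i - b k) + (b j - b k) := by
    rw [hsum, Finset.sum_eq_zero hmR, max_eq_left (by linarith), max_eq_left (by linarith)]
    simp
  have hS : ∑ s, b s = b i + (b j + (b k + T)) := hsum b
  rw [hX, hS]
  rw [hsum]
  have hR2 : ∑ r ∈ R, b r * (b i + (b j + (b k + T)) - b r + 2 * b k +
      (b i - b k + (b j - b k) - max (b r - b k) 0)) ≤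
      T * (b i + (b j + (b k + T)) + 2 * b k + (b i - b k + (b j - b k))) := by
    rw [hT, Finset.sum_mul]
    refine Finset.sum_le_sum fun r hr => ?_
    rw [hmR r hr]
    refine mul_le_mul_of_nonneg_left ?_ (hb r)
    linarith [hb r]
  rw [max_eq_left (show 0 ≤ b i - b k by linarith), max_eq_left (show 0 ≤ b j - b k by linarith),
    sub_self, max_self]
  have hfin : b i * (b i + (b j + (b k + T)) - b i + 2 * b k + (b i - b k + (b j - b k) - (b i - b k))) +
    (b j * (b i + (b j + (b k + T)) - b j + 2 * b k + (b i - b k + (b j - b k) - (b j - b k))) +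
    (b k * (b i + (b j + (b k + T)) - b k + 2 * b k + (b i - b k + (b j - b k) - 0)) +
      T * (b i + (b j + (b k + T)) + 2 * b k + (b i - b k + (b j - b k))))) ≤
      4 / 3 * (b i + (b j + (b k + T))) ^ 2 := by
    nlinarith [sq_nonneg (b i - b j), sq_nonneg (b i + b j - 2 * b k - T),
      sq_nonneg (b i + b j - 2 * b k), sq_nonneg T, sq_nonneg (b i + b j - 2 * b k - 2 * T),
      sq_nonneg (2 * (b i + b j - 2 * b k) - T)]
  linarith

theorem ortho_case {m n : ℕ} (hm : 3 ≤ m)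
    (B : Fin m → Matrix (Fin n) (Fin n) ℂ) (hherm : ∀ r, (B r)ᴴ = B r)
    (h : ∀ s t, s ≠ t → trace (B s * (B t)ᴴ) = 0) :
    ∑ r, ∑ s, nsq (B r * B s - B s * B r) ≤ (4 / 3) * (∑ r, nsq (B r)) ^ 2 := by
  obtain ⟨q, hq, hh⟩ := final_real hm (fun r => nsq (B r))
    (fun r => by rw [nsq_eq]; positivity)
  refine le_trans (Finset.sum_le_sum fun r _ => ?_) hh
  have := herm_bound (B r) (hherm r) B (Finset.univ.erase r) h q hq
  rw [← Finset.add_sum_erase _ _ (Finset.mem_univ r)]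
  simpa [nsq] using this

/-- rotation invariance -/
theorem rot_inv {m n : ℕ} (O : Matrix (Fin m) (Fin m) ℝ) (hO : Oᵀ * O = 1)
    (X : Fin m → Matrix (Fin n) (Fin n) ℂ) :
    ∑ r, nsq (∑ s, (O r s : ℂ) • X s) = ∑ r, nsq (X r) := by
  have hO' : ∀ s t, ∑ r, (O r s : ℂ) * (O r t : ℂ) = if s = t then 1 else 0 := fun s t => by
    have := congrFun (congrFun hO s) t
    rw [Matrix.mul_apply, Matrix.one_apply] at this
    simp only [transpose_apply] at this
    split_ifs at this ⊢ <;> exact_mod_cast this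
  have : ∑ r, trace ((∑ s, (O r s : ℂ) • X s) * (∑ s, (O r s : ℂ) • X s)ᴴ)
      = ∑ r, trace (X r * (X r)ᴴ) := by
    calc _ = ∑ r, ∑ s, ∑ t, ((O r s : ℂ) * O r t) * trace (X s * (X t)ᴴ) := by
          refine Finset.sum_congr rfl fun r _ => ?_
          simp only [conjTranspose_sum, conjTranspose_smul, Finset.sum_mul_sum, trace_sum]
          refine Finset.sum_congr rfl fun s _ => Finset.sum_congr rfl fun t _ => ?_
          simp [mul_assoc]
          try ring
      _ = ∑ s, ∑ t, (∑ r, (O r s : ℂ) * O r t) * trace (X s * (X t)ᴴ) := by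
          rw [Finset.sum_comm]
          refine Finset.sum_congr rfl fun s _ => ?_
          rw [Finset.sum_comm]
          simp only [Finset.sum_mul]
      _ = _ := by
          simp only [hO']
          simp
  have := congrArg Complex.re this
  rw [Complex.re_sum, Complex.re_sum] at this
  exact this

theorem ddvv_hermitian (m n : ℕ) (hm : 3 ≤ m) (hn : 2 ≤ n)
    (B : Fin m → Matrix (Fin n) (Fin n) ℂ) (hherm : ∀ r, (B r)ᴴ = B r) :
    ∑ r, ∑ s, (trace ((B r * B s - B s * B r) * (B r * B s - B s * B r)ᴴ)).re ≤
      (4 / 3) * (∑ r, (trace (B r * (B r)ᴴ)).re) ^ 2 := by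
  change ∑ r, ∑ s, nsq (B r * B s - B s * B r) ≤ (4 / 3) * (∑ r, nsq (B r)) ^ 2
  set G : Matrix (Fin m) (Fin m) ℝ := Matrix.of fun r s => (trace (B r * (B s)ᴴ)).re with hG
  have htr : ∀ r s, trace (B r * (B s)ᴴ) = (G r s : ℂ) := fun r s => by
    apply Complex.ext
    · simp [hG]
    · have h1 : star (trace (B r * (B s)ᴴ)) = trace (B r * (B s)ᴴ) := by
        rw [← trace_conjTranspose, conjTranspose_mul, conjTranspose_conjTranspose, hherm, hherm,
          trace_mul_comm]
      have := congrArg Complex.im h1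
      simp at this ⊢
      linarith
  have hGs : G.IsHermitian := by
    ext r s
    simp only [hG, conjTranspose_apply, of_apply, star_trivial, hherm]
    rw [trace_mul_comm]
  set V : Matrix (Fin m) (Fin m) ℝ := (hGs.eigenvectorUnitary : Matrix (Fin m) (Fin m) ℝ) with hV
  have hV1 : V * Vᵀ = 1 := (Matrix.mem_unitaryGroup_iff).1 hGs.eigenvectorUnitary.2
  have hV2 : Vᵀ * V = 1 := (Matrix.mem_unitaryGroup_iff').1 hGs.eigenvectorUnitary.2
  have hspec : G = V * diagonal hGs.eigenvalues * Vᵀ := by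
    have := hGs.spectral_theorem
    rw [Unitary.conjStarAlgAut_apply] at this
    exact this
  have hdiag : Vᵀ * G * V = diagonal hGs.eigenvalues := by
    have : Vᵀ * (V * diagonal hGs.eigenvalues * Vᵀ) * V = diagonal hGs.eigenvalues := by
      calc _ = (Vᵀ * V) * diagonal hGs.eigenvalues * (Vᵀ * V) := by simp only [mul_assoc]
        _ = _ := by rw [hV2, one_mul, mul_one]
    rw [← hspec] at this
    exact this
  set O := Vᵀ with hOdef
  have hO : Oᵀ * O = 1 := by rw [hOdef, transpose_transpose]; exact hV1
  set C : Fin m → Matrix (Fin n) (Fin n) ℂ := fun r => ∑ s, (O r s : ℂ) • B s with hC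
  have hCh : ∀ r, (C r)ᴴ = C r := fun r => by
    simp [hC, conjTranspose_sum, conjTranspose_smul, hherm]
  have hCo : ∀ s t, s ≠ t → trace (C s * (C t)ᴴ) = 0 := fun s t hst => by
    have h1 : trace (C s * (C t)ᴴ) = ((Vᵀ * G * V) s t : ℝ) := by
      simp only [hC, conjTranspose_sum, conjTranspose_smul, Finset.sum_mul_sum, trace_sum]
      simp only [Matrix.mul_apply, Finset.sum_mul]
      push_cast
      rw [Finset.sum_comm]
      refine Finset.sum_congr rfl fun a _ => Finset.sum_congr rfl fun c _ => ?_
      simp [htr, hOdef]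
      try ring
    rw [h1, hdiag, diagonal_apply_ne _ hst]
    simp
  have key := ortho_case hm C hCh hCo
  have e1 : ∑ r, nsq (C r) = ∑ r, nsq (B r) := rot_inv O hO B
  have e2 : ∑ r, ∑ s, nsq (C r * C s - C s * C r) = ∑ r, ∑ s, nsq (B r * B s - B s * B r) := by
    calc _ = ∑ r, ∑ s, nsq (∑ t, (O s t : ℂ) • (C r * B t - B t * C r)) := by
          refine Finset.sum_congr rfl fun r _ => Finset.sum_congr rfl fun s _ => ?_
          congr 1
          conv_lhs => rw [show C s = ∑ t, (O s t : ℂ) • B t from rfl]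
          simp only [Finset.mul_sum, Finset.sum_mul, mul_smul_comm, smul_mul_assoc, smul_sub,
            Finset.sum_sub_distrib]
      _ = ∑ r, ∑ t, nsq (C r * B t - B t * C r) :=
          Finset.sum_congr rfl fun r _ => rot_inv O hO _
      _ = ∑ t, ∑ r, nsq (∑ u, (O r u : ℂ) • (B u * B t - B t * B u)) := by
          rw [Finset.sum_comm]
          refine Finset.sum_congr rfl fun r _ => Finset.sum_congr rfl fun s _ => ?_
          congr 1
          simp only [hC, Finset.mul_sum, Finset.sum_mul, mul_smul_comm, smul_mul_assoc, smul_sub,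
            Finset.sum_sub_distrib]
      _ = ∑ t, ∑ u, nsq (B u * B t - B t * B u) :=
          Finset.sum_congr rfl fun r _ => rot_inv O hO _
      _ = _ := Finset.sum_comm
  rw [e1, e2] at key
  exact key
end

section
/- For any m complex n×n matrices B₁,…,B_m with m ≥ 3 and n ≥ 2, one has ∑_{r,s=1}^m ‖[B_r,B_s]‖² ≤ (4/3)(∑_{r=1}^m ‖B_r‖²)². -/
open Matrix

namespace DDVV

/-- Edges of weight larger than one form a star. -/
lemma exists_center_s7 {n : Type*} [Fintype n] [DecidableEq n] [Nonempty n] (l : n → ℝ)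
    (hl : ∑ i, l i ^ 2 = 1) :
    ∃ c, ∀ i j, i ≠ c → j ≠ c → (l i - l j) ^ 2 ≤ 1 := by
  obtain ⟨p, hp⟩ := Finite.exists_max l
  obtain ⟨q, hq⟩ := Finite.exists_min l
  have two : ∀ i j, i ≠ j → l i ^ 2 + l j ^ 2 ≤ 1 := by
    intro i j hij
    rw [← hl, ← Finset.sum_pair (f := fun i => l i ^ 2) hij]
    exact Finset.sum_le_sum_of_subset_of_nonneg (Finset.subset_univ _) (fun _ _ _ => sq_nonneg _)
  have sq_le : ∀ x : ℝ, -1 ≤ x → x ≤ 1 → x ^ 2 ≤ 1 := by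
    intro x h1 h2
    nlinarith
  by_cases h : ∀ i, i ≠ p → l i - l q ≤ 1
  · refine ⟨p, fun i j hi hj => sq_le _ ?_ ?_⟩
    · have := h j hj
      have := hq i
      linarith
    · have := h i hi
      have := hq j
      linarith
  · push Not at h
    obtain ⟨i, hip, hi⟩ := h
    have hB : ∀ j, j ≠ q → l p - l j ≤ 1 := by
      intro j hj
      by_contra hcon
      push Not at hcon
      have hiq : i ≠ q := by
        rintro rfl
        linarith
      have hpj : p ≠ j := by
        rintro rfl
        linarith
      have hpq : p ≠ q := by
        rintro rfl
        have := hp i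
        linarith
      by_cases hij : i = j
      · subst hij
        have := two p q hpq
        nlinarith [sq_nonneg (l p + l q)]
      · have h4 : l i ^ 2 + l q ^ 2 + (l p ^ 2 + l j ^ 2) ≤ 1 := by
          have hd : Disjoint ({i, q} : Finset n) {p, j} := by
            simp only [Finset.disjoint_left, Finset.mem_insert, Finset.mem_singleton]
            rintro a (rfl | rfl)
            · simp [hip, hij]
            · simp [hpq.symm, hj.symm]
          rw [← hl, ← Finset.sum_pair (f := fun i => l i ^ 2) hiq,
            ← Finset.sum_pair (f := fun i => l i ^ 2) hpj, ← Finset.sum_union hd]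
          exact Finset.sum_le_sum_of_subset_of_nonneg (Finset.subset_univ _)
            (fun _ _ _ => sq_nonneg _)
        nlinarith [sq_nonneg (l i + l q), sq_nonneg (l p + l j)]
    refine ⟨q, fun i j hi hj => sq_le _ ?_ ?_⟩
    · have := hB i hi
      have := hp j
      linarith
    · have := hB j hj
      have := hp i
      linarith

lemma star_ineq {n : Type*} [Fintype n] [DecidableEq n] (l : n → ℝ)
    (hl : ∑ i, l i ^ 2 = 1) (c : n) (J : Finset n) (hJ : c ∉ J) :
    ∑ j ∈ J, ((l c - l j) ^ 2 - 1) ≤ 1 := by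
  have h1 : l c ^ 2 + ∑ j ∈ J, l j ^ 2 ≤ 1 := by
    rw [← hl, ← Finset.sum_insert (f := fun i => l i ^ 2) hJ]
    exact Finset.sum_le_sum_of_subset_of_nonneg (Finset.subset_univ _) (fun _ _ _ => sq_nonneg _)
  have h2 : (∑ j ∈ J, l j) ^ 2 ≤ J.card * ∑ j ∈ J, l j ^ 2 := sq_sum_le_card_mul_sum_sq
  have h3 : ∑ j ∈ J, ((l c - l j) ^ 2 - 1)
      = J.card * l c ^ 2 - 2 * l c * ∑ j ∈ J, l j + ∑ j ∈ J, l j ^ 2 - J.card := by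
    have : ∀ j, (l c - l j) ^ 2 - 1 = l c ^ 2 - 2 * l c * l j + l j ^ 2 - 1 := fun j => by ring
    simp only [this, Finset.sum_sub_distrib, Finset.sum_add_distrib, ← Finset.mul_sum]
    simp
  rw [h3]
  have h4 : (0 : ℝ) ≤ J.card := by positivity
  nlinarith [sq_nonneg (l c + ∑ j ∈ J, l j), mul_le_mul_of_nonneg_left h1 h4]

lemma pos_part_sum {n : Type*} [Fintype n] [DecidableEq n] (l : n → ℝ)
    (hl : ∑ i, l i ^ 2 = 1) :
    ∑ i, ∑ j, max ((l i - l j) ^ 2 - 1) 0 ≤ 2 := by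
  have hne : Nonempty n := by
    by_contra h
    rw [not_nonempty_iff] at h
    simp at hl
  obtain ⟨c, hc⟩ := exists_center_s7 l hl
  set f : n → n → ℝ := fun i j => max ((l i - l j) ^ 2 - 1) 0 with hf
  have hf0 : ∀ i j, i ≠ c → j ≠ c → f i j = 0 := by
    intro i j hi hj
    have := hc i j hi hj
    simp only [hf]
    exact max_eq_right (by linarith)
  have hsymm : ∀ i j, f i j = f j i := by
    intro i j
    simp only [hf]
    congr 2
    ring
  have hcc : f c c = 0 := by simp [hf]
  have hrow : ∑ j, f c j ≤ 1 := by
    have := star_ineq l hl c (Finset.univ.filter fun j => 0 < (l c - l j) ^ 2 - 1) (by simp)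
    rw [Finset.sum_filter] at this
    refine le_trans (le_of_eq (Finset.sum_congr rfl fun j _ => ?_)) this
    simp only [hf]
    split_ifs with h
    · exact max_eq_left h.le
    · exact max_eq_right (not_lt.mp h)
  have hother : ∀ i, i ≠ c → ∑ j, f i j = f c i := by
    intro i hi
    rw [Finset.sum_eq_single c (fun j _ hj => hf0 i j hi hj) (by simp), hsymm]
  have : ∑ i, ∑ j, f i j = ∑ j, f c j + ∑ i, f c i := by
    rw [← Finset.add_sum_erase _ _ (Finset.mem_univ c)]
    congr 1
    rw [← Finset.add_sum_erase _ (fun i => f c i) (Finset.mem_univ c), hcc, zero_add]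
    exact Finset.sum_congr rfl fun i hi => hother i (Finset.ne_of_mem_erase hi)
  change ∑ i, ∑ j, f i j ≤ 2
  rw [this]
  linarith

lemma weights {n : Type*} [Fintype n] [DecidableEq n] (l : n → ℝ)
    (hl : ∑ i, l i ^ 2 = 1) (w : n → n → ℝ) (h0 : ∀ i j, 0 ≤ w i j) (h1 : ∀ i j, w i j ≤ 1) :
    ∑ i, ∑ j, (l i - l j) ^ 2 * w i j ≤ (∑ i, ∑ j, w i j) + 2 := by
  have := pos_part_sum l hl
  have h2 : ∑ i, ∑ j, (l i - l j) ^ 2 * w i j - ∑ i, ∑ j, w i j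
      ≤ ∑ i, ∑ j, max ((l i - l j) ^ 2 - 1) 0 := by
    simp only [← Finset.sum_sub_distrib]
    refine Finset.sum_le_sum fun i _ => Finset.sum_le_sum fun j _ => ?_
    have a := le_max_left ((l i - l j) ^ 2 - 1) 0
    have b := le_max_right ((l i - l j) ^ 2 - 1) 0
    nlinarith [h0 i j, h1 i j, mul_nonneg b (sub_nonneg.mpr (h1 i j)),
      mul_nonneg (h0 i j) (sub_nonneg.mpr a)]
  linarith

lemma weights_two {n : Type*} [Fintype n] [DecidableEq n] (l : n → ℝ)
    (hl : ∑ i, l i ^ 2 = 1) (w : n → n → ℝ) (h0 : ∀ i j, 0 ≤ w i j) :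
    ∑ i, ∑ j, (l i - l j) ^ 2 * w i j ≤ 2 * ∑ i, ∑ j, w i j := by
  simp only [Finset.mul_sum]
  refine Finset.sum_le_sum fun i _ => Finset.sum_le_sum fun j _ => ?_
  refine mul_le_mul_of_nonneg_right ?_ (h0 i j)
  by_cases hij : i = j
  · subst hij
    simp
  · have : l i ^ 2 + l j ^ 2 ≤ 1 := by
      rw [← hl, ← Finset.sum_pair (f := fun i => l i ^ 2) hij]
      exact Finset.sum_le_sum_of_subset_of_nonneg (Finset.subset_univ _)
        (fun _ _ _ => sq_nonneg _)
    nlinarith [sq_nonneg (l i + l j)]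

lemma layer {ι : Type*} [DecidableEq ι] (c : ι → ι → ℝ) (hc : ∀ i j, c i j = c j i)
    (S : Finset ι) :
    (∀ T ⊆ S, ∀ r ∈ T, ∑ s ∈ T, c r s ≤ 4 / 3 * T.card) →
    ∀ x : ι → ℝ, (∀ i ∈ S, 0 ≤ x i) →
      ∑ r ∈ S, ∑ s ∈ S, c r s * (x r * x s) ≤ 4 / 3 * (∑ r ∈ S, x r) ^ 2 := by
  induction S using Finset.strongInduction with
  | H S ih =>
    intro hT x hx
    rcases S.eq_empty_or_nonempty with rfl | hne
    · simp
    obtain ⟨i0, hi0, hmin⟩ := S.exists_min_image x hne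
    set t := x i0 with ht
    have ht0 : 0 ≤ t := hx i0 hi0
    set y : ι → ℝ := fun i => x i - t with hy
    have hy0 : y i0 = 0 := by simp [hy, ht]
    have hyn : ∀ i ∈ S, 0 ≤ y i := fun i hi => sub_nonneg.mpr (hmin i hi)
    have ih' := ih (S.erase i0) (Finset.erase_ssubset hi0)
      (fun T hTS => hT T (hTS.trans (Finset.erase_subset _ _))) y
      (fun i hi => hyn i (Finset.mem_of_mem_erase hi))
    have e1 : ∑ r ∈ S.erase i0, y r = ∑ r ∈ S, y r := Finset.sum_erase _ hy0
    have e2 : ∑ r ∈ S.erase i0, ∑ s ∈ S.erase i0, c r s * (y r * y s)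
        = ∑ r ∈ S, ∑ s ∈ S, c r s * (y r * y s) := by
      rw [Finset.sum_erase _ (by simp [hy0])]
      exact Finset.sum_congr rfl fun r _ => Finset.sum_erase _ (by simp [hy0])
    rw [e1, e2] at ih'
    have hS := hT S subset_rfl
    have hxs : ∑ r ∈ S, x r = t * S.card + ∑ r ∈ S, y r := by
      simp only [hy, Finset.sum_sub_distrib]
      simp
      ring
    have b1 : ∑ r ∈ S, ∑ s ∈ S, c r s ≤ 4 / 3 * S.card * S.card := by
      refine (Finset.sum_le_sum hS).trans ?_
      simp
      linarith
    have b2 : ∑ r ∈ S, y r * ∑ s ∈ S, c r s ≤ (∑ r ∈ S, y r) * (4 / 3 * S.card) := by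
      rw [Finset.sum_mul]
      exact Finset.sum_le_sum fun r hr => mul_le_mul_of_nonneg_left (hS r hr) (hyn r hr)
    have ex : ∑ r ∈ S, ∑ s ∈ S, c r s * (x r * x s)
        = t ^ 2 * ∑ r ∈ S, ∑ s ∈ S, c r s + 2 * t * (∑ r ∈ S, y r * ∑ s ∈ S, c r s)
          + ∑ r ∈ S, ∑ s ∈ S, c r s * (y r * y s) := by
      have sw : ∑ r ∈ S, y r * ∑ s ∈ S, c r s = ∑ r ∈ S, ∑ s ∈ S, c r s * y s := by
        rw [Finset.sum_comm]
        refine Finset.sum_congr rfl fun r _ => ?_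
        rw [Finset.mul_sum]
        exact Finset.sum_congr rfl fun s _ => by rw [hc, mul_comm]
      have : 2 * t * (∑ r ∈ S, y r * ∑ s ∈ S, c r s) = t * (∑ r ∈ S, y r * ∑ s ∈ S, c r s)
          + t * ∑ r ∈ S, ∑ s ∈ S, c r s * y s := by
        rw [← sw]
        ring
      rw [this]
      simp only [Finset.mul_sum, ← Finset.sum_add_distrib]
      refine Finset.sum_congr rfl fun r _ => Finset.sum_congr rfl fun s _ => ?_
      simp only [hy]
      ring
    rw [ex, hxs]
    nlinarith [mul_le_mul_of_nonneg_left b1 (sq_nonneg t), mul_le_mul_of_nonneg_left b2 ht0]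

/-- squared Frobenius norm -/
noncomputable def N {n : Type*} [Fintype n] (X : Matrix n n ℂ) : ℝ := (trace (X * Xᴴ)).re

section
variable {n : Type*} [Fintype n]

lemma N_eq (X : Matrix n n ℂ) : N X = ∑ i, ∑ j, Complex.normSq (X i j) := by
  simp [N, trace, Matrix.mul_apply, Complex.normSq_apply]

lemma N_nonneg (X : Matrix n n ℂ) : 0 ≤ N X := by
  rw [N_eq]
  exact Finset.sum_nonneg fun _ _ => Finset.sum_nonneg fun _ _ => Complex.normSq_nonneg _

lemma N_eq_zero {X : Matrix n n ℂ} (h : N X = 0) : X = 0 := by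
  rw [N_eq] at h
  have h1 := (Finset.sum_eq_zero_iff_of_nonneg (f := fun i => ∑ j, Complex.normSq (X i j))
    (fun _ _ => Finset.sum_nonneg fun _ _ => Complex.normSq_nonneg _)).mp h
  ext i j
  have h2 := (Finset.sum_eq_zero_iff_of_nonneg (f := fun j => Complex.normSq (X i j))
    (fun _ _ => Complex.normSq_nonneg _)).mp (h1 i (Finset.mem_univ _)) j (Finset.mem_univ _)
  simpa using h2

lemma N_neg (X : Matrix n n ℂ) : N (-X) = N X := by simp [N]

lemma N_conj (X : Matrix n n ℂ) : N Xᴴ = N X := by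
  simp only [N, conjTranspose_conjTranspose]
  rw [trace_mul_comm]

lemma N_smul (a : ℝ) (X : Matrix n n ℂ) : N (a • X) = a ^ 2 * N X := by
  simp only [N_eq, Finset.mul_sum, Matrix.smul_apply]
  refine Finset.sum_congr rfl fun i _ => Finset.sum_congr rfl fun j _ => ?_
  simp [Complex.normSq_apply]
  ring

lemma N_par (X Y : Matrix n n ℂ) :
    N (X + Complex.I • Y) + N (X - Complex.I • Y) = 2 * N X + 2 * N Y := by
  simp only [N_eq, Finset.mul_sum, ← Finset.sum_add_distrib]
  refine Finset.sum_congr rfl fun i _ => Finset.sum_congr rfl fun j _ => ?_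
  simp [Complex.normSq_apply]
  ring

/-- commutator -/
def C (X Y : Matrix n n ℂ) : Matrix n n ℂ := X * Y - Y * X

lemma C_swap (X Y : Matrix n n ℂ) : C X Y = - C Y X := by simp [C]

/-- Bessel for a matrix entry -/
lemma bessel_s7 [DecidableEq n] {ι : Type*} [DecidableEq ι] (S : Finset ι) (X : ι → Matrix n n ℂ)
    (hX : ∀ r ∈ S, ∀ s ∈ S, trace (X r * (X s)ᴴ) = if r = s then 1 else 0) (p q : n) :
    ∑ s ∈ S, Complex.normSq (X s p q) ≤ 1 := by
  set t := ∑ s ∈ S, Complex.normSq (X s p q) with ht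
  have ht0 : 0 ≤ t := Finset.sum_nonneg fun _ _ => Complex.normSq_nonneg _
  set Y : Matrix n n ℂ := ∑ s ∈ S, star (X s p q) • X s with hY
  have hYpq : Y p q = (t : ℂ) := by
    simp only [hY, Matrix.sum_apply, Matrix.smul_apply, smul_eq_mul, ht, Complex.ofReal_sum]
    refine Finset.sum_congr rfl fun s _ => ?_
    rw [Complex.normSq_eq_conj_mul_self]
    rfl
  have hNY : N Y = t := by
    have : trace (Y * Yᴴ) = (t : ℂ) := by
      simp only [hY, conjTranspose_sum, Finset.sum_mul, Finset.mul_sum, trace_sum,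
        conjTranspose_smul, Matrix.smul_mul, Matrix.mul_smul, trace_smul, ht, Complex.ofReal_sum]
      refine Finset.sum_congr rfl fun s hs => ?_
      rw [Finset.sum_eq_single s]
      · rw [hX s hs s hs, Complex.normSq_eq_conj_mul_self]
        simp [mul_comm]
      · intro r hr hrs
        rw [hX r hr s hs]
        simp [hrs]
      · exact fun h => absurd hs h
    simp [N, this]
  have : Complex.normSq (Y p q) ≤ N Y := by
    rw [N_eq]
    refine le_trans ?_ (Finset.single_le_sum (f := fun i => ∑ j, Complex.normSq (Y i j))
      (fun _ _ => Finset.sum_nonneg fun _ _ => Complex.normSq_nonneg _) (Finset.mem_univ p))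
    exact Finset.single_le_sum (f := fun j => Complex.normSq (Y p j))
      (fun _ _ => Complex.normSq_nonneg _) (Finset.mem_univ q)
  rw [hYpq, hNY, Complex.normSq_ofReal] at this
  nlinarith

lemma N_comm_diag [DecidableEq n] (l : n → ℝ) (X : Matrix n n ℂ) :
    N (C (diagonal (fun i => (l i : ℂ))) X)
      = ∑ i, ∑ j, (l i - l j) ^ 2 * Complex.normSq (X i j) := by
  rw [N_eq]
  refine Finset.sum_congr rfl fun i _ => Finset.sum_congr rfl fun j _ => ?_
  simp [C, Complex.normSq_apply]
  ring

/-- diagonal version of the spectral estimate -/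
lemma diag_est [DecidableEq n] {ι : Type*} [DecidableEq ι] (l : n → ℝ) (hl : ∑ i, l i ^ 2 = 1)
    (S : Finset ι) (X : ι → Matrix n n ℂ)
    (hX : ∀ r ∈ S, ∀ s ∈ S, trace (X r * (X s)ᴴ) = if r = s then 1 else 0) :
    ∑ s ∈ S, N (C (diagonal (fun i => (l i : ℂ))) (X s)) ≤ S.card + 2 ∧
    ∑ s ∈ S, N (C (diagonal (fun i => (l i : ℂ))) (X s)) ≤ 2 * S.card := by
  set w : n → n → ℝ := fun i j => ∑ s ∈ S, Complex.normSq (X s i j) with hw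
  have h0 : ∀ i j, 0 ≤ w i j := fun i j => Finset.sum_nonneg fun _ _ => Complex.normSq_nonneg _
  have h1 : ∀ i j, w i j ≤ 1 := fun i j => bessel_s7 S X hX i j
  have hsum : ∑ i, ∑ j, w i j = S.card := by
    have : ∑ s ∈ S, N (X s) = S.card := by
      rw [Finset.card_eq_sum_ones]
      push_cast
      refine Finset.sum_congr rfl fun s hs => ?_
      simp [N, hX s hs s hs]
    rw [← this]
    simp only [N_eq, hw]
    symm
    rw [Finset.sum_comm]
    exact Finset.sum_congr rfl fun i _ => Finset.sum_comm
  have hL : ∑ s ∈ S, N (C (diagonal (fun i => (l i : ℂ))) (X s))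
      = ∑ i, ∑ j, (l i - l j) ^ 2 * w i j := by
    simp only [N_comm_diag, hw, Finset.mul_sum]
    rw [Finset.sum_comm]
    exact Finset.sum_congr rfl fun i _ => Finset.sum_comm
  rw [hL, ← hsum]
  exact ⟨weights l hl w h0 h1, weights_two l hl w h0⟩

lemma herm_est [DecidableEq n] {ι : Type*} [DecidableEq ι] (A : Matrix n n ℂ)
    (hA : A.IsHermitian) (hA1 : N A = 1)
    (S : Finset ι) (X : ι → Matrix n n ℂ)
    (hX : ∀ r ∈ S, ∀ s ∈ S, trace (X r * (X s)ᴴ) = if r = s then 1 else 0) :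
    ∑ s ∈ S, N (C A (X s)) ≤ S.card + 2 ∧
    ∑ s ∈ S, N (C A (X s)) ≤ 2 * S.card := by
  set U : Matrix n n ℂ := (hA.eigenvectorUnitary : Matrix n n ℂ) with hU
  have hUU : U * Uᴴ = 1 := Unitary.coe_mul_star_self hA.eigenvectorUnitary
  have hUU' : Uᴴ * U = 1 := Unitary.coe_star_mul_self hA.eigenvectorUnitary
  set D : Matrix n n ℂ := diagonal (fun i => (hA.eigenvalues i : ℂ)) with hD
  have hAD : A = U * D * Uᴴ := hA.spectral_theorem
  have hNU : ∀ Z : Matrix n n ℂ, N (U * Z * Uᴴ) = N Z := by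
    intro Z
    have : U * Z * Uᴴ * (U * Z * Uᴴ)ᴴ = U * (Z * Zᴴ * Uᴴ) := by
      simp only [conjTranspose_mul, conjTranspose_conjTranspose]
      calc _ = U * Z * (Uᴴ * U) * Zᴴ * Uᴴ := by simp only [Matrix.mul_assoc]
        _ = _ := by rw [hUU']; simp only [Matrix.mul_assoc, Matrix.one_mul]
    rw [N, this, trace_mul_comm, Matrix.mul_assoc, hUU', Matrix.mul_one, N]
  have hl : ∑ i, hA.eigenvalues i ^ 2 = 1 := by
    have hND : N A = N D := (congrArg N hAD).trans (hNU D)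
    rw [← hA1, hND, N, hD, diagonal_conjTranspose, diagonal_mul_diagonal, trace_diagonal]
    simp [pow_two]
  set Y : ι → Matrix n n ℂ := fun s => Uᴴ * X s * U with hY
  have hC : ∀ s, N (C A (X s)) = N (C D (Y s)) := by
    intro s
    rw [← hNU (C D (Y s))]
    congr 1
    have e : X s = U * Y s * Uᴴ := by
      simp only [hY]
      calc X s = (U * Uᴴ) * X s * (U * Uᴴ) := by simp [hUU]
        _ = _ := by simp only [Matrix.mul_assoc]
    have key : ∀ P Q : Matrix n n ℂ, U * P * Uᴴ * (U * Q * Uᴴ) = U * (P * Q) * Uᴴ := by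
      intro P Q
      calc _ = U * P * (Uᴴ * U) * Q * Uᴴ := by simp only [Matrix.mul_assoc]
        _ = _ := by rw [hUU']; simp only [Matrix.mul_assoc, Matrix.one_mul]
    have hCA : C A (X s) = C (U * D * Uᴴ) (U * Y s * Uᴴ) := congrArg₂ C hAD e
    rw [hCA, C, C, key, key, Matrix.mul_sub, Matrix.sub_mul]
  simp only [hC]
  refine diag_est hA.eigenvalues hl S Y ?_
  intro r hr s hs
  rw [← hX r hr s hs]
  simp only [hY, conjTranspose_mul, conjTranspose_conjTranspose]
  calc trace (Uᴴ * X r * U * (Uᴴ * ((X s)ᴴ * U)))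
      = trace (Uᴴ * (X r * (U * Uᴴ) * (X s)ᴴ * U)) := by simp only [Matrix.mul_assoc]
    _ = trace (X r * (X s)ᴴ * (U * Uᴴ)) := by
        rw [trace_mul_comm, hUU]
        simp only [Matrix.mul_assoc, Matrix.mul_one, hUU]
    _ = _ := by rw [hUU, Matrix.mul_one]

lemma rot {ι : Type*} [Fintype ι] [DecidableEq ι] (O : Matrix ι ι ℝ) (hO : O * Oᵀ = 1)
    (X : ι → Matrix n n ℂ) :
    ∑ k, N (∑ r, O r k • X r) = ∑ r, N (X r) := by
  have real : ∀ x : ι → ℝ, ∑ k, (∑ r, O r k * x r) ^ 2 = ∑ r, x r ^ 2 := by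
    intro x
    have h1 : ∑ k, (∑ r, O r k * x r) ^ 2 = (Oᵀ *ᵥ x) ⬝ᵥ (Oᵀ *ᵥ x) := by
      simp [dotProduct, mulVec, pow_two]
    rw [h1, dotProduct_mulVec, vecMul_transpose, mulVec_mulVec, hO, one_mulVec]
    simp [dotProduct, pow_two]
  simp only [N_eq]
  rw [Finset.sum_comm, Finset.sum_comm (γ := ι)]
  refine Finset.sum_congr rfl fun i _ => ?_
  rw [Finset.sum_comm, Finset.sum_comm (γ := ι)]
  refine Finset.sum_congr rfl fun j _ => ?_
  have a := real fun r => (X r i j).re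
  have b := real fun r => (X r i j).im
  simp only [Complex.normSq_apply, ← pow_two, Finset.sum_add_distrib, Matrix.sum_apply,
    Matrix.smul_apply, Complex.re_sum, Complex.im_sum, Complex.smul_re, Complex.smul_im,
    smul_eq_mul]
  rw [a, b]

lemma C_sum_right {ι : Type*} [Fintype ι] (A : Matrix n n ℂ) (a : ι → ℝ) (X : ι → Matrix n n ℂ) :
    C A (∑ r, a r • X r) = ∑ r, a r • C A (X r) := by
  simp [C, Finset.mul_sum, Finset.sum_mul, smul_sub, Finset.sum_sub_distrib]

lemma C_sum_left {ι : Type*} [Fintype ι] (A : Matrix n n ℂ) (a : ι → ℝ) (X : ι → Matrix n n ℂ) :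
    C (∑ r, a r • X r) A = ∑ r, a r • C (X r) A := by
  simp [C, Finset.mul_sum, Finset.sum_mul, smul_sub, Finset.sum_sub_distrib]

/-- orthogonal Hermitian family -/
lemma herm_orth [DecidableEq n] {ι : Type*} [Fintype ι] [DecidableEq ι] (A : ι → Matrix n n ℂ)
    (hA : ∀ r, (A r).IsHermitian) (ho : ∀ r s, r ≠ s → trace (A r * A s) = 0) :
    ∑ r, ∑ s, N (C (A r) (A s)) ≤ 4 / 3 * (∑ r, N (A r)) ^ 2 := by
  set x : ι → ℝ := fun r => N (A r) with hx
  have hx0 : ∀ r, 0 ≤ x r := fun r => N_nonneg _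
  set a : ι → Matrix n n ℂ := fun r => (√(x r))⁻¹ • A r with ha
  have hAa : ∀ r, A r = √(x r) • a r := by
    intro r
    simp only [ha, smul_smul]
    by_cases h : x r = 0
    · simp [h, N_eq_zero h]
    · rw [mul_inv_cancel₀ (by rwa [Real.sqrt_ne_zero (hx0 r)]), one_smul]
  have haH : ∀ r, (a r).IsHermitian := by
    intro r
    simp [ha, IsHermitian, conjTranspose_smul, (hA r).eq]
  have hNC : ∀ r s, N (C (A r) (A s)) = N (C (a r) (a s)) * (x r * x s) := by
    intro r s
    have : C (A r) (A s) = (√(x r) * √(x s)) • C (a r) (a s) := by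
      conv_lhs => rw [hAa r, hAa s]
      simp [C, smul_sub, smul_smul, mul_comm]
    rw [this, N_smul, mul_pow, Real.sq_sqrt (hx0 r), Real.sq_sqrt (hx0 s)]
    ring
  have hN1 : ∀ r, x r ≠ 0 → N (a r) = 1 := by
    intro r h
    simp only [ha, N_smul, inv_pow]
    rw [Real.sq_sqrt (hx0 r)]
    exact inv_mul_cancel₀ h
  have hortho : ∀ r s, x r ≠ 0 → trace (a r * (a s)ᴴ) = if r = s then 1 else 0 := by
    intro r s hr
    split_ifs with h
    · subst h
      have h1 := hN1 r hr
      have him : (trace (a r * (a r)ᴴ)).im = 0 := by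
        simp [trace, Matrix.mul_apply, mul_comm]
      exact Complex.ext (by simpa [N] using h1) (by simpa using him)
    · rw [(haH s).eq]
      simp [ha, ho r s h]
  set P : Finset ι := Finset.univ.filter fun r => x r ≠ 0 with hP
  have main := layer (fun r s => N (C (a r) (a s)))
    (fun r s => by rw [C_swap, N_neg]) P (by
      intro T hT r hr
      have hxT : ∀ s ∈ T, x s ≠ 0 := fun s hs => by simpa [hP] using hT hs
      have est := herm_est (a r) (haH r) (hN1 r (hxT r hr)) (T.erase r) a
        (fun s hs u _ => hortho s u (hxT s (Finset.mem_of_mem_erase hs)))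
      have hz : N (C (a r) (a r)) = 0 := by simp [C, N]
      rw [Finset.sum_erase (f := fun s => N (C (a r) (a s))) _ hz] at est
      have hcard : ((T.erase r).card : ℝ) = T.card - 1 := by
        rw [Finset.card_erase_of_mem hr, Nat.cast_sub (Finset.card_pos.mpr ⟨r, hr⟩)]
        simp
      rw [hcard] at est
      by_cases h3 : 3 ≤ T.card
      · have : (3 : ℝ) ≤ T.card := by exact_mod_cast h3
        linarith [est.1]
      · have : (T.card : ℝ) ≤ 2 := by
          have : T.card ≤ 2 := by omega
          exact_mod_cast this
        linarith [est.2]) x (fun i _ => hx0 i)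
  have s1 : ∑ r ∈ P, x r = ∑ r, x r := Finset.sum_filter_ne_zero _
  have s2 : ∑ r ∈ P, ∑ s ∈ P, N (C (a r) (a s)) * (x r * x s)
      = ∑ r, ∑ s, N (C (a r) (a s)) * (x r * x s) := by
    have z : ∀ r, r ∉ P → x r = 0 := by
      intro r hr
      simpa [hP] using hr
    rw [Finset.sum_subset (Finset.subset_univ P) (fun r _ hr => by simp [z r hr])]
    refine Finset.sum_congr rfl fun r _ => ?_
    exact Finset.sum_subset (Finset.subset_univ P) (fun s _ hs => by simp [z s hs])
  simp only [hNC]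
  rw [← s1, ← s2]
  exact main

lemma herm [DecidableEq n] {ι : Type*} [Fintype ι] [DecidableEq ι] (A : ι → Matrix n n ℂ)
    (hA : ∀ r, (A r).IsHermitian) :
    ∑ r, ∑ s, N (C (A r) (A s)) ≤ 4 / 3 * (∑ r, N (A r)) ^ 2 := by
  set G : Matrix ι ι ℝ := fun r s => (trace (A r * A s)).re with hG
  have him : ∀ r s, trace (A r * A s) = ((G r s : ℝ) : ℂ) := by
    intro r s
    have : star (trace (A r * A s)) = trace (A r * A s) := by
      rw [← trace_conjTranspose, conjTranspose_mul, (hA r).eq, (hA s).eq, trace_mul_comm]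
    exact (Complex.conj_eq_iff_re.mp this).symm
  have hGH : G.IsHermitian := by
    ext r s
    change (trace (A s * A r)).re = (trace (A r * A s)).re
    rw [trace_mul_comm]
  set O : Matrix ι ι ℝ := (hGH.eigenvectorUnitary : Matrix ι ι ℝ) with hO
  have hOO : O * Oᵀ = 1 := Unitary.coe_mul_star_self hGH.eigenvectorUnitary
  have hOO' : Oᵀ * O = 1 := Unitary.coe_star_mul_self hGH.eigenvectorUnitary
  have hGD : G = O * diagonal hGH.eigenvalues * Oᵀ := hGH.spectral_theorem
  have hDG : Oᵀ * G * O = diagonal hGH.eigenvalues := by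
    have : Oᵀ * G * O = Oᵀ * (O * diagonal hGH.eigenvalues * Oᵀ) * O :=
      congrArg (fun M => Oᵀ * M * O) hGD
    rw [this]
    calc _ = (Oᵀ * O) * diagonal hGH.eigenvalues * (Oᵀ * O) := by simp only [Matrix.mul_assoc]
      _ = _ := by simp [hOO']
  have h := herm_orth (fun k => ∑ r, O r k • A r)
    (fun k => by
      simp [IsHermitian, conjTranspose_sum, conjTranspose_smul, (hA _).eq])
    (fun k l hkl => by
      have e : (Oᵀ * G * O) k l = 0 := by
        rw [hDG]
        exact diagonal_apply_ne _ hkl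
      have : trace ((∑ r, O r k • A r) * (∑ r, O r l • A r)) = (((Oᵀ * G * O) k l : ℝ) : ℂ) := by
        simp only [Matrix.mul_apply, transpose_apply, Finset.sum_mul, Finset.mul_sum, trace_sum,
          Matrix.smul_mul, Matrix.mul_smul, trace_smul, him]
        push_cast
        refine Finset.sum_congr rfl fun r _ => Finset.sum_congr rfl fun s _ => ?_
        simp
        ring
      rw [this, e]
      simp)
  rw [rot O hOO] at h
  refine le_trans (le_of_eq ?_) h
  simp only [C_sum_right, rot O hOO]
  rw [Finset.sum_comm]
  conv_rhs => rw [Finset.sum_comm]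
  refine Finset.sum_congr rfl fun s _ => ?_
  simp only [C_sum_left, rot O hOO]

lemma cross (X Y : Matrix n n ℂ) :
    N (C X Yᴴ) - N (C X Y) = (trace (C X Xᴴ * (C Y Yᴴ)ᴴ)).re := by
  simp only [N, C, conjTranspose_sub, conjTranspose_mul, conjTranspose_conjTranspose,
    Matrix.mul_sub, Matrix.sub_mul, trace_sub, Complex.sub_re, ← Matrix.mul_assoc]
  have c1 : trace (X * Yᴴ * Y * Xᴴ) = trace (Xᴴ * X * Yᴴ * Y) := by
    rw [trace_mul_comm]; simp only [Matrix.mul_assoc]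
  have c2 : trace (Yᴴ * X * Xᴴ * Y) = trace (X * Xᴴ * Y * Yᴴ) := by
    rw [Matrix.mul_assoc, Matrix.mul_assoc, trace_mul_comm]; simp only [Matrix.mul_assoc]
  have c3 : trace (X * Y * Yᴴ * Xᴴ) = trace (Xᴴ * X * Y * Yᴴ) := by
    rw [trace_mul_comm]; simp only [Matrix.mul_assoc]
  have c4 : trace (Y * X * Xᴴ * Yᴴ) = trace (X * Xᴴ * Yᴴ * Y) := by
    rw [Matrix.mul_assoc, Matrix.mul_assoc, trace_mul_comm]; simp only [Matrix.mul_assoc]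
  have c5 : trace (X * Yᴴ * Xᴴ * Y) = trace (Y * X * Yᴴ * Xᴴ) := by
    rw [trace_mul_comm]; simp only [Matrix.mul_assoc]
  have c6 : trace (Yᴴ * X * Y * Xᴴ) = trace (X * Y * Xᴴ * Yᴴ) := by
    rw [Matrix.mul_assoc, Matrix.mul_assoc, trace_mul_comm]; simp only [Matrix.mul_assoc]
  rw [c1, c2, c3, c4, c5, c6]
  ring

lemma cross_sum {ι : Type*} [Fintype ι] (B : ι → Matrix n n ℂ) :
    ∑ r, ∑ s, N (C (B r) (B s)) ≤ ∑ r, ∑ s, N (C (B r) (B s)ᴴ) := by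
  rw [← sub_nonneg]
  simp only [← Finset.sum_sub_distrib, cross]
  have : ∑ r, ∑ s, (trace (C (B r) (B r)ᴴ * (C (B s) (B s)ᴴ)ᴴ)).re
      = N (∑ r, C (B r) (B r)ᴴ) := by
    simp only [N, conjTranspose_sum, Finset.sum_mul, Finset.mul_sum, trace_sum, Complex.re_sum]
    exact Finset.sum_comm
  rw [this]
  exact N_nonneg _

lemma four (H K H' K' : Matrix n n ℂ) (hH : Hᴴ = H) (hK : Kᴴ = K) (hH' : H'ᴴ = H')
    (hK' : K'ᴴ = K') :
    N (C (H + Complex.I • K) (H' + Complex.I • K'))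
      + N (C (H + Complex.I • K) (H' - Complex.I • K'))
      = 2 * (N (C H H') + N (C H K') + N (C K H') + N (C K K')) := by
  have one : ∀ Z : Matrix n n ℂ, Zᴴ = Z →
      N (C (H + Complex.I • K) Z) = N (C H Z) + N (C K Z) := by
    intro Z hZ
    have e1 : C (H + Complex.I • K) Z = C H Z + Complex.I • C K Z := by
      simp [C, Matrix.add_mul, Matrix.mul_add, smul_sub]
      abel
    have e2 : (C (H + Complex.I • K) Z)ᴴ = -(C H Z - Complex.I • C K Z) := by
      simp [C, Matrix.add_mul, Matrix.mul_add, smul_sub, conjTranspose_smul, hH, hK, hZ]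
      abel
    have e3 := N_conj (C (H + Complex.I • K) Z)
    rw [e2, N_neg] at e3
    have e4 := N_par (C H Z) (C K Z)
    rw [← e1, e3] at e4
    linarith
  have p := N_par (C (H + Complex.I • K) H') (C (H + Complex.I • K) K')
  have f1 : C (H + Complex.I • K) (H' + Complex.I • K')
      = C (H + Complex.I • K) H' + Complex.I • C (H + Complex.I • K) K' := by
    simp only [C, Matrix.mul_add, Matrix.add_mul _ _ (H + Complex.I • K), Matrix.mul_smul,
      Matrix.smul_mul _ _ (H + Complex.I • K), smul_sub]
    abel
  have f2 : C (H + Complex.I • K) (H' - Complex.I • K')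
      = C (H + Complex.I • K) H' - Complex.I • C (H + Complex.I • K) K' := by
    simp only [C, Matrix.mul_sub, Matrix.sub_mul _ _ (H + Complex.I • K), Matrix.mul_smul,
      Matrix.smul_mul _ _ (H + Complex.I • K), smul_sub]
    abel
  rw [f1, f2, p, one _ hH', one _ hK']
  ring

lemma general [DecidableEq n] {ι : Type*} [Fintype ι] [DecidableEq ι] (B : ι → Matrix n n ℂ) :
    ∑ r, ∑ s, N (C (B r) (B s)) ≤ 4 / 3 * (∑ r, N (B r)) ^ 2 := by
  set H : ι → Matrix n n ℂ := fun r => (1 / 2 : ℂ) • (B r + (B r)ᴴ) with hH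
  set K : ι → Matrix n n ℂ := fun r => (-Complex.I / 2) • (B r - (B r)ᴴ) with hK
  have hHh : ∀ r, (H r)ᴴ = H r := by
    intro r
    simp [hH, conjTranspose_smul, add_comm]
  have hKh : ∀ r, (K r)ᴴ = K r := by
    intro r
    simp only [hK, conjTranspose_smul, conjTranspose_sub, conjTranspose_conjTranspose]
    rw [← neg_sub (B r), smul_neg, ← neg_smul]
    congr 1
    simp
    ring
  have hB : ∀ r, B r = H r + Complex.I • K r := by
    intro r
    ext i j
    simp [hH, hK]
    linear_combination (1 / 2 * (B r i j - starRingEnd ℂ (B r j i))) * Complex.I_mul_I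
  have hBs : ∀ r, (B r)ᴴ = H r - Complex.I • K r := by
    intro r
    ext i j
    simp [hH, hK]
    linear_combination (-1 / 2 * (B r i j - starRingEnd ℂ (B r j i))) * Complex.I_mul_I
  have hNB : ∀ r, N (B r) = N (H r) + N (K r) := by
    intro r
    have := N_par (H r) (K r)
    rw [← hB, ← hBs, N_conj] at this
    linarith
  have h4 : ∀ r s, N (C (B r) (B s)) + N (C (B r) (B s)ᴴ)
      = 2 * (N (C (H r) (H s)) + N (C (H r) (K s)) + N (C (K r) (H s)) + N (C (K r) (K s))) := by
    intro r s
    rw [hBs s, hB r, hB s]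
    exact four _ _ _ _ (hHh r) (hKh r) (hHh s) (hKh s)
  have hh := herm (Sum.elim H K) (by
    rintro (r | r)
    · exact hHh r
    · exact hKh r)
  simp only [Fintype.sum_sum_type, Sum.elim_inl, Sum.elim_inr] at hh
  rw [← Finset.sum_add_distrib (f := fun r => N (H r))] at hh
  simp only [← hNB] at hh
  have hc := cross_sum B
  have hs : ∑ r, ∑ s, N (C (B r) (B s)) + ∑ r, ∑ s, N (C (B r) (B s)ᴴ)
      = 2 * (∑ r, (∑ s, N (C (H r) (H s)) + ∑ s, N (C (H r) (K s)))
        + ∑ r, (∑ s, N (C (K r) (H s)) + ∑ s, N (C (K r) (K s)))) := by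
    simp only [← Finset.sum_add_distrib, h4, Finset.mul_sum]
    refine Finset.sum_congr rfl fun r _ => Finset.sum_congr rfl fun s _ => ?_
    ring
  linarith

end

end DDVV

/-- DDVV-type inequality for general complex matrices, m ≥ 3. -/
theorem ddvv_complex (m n : ℕ) (hm : 3 ≤ m) (hn : 2 ≤ n)
    (B : Fin m → Matrix (Fin n) (Fin n) ℂ) :
    ∑ r, ∑ s, (trace ((B r * B s - B s * B r) * (B r * B s - B s * B r)ᴴ)).re ≤
      (4 / 3) * (∑ r, (trace (B r * (B r)ᴴ)).re) ^ 2 :=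
  DDVV.general B
end

section
/- For any two complex n×n matrices B₁, B₂, one has ∑_{r,s=1}^2 ‖[B_r,B_s]‖² ≤ (‖B₁‖² + ‖B₂‖²)², i.e., 2‖[B₁,B₂]‖² ≤ (‖B₁‖² + ‖B₂‖²)². -/
open Matrix

section helpers

open scoped ComplexOrder

lemma weights_aux {n : ℕ} (w a : Fin n → ℝ) (hw : ∀ i, 0 ≤ w i) :
    (∑ i, w i) * (∑ i, a i ^ 2 * w i) - (∑ i, a i * w i) ^ 2 ≤
      (∑ i, w i) ^ 2 * (∑ i, a i ^ 2) / 2 := by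
  rcases isEmpty_or_nonempty (Fin n) with h | h
  · simp
  obtain ⟨k, hk⟩ := Finite.exists_max a
  obtain ⟨l, hl⟩ := Finite.exists_min a
  have hS : (a k - a l) ^ 2 ≤ 2 * ∑ i, a i ^ 2 := by
    by_cases hkl : k = l
    · subst hkl
      have : 0 ≤ ∑ i, a i ^ 2 := Finset.sum_nonneg fun i _ => sq_nonneg _
      nlinarith
    · have : ∑ i ∈ {k, l}, a i ^ 2 ≤ ∑ i, a i ^ 2 :=
        Finset.sum_le_sum_of_subset_of_nonneg (Finset.subset_univ _) fun i _ _ => sq_nonneg _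
      rw [Finset.sum_pair hkl] at this
      nlinarith [sq_nonneg (a k + a l)]
  have ht : 0 ≤ ∑ i, w i := Finset.sum_nonneg fun i _ => hw i
  have h2 : ∑ i, a i ^ 2 * w i ≤ (a k + a l) * (∑ i, a i * w i) - a k * a l * ∑ i, w i := by
    rw [Finset.mul_sum, Finset.mul_sum, ← Finset.sum_sub_distrib]
    refine Finset.sum_le_sum fun i _ => ?_
    have := mul_nonneg (mul_nonneg (sub_nonneg.2 (hk i)) (sub_nonneg.2 (hl i))) (hw i)
    nlinarith
  generalize ∑ i, w i = t at *
  generalize ∑ i, a i * w i = m at *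
  generalize ∑ i, a i ^ 2 * w i = v at *
  generalize ∑ i, a i ^ 2 = S at *
  have h3 := mul_le_mul_of_nonneg_left h2 ht
  have h4 := mul_le_mul_of_nonneg_left hS (sq_nonneg t)
  nlinarith [sq_nonneg (2 * m - (a k + a l) * t)]

lemma herm_aux {n : ℕ} (A P : Matrix (Fin n) (Fin n) ℂ) (hA : A.IsHermitian)
    (hP : P.PosSemidef) :
    (trace P).re * (trace (A * A * P)).re - (trace (A * P)).re ^ 2 ≤
      (trace P).re ^ 2 * (trace (A * A)).re / 2 := by
  set U : Matrix (Fin n) (Fin n) ℂ := (hA.eigenvectorUnitary : Matrix (Fin n) (Fin n) ℂ) with hU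
  have hUU : Uᴴ * U = 1 := by
    simpa [star_eq_conjTranspose] using Unitary.coe_star_mul_self hA.eigenvectorUnitary
  have hUU' : U * Uᴴ = 1 := mul_eq_one_comm.1 hUU
  set a := hA.eigenvalues with ha
  set D : Matrix (Fin n) (Fin n) ℂ := diagonal (fun i => (a i : ℂ)) with hD
  have hs : A = U * D * Uᴴ := by
    have := hA.spectral_theorem
    rw [Unitary.conjStarAlgAut_apply] at this
    exact this
  set Q := Uᴴ * P * U with hQ
  have hQp : Q.PosSemidef := hP.conjTranspose_mul_mul_same U
  have hAA : A * A = U * (D * D) * Uᴴ := by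
    rw [hs]
    calc U * D * Uᴴ * (U * D * Uᴴ) = U * D * (Uᴴ * U) * D * Uᴴ := by simp only [mul_assoc]
      _ = _ := by rw [hUU]; simp only [mul_assoc, one_mul]
  have key : ∀ M : Matrix (Fin n) (Fin n) ℂ, trace (U * M * Uᴴ * P) = trace (M * Q) := by
    intro M
    rw [mul_assoc, mul_assoc, trace_mul_comm, hQ]
    simp only [mul_assoc]
  have e1 : (trace P).re = ∑ i, (Q i i).re := by
    have := key 1
    rw [mul_one, hUU', one_mul, one_mul] at this
    rw [this]; simp [trace]
  have e2 : (trace (A * P)).re = ∑ i, a i * (Q i i).re := by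
    rw [hs, key, hD]; simp [trace, diagonal_mul]
  have e3 : (trace (A * A * P)).re = ∑ i, a i ^ 2 * (Q i i).re := by
    rw [hAA, key, hD, diagonal_mul_diagonal]; simp [trace, diagonal_mul, ← pow_two, ← Complex.ofReal_pow]
  have e4 : (trace (A * A)).re = ∑ i, a i ^ 2 := by
    rw [hAA, trace_mul_comm, ← mul_assoc, hUU, one_mul, hD, diagonal_mul_diagonal]
    simp [trace, ← pow_two, ← Complex.ofReal_pow]
  rw [e1, e2, e3, e4]
  exact weights_aux _ _ fun i => (Complex.le_def.1 (hQp.diag_nonneg (i := i))).1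

lemma fro_nonneg {n : ℕ} (A : Matrix (Fin n) (Fin n) ℂ) : 0 ≤ (trace (A * Aᴴ)).re :=
  (Complex.le_def.1 (posSemidef_self_mul_conjTranspose A).trace_nonneg).1

lemma fro_im {n : ℕ} (A : Matrix (Fin n) (Fin n) ℂ) : (trace (A * Aᴴ)).im = 0 :=
  (Complex.le_def.1 (posSemidef_self_mul_conjTranspose A).trace_nonneg).2.symm

lemma fro_cs {n : ℕ} (Y Z : Matrix (Fin n) (Fin n) ℂ) :
    (trace (Z * Yᴴ)).re ^ 2 + (trace (Z * Yᴴ)).im ^ 2 ≤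
      (trace (Y * Yᴴ)).re * (trace (Z * Zᴴ)).re := by
  rcases (fro_nonneg Y).eq_or_lt with h | h
  · have : trace (Y * Yᴴ) = 0 := Complex.ext h.symm (fro_im Y)
    rw [trace_mul_conjTranspose_self_eq_zero_iff] at this
    simp [this]
  have h1 := fro_nonneg (trace (Y * Yᴴ) • Z - trace (Z * Yᴴ) • Y)
  have hc : trace (Y * Zᴴ) = star (trace (Z * Yᴴ)) := by
    rw [← trace_conjTranspose, conjTranspose_mul, conjTranspose_conjTranspose]
  have hy := fro_im Y
  have hz := fro_im Z
  simp only [conjTranspose_sub, conjTranspose_smul, sub_mul, mul_sub, smul_mul_assoc,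
    mul_smul_comm, trace_sub, trace_smul, hc, smul_eq_mul] at h1
  generalize trace (Y * Yᴴ) = y at *
  generalize trace (Z * Zᴴ) = z at *
  generalize trace (Z * Yᴴ) = t at *
  simp [hy, hz] at h1
  refine le_of_mul_le_mul_left ?_ h
  nlinarith

lemma bw_aux {n : ℕ} (X Y : Matrix (Fin n) (Fin n) ℂ) :
    (trace ((X * Y - Y * X) * (X * Y - Y * X)ᴴ)).re ≤
      2 * (trace (X * Xᴴ)).re * (trace (Y * Yᴴ)).re := by
  rcases (fro_nonneg Y).eq_or_lt with h | h
  · have : trace (Y * Yᴴ) = 0 := Complex.ext h.symm (fro_im Y)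
    rw [trace_mul_conjTranspose_self_eq_zero_iff] at this
    simp [this]
  obtain ⟨A, B, hA, hB, rfl⟩ : ∃ A B : Matrix (Fin n) (Fin n) ℂ, A.IsHermitian ∧ B.IsHermitian ∧
      X = A + Complex.I • B := by
    refine ⟨(1/2 : ℂ) • (X + Xᴴ), (-Complex.I/2 : ℂ) • (X - Xᴴ), ?_, ?_, ?_⟩
    · simp [IsHermitian, conjTranspose_smul, add_comm]
    · simp only [IsHermitian, conjTranspose_smul, conjTranspose_sub, conjTranspose_conjTranspose]
      rw [← neg_sub X, smul_neg, ← neg_smul]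
      congr 1
      simp [neg_div]
    · rw [smul_smul, show Complex.I * (-Complex.I/2) = 1/2 by
        linear_combination (-1/2 : ℂ) * Complex.I_mul_I, ← smul_add, add_add_sub_cancel,
        ← two_smul ℂ X, smul_smul]
      norm_num
  set P := Y * Yᴴ + Yᴴ * Y with hPd
  have hP : P.PosSemidef :=
    (posSemidef_self_mul_conjTranspose Y).add (posSemidef_conjTranspose_mul_self Y)
  have hPt : (trace P).re = 2 * (trace (Y * Yᴴ)).re := by
    rw [hPd, trace_add, trace_mul_comm Yᴴ Y]; simp; ring
  have im0 : ∀ M : Matrix (Fin n) (Fin n) ℂ, M.IsHermitian → (trace (M * P)).im = 0 := by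
    intro M hM
    have : star (trace (M * P)) = trace (M * P) := by
      rw [← trace_conjTranspose, conjTranspose_mul, hM.eq, hP.1.eq, trace_mul_comm]
    exact Complex.conj_eq_iff_im.1 this
  have hXs : (A + Complex.I • B)ᴴ = A - Complex.I • B := by
    simp [hA.eq, hB.eq, sub_eq_add_neg]
  have ha := herm_aux A P hA hP
  have hb := herm_aux B P hB hP
  have hc := fro_cs Y ((A - Complex.I • B) * Y + Y * (A - Complex.I • B))
  have hx : (trace ((A + Complex.I • B) * (A + Complex.I • B)ᴴ)).re
      = (trace (A * A)).re + (trace (B * B)).re := by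
    rw [hXs]
    simp only [add_mul, mul_sub, smul_mul_assoc, mul_smul_comm, trace_add, trace_sub, trace_smul,
      smul_eq_mul, trace_mul_comm B A, Complex.add_re, Complex.add_im, Complex.sub_re, Complex.mul_re,
      Complex.mul_im, Complex.I_re, Complex.I_im]
    ring
  have ht : trace (((A - Complex.I • B) * Y + Y * (A - Complex.I • B)) * Yᴴ)
      = trace (A * P) - Complex.I * trace (B * P) := by
    have : ∀ M : Matrix (Fin n) (Fin n) ℂ, trace (Y * (M * Yᴴ)) = trace (M * (Yᴴ * Y)) := by
      intro M; rw [trace_mul_comm, mul_assoc]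
    simp only [hPd, add_mul, sub_mul, mul_add, mul_sub, smul_mul_assoc, mul_smul_comm, trace_add,
      trace_sub, trace_smul, smul_eq_mul, mul_assoc, this]
    ring
  have hid : ∀ X W : Matrix (Fin n) (Fin n) ℂ, Xᴴ = W →
      (trace ((X * Y - Y * X) * (X * Y - Y * X)ᴴ)).re
      + (trace ((W * Y + Y * W) * (W * Y + Y * W)ᴴ)).re = (trace ((X * W + W * X) * P)).re := by
    intro X W hW
    have hW' : Wᴴ = X := by rw [← hW, conjTranspose_conjTranspose]
    have r : ∀ M N : Matrix (Fin n) (Fin n) ℂ, trace (Y * (M * (N * Yᴴ))) =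
        trace (M * (N * (Yᴴ * Y))) := by
      intro M N; rw [trace_mul_comm]; simp only [mul_assoc]
    have r2 : ∀ M N : Matrix (Fin n) (Fin n) ℂ, trace (M * (Y * (Yᴴ * N))) =
        trace (N * (M * (Y * Yᴴ))) := by
      intro M N; rw [trace_mul_comm N]; simp only [mul_assoc]
    have c1 : trace (Y * (X * (Yᴴ * W))) = star (trace (X * (Y * (W * Yᴴ)))) := by
      rw [← trace_conjTranspose]; simp [hW, hW', mul_assoc]
    have c2 : trace (W * (Y * (X * Yᴴ))) = star (trace (X * (Y * (W * Yᴴ)))) := by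
      rw [← c1, trace_mul_comm W]; simp only [mul_assoc]
    have c3 : trace (Y * (W * (Yᴴ * X))) = trace (X * (Y * (W * Yᴴ))) := by
      rw [trace_mul_comm X]; simp only [mul_assoc]
    simp only [conjTranspose_sub, conjTranspose_add, conjTranspose_mul, hW, hW', hPd, add_mul,
      sub_mul, mul_add, mul_sub, mul_assoc, trace_add, trace_sub, r, r2, c1, c2, c3,
      Complex.add_re, Complex.sub_re]
    ring
  have hq : (trace (((A + Complex.I • B) * (A - Complex.I • B)
      + (A - Complex.I • B) * (A + Complex.I • B)) * P)).re
      = 2 * ((trace (A * A * P)).re + (trace (B * B * P)).re) := by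
    have : ((A + Complex.I • B) * (A - Complex.I • B)
      + (A - Complex.I • B) * (A + Complex.I • B)) = (2:ℂ) • (A * A + B * B) := by
      simp only [add_mul, sub_mul, mul_add, mul_sub, smul_mul_assoc, mul_smul_comm, smul_add,
        smul_sub, smul_smul, Complex.I_mul_I]
      module
    rw [this]; simp [add_mul, mul_add]
  have h1 := hid _ _ hXs
  rw [hq] at h1
  rw [ht] at hc
  have iA := im0 A hA
  have iB := im0 B hB
  simp only [Complex.sub_re, Complex.sub_im, Complex.mul_re, Complex.mul_im, Complex.I_re,
    Complex.I_im, iA, iB] at hc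
  rw [hx]
  rw [hPt] at ha hb
  refine le_of_mul_le_mul_left ?_ h
  rw [← eq_sub_iff_add_eq] at h1
  rw [h1]
  nlinarith

end helpers

/-- DDVV-type inequality for two general complex matrices. -/
theorem ddvv_complex_two (n : ℕ) (B : Fin 2 → Matrix (Fin n) (Fin n) ℂ) :
    ∑ r, ∑ s, (trace ((B r * B s - B s * B r) * (B r * B s - B s * B r)ᴴ)).re ≤
      ((trace (B 0 * (B 0)ᴴ)).re + (trace (B 1 * (B 1)ᴴ)).re) ^ 2 := by
  have h1 := bw_aux (B 0) (B 1)
  have h2 := bw_aux (B 1) (B 0)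
  simp only [Fin.sum_univ_two, sub_self, zero_mul, trace_zero, Complex.zero_re]
  nlinarith [sq_nonneg ((trace (B 0 * (B 0)ᴴ)).re - (trace (B 1 * (B 1)ᴴ)).re)]
end
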